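/- For any computable consistent extensions T and U of PA and any n ≥ 1, there exists a B(Σ_n) sentence φ such that φ ∈ Cons(Σ_n∧Π_n,T) ∩ Cons(Σ_n∧Π_n,U), T ⊬ φ, and U ⊬ φ. -/

import Mathlib

open FirstOrder Language
open scoped FirstOrder

namespace Guaspari

/-- The first-order language of arithmetic: a constant `0`, a unary function `S`,
binary functions `+` (coded `false`) and `·` (coded `true`), and a binary relation `≤`. -/
def LA : FirstOrder.Language :=
  ⟨fun n => match n with | 0 => Unit | 1 => Unit | 2 => Bool | _ => Empty,
   fun n => match n with | 2 => Unit | _ => Empty⟩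

/-- Sentences of the language of arithmetic. -/
abbrev Snt : Type := LA.Sentence

/-- Theories (sets of sentences) in the language of arithmetic. -/
abbrev Thy : Type := LA.Theory

/-- The term `0`. -/
def zeroT {α : Type} {n : ℕ} : LA.Term (α ⊕ Fin n) :=
  Constants.term (show LA.Constants from Unit.unit)

/-- The term `S t`. -/
def succT {α : Type} {n : ℕ} (t : LA.Term (α ⊕ Fin n)) : LA.Term (α ⊕ Fin n) :=
  Functions.apply₁ (show LA.Functions 1 from Unit.unit) t

/-- The term `t + u`. -/
def addT {α : Type} {n : ℕ} (t u : LA.Term (α ⊕ Fin n)) : LA.Term (α ⊕ Fin n) :=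
  Functions.apply₂ (show LA.Functions 2 from false) t u

/-- The term `t * u`. -/
def mulT {α : Type} {n : ℕ} (t u : LA.Term (α ⊕ Fin n)) : LA.Term (α ⊕ Fin n) :=
  Functions.apply₂ (show LA.Functions 2 from true) t u

/-- The atomic formula `t ≤ u`. -/
def leF {α : Type} {n : ℕ} (t u : LA.Term (α ⊕ Fin n)) : LA.BoundedFormula α n :=
  Relations.boundedFormula₂ (show LA.Relations 2 from Unit.unit) t u

/-- The `i`-th (de Bruijn-indexed) bound variable as a term. -/
def vT {m : ℕ} (i : Fin m) : LA.Term (Empty ⊕ Fin m) := Term.var (Sum.inr i)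

/-- The induction axiom for the formula `φ(x₀,…,x_{k-1}, x_k)` with induction on `x_k`,
universally closed over the parameters `x₀,…,x_{k-1}`. -/
def indAxiom {k : ℕ} (φ : LA.BoundedFormula Empty (k + 1)) : Snt :=
  let base := ∀' ((vT (Fin.last k) =' zeroT) ⟹ φ)
  let step := ∀' (φ ⟹
    ∀' ((vT (Fin.last (k + 1)) =' succT (vT (Fin.castSucc (Fin.last k)))) ⟹ φ.liftAt 1 k))
  ((base ⊓ step) ⟹ ∀' φ).alls

/-- The axioms of Peano arithmetic `PA`: the basic axioms for `0`, `S`, `+`, `·`, `≤`,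
together with the full induction scheme. -/
def PAAx : Thy :=
  {∀' ∼(succT (vT 0) =' zeroT),
   ∀' ∀' ((succT (vT 0) =' succT (vT 1)) ⟹ (vT 0 =' vT 1)),
   ∀' (addT (vT 0) zeroT =' vT 0),
   ∀' ∀' (addT (vT 0) (succT (vT 1)) =' succT (addT (vT 0) (vT 1))),
   ∀' (mulT (vT 0) zeroT =' zeroT),
   ∀' ∀' (mulT (vT 0) (succT (vT 1)) =' addT (mulT (vT 0) (vT 1)) (vT 0)),
   ∀' ∀' (leF (vT 0) (vT 1) ⇔ ∃' (addT (vT 2) (vT 0) =' vT 1))} ∪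
  {φ | ∃ (k : ℕ) (ψ : LA.BoundedFormula Empty (k + 1)), φ = indAxiom ψ}

/-- `Prv T φ`: the sentence `φ` is provable from the theory `T` (equivalently, by the
Gödel completeness theorem, `φ` holds in every model of `T`). -/
def Prv (T : Thy) (φ : Snt) : Prop := T ⊨ᵇ φ

/-- `Th T`: the set of sentences provable from `T`. -/
def Th (T : Thy) : Set Snt := {φ | Prv T φ}

/-- `Con T`: the theory `T` is consistent. -/
def Con (T : Thy) : Prop := ¬ Prv T ⊥

/-- The theory `T + φ`. -/
def add (T : Thy) (φ : Snt) : Thy := insert φ T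

/-- `T` is an extension of `PA`. -/
def ExtPA (T : Thy) : Prop := ∀ φ ∈ PAAx, Prv T φ

/-- `V` is a subtheory of `T` (containing `PA`, as assumed throughout the paper). -/
def SubThy (V T : Thy) : Prop := ExtPA V ∧ ∀ φ, Prv V φ → Prv T φ

/-- Δ₀ (bounded) formulas. -/
inductive IsDelta0 : ∀ {m : ℕ}, LA.BoundedFormula Empty m → Prop
  | falsum {m : ℕ} : IsDelta0 (⊥ : LA.BoundedFormula Empty m)
  | equal {m : ℕ} (t u : LA.Term (Empty ⊕ Fin m)) : IsDelta0 (t =' u)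
  | le {m : ℕ} (t u : LA.Term (Empty ⊕ Fin m)) : IsDelta0 (leF t u)
  | imp {m : ℕ} {φ ψ : LA.BoundedFormula Empty m} :
      IsDelta0 φ → IsDelta0 ψ → IsDelta0 (φ ⟹ ψ)
  | ball {m : ℕ} (t : LA.Term (Empty ⊕ Fin m)) {φ : LA.BoundedFormula Empty (m + 1)} :
      IsDelta0 φ →
      IsDelta0 (∀' (leF (vT (Fin.last m)) (t.relabel (Sum.map id Fin.castSucc)) ⟹ φ))
  | bex {m : ℕ} (t : LA.Term (Empty ⊕ Fin m)) {φ : LA.BoundedFormula Empty (m + 1)} :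
      IsDelta0 φ →
      IsDelta0 (∃' (leF (vT (Fin.last m)) (t.relabel (Sum.map id Fin.castSucc)) ⊓ φ))

mutual
  /-- `Σ_k` formulas (cumulatively: every `Π_k` formula is `Σ_{k+1}`). -/
  inductive IsSigmaFml : ℕ → ∀ {m : ℕ}, LA.BoundedFormula Empty m → Prop
    | ofDelta0 {m : ℕ} {φ : LA.BoundedFormula Empty m} : IsDelta0 φ → IsSigmaFml 0 φ
    | ofPi {k : ℕ} {m : ℕ} {φ : LA.BoundedFormula Empty m} :
        IsPiFml k φ → IsSigmaFml (k + 1) φ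
    | ex {k : ℕ} {m : ℕ} {φ : LA.BoundedFormula Empty (m + 1)} :
        IsSigmaFml (k + 1) φ → IsSigmaFml (k + 1) (∃' φ)
  /-- `Π_k` formulas (cumulatively: every `Σ_k` formula is `Π_{k+1}`). -/
  inductive IsPiFml : ℕ → ∀ {m : ℕ}, LA.BoundedFormula Empty m → Prop
    | ofDelta0 {m : ℕ} {φ : LA.BoundedFormula Empty m} : IsDelta0 φ → IsPiFml 0 φ
    | ofSigma {k : ℕ} {m : ℕ} {φ : LA.BoundedFormula Empty m} :
        IsSigmaFml k φ → IsPiFml (k + 1) φ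
    | all {k : ℕ} {m : ℕ} {φ : LA.BoundedFormula Empty (m + 1)} :
        IsPiFml (k + 1) φ → IsPiFml (k + 1) (∀' φ)
end

/-- The set of `Σ_k` sentences. -/
def SigmaS (k : ℕ) : Set Snt := {φ | IsSigmaFml k φ}

/-- The set of `Π_k` sentences. -/
def PiS (k : ℕ) : Set Snt := {φ | IsPiFml k φ}

/-- The set of `Σ_k ∧ Π_k` sentences, i.e. sentences of the form `σ ∧ π` with
`σ` a `Σ_k` sentence and `π` a `Π_k` sentence. -/
def SigAndPiS (k : ℕ) : Set Snt :=
  {φ | ∃ σ ∈ SigmaS k, ∃ π ∈ PiS k, φ = σ ⊓ π}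

/-- `B(Σ_k)` sentences: Boolean combinations of `Σ_k` sentences. -/
inductive IsBoolSigma (k : ℕ) : Snt → Prop
  | base {φ : Snt} : φ ∈ SigmaS k → IsBoolSigma k φ
  | not {φ : Snt} : IsBoolSigma k φ → IsBoolSigma k (∼φ)
  | imp {φ ψ : Snt} : IsBoolSigma k φ → IsBoolSigma k ψ → IsBoolSigma k (φ ⟹ ψ)
  | inf {φ ψ : Snt} : IsBoolSigma k φ → IsBoolSigma k ψ → IsBoolSigma k (φ ⊓ ψ)
  | sup {φ ψ : Snt} : IsBoolSigma k φ → IsBoolSigma k ψ → IsBoolSigma k (φ ⊔ ψ)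

/-- The set of `B(Σ_k)` sentences. -/
def BSigmaS (k : ℕ) : Set Snt := {φ | IsBoolSigma k φ}

/-- The set of `Γ` sentences provable in `T`, `Th_Γ(T)`. -/
def ThIn (Γ : Set Snt) (T : Thy) : Set Snt := Γ ∩ Th T

instance (i : ℕ) : Encodable (LA.Functions i) :=
  match i with
  | 0 => inferInstanceAs (Encodable Unit)
  | 1 => inferInstanceAs (Encodable Unit)
  | 2 => inferInstanceAs (Encodable Bool)
  | (_ + 3) => inferInstanceAs (Encodable Empty)

instance (i : ℕ) : Encodable (LA.Relations i) :=
  match i with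
  | 0 => inferInstanceAs (Encodable Empty)
  | 1 => inferInstanceAs (Encodable Empty)
  | 2 => inferInstanceAs (Encodable Unit)
  | (_ + 3) => inferInstanceAs (Encodable Empty)

/-- A Gödel numbering of sentences, via Mathlib's encoding of bounded formulas. -/
def gnum (φ : Snt) : ℕ :=
  Encodable.encode
    (show List ((Σ k, LA.Term (Empty ⊕ Fin k)) ⊕ ((Σ n, LA.Relations n) ⊕ ℕ)) from
      BoundedFormula.encoding.encode (⟨0, φ⟩ : Σ n, LA.BoundedFormula Empty n))

/-- The (axiom set of the) theory `T` is computable. -/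
def CompThy (T : Thy) : Prop :=
  ComputablePred (fun m : ℕ => ∃ φ ∈ T, gnum φ = m)

/-- `T` is a computable consistent extension of `PA`. -/
def GoodThy (T : Thy) : Prop := CompThy T ∧ Con T ∧ ExtPA T

/-- `φ` is `Γ`-conservative over `T` for a class of sentences `Γ`:
every `Γ` sentence provable in `T + φ` is provable in `T`. -/
def ConsIn (Γ : Set Snt) (T : Thy) (φ : Snt) : Prop :=
  ∀ γ ∈ Γ, Prv (add T φ) γ → Prv T γ

/-- `φ` is hereditarily `Γ`-conservative over `T`: `Γ`-conservative over every
subtheory of `T` (containing `PA`). -/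
def HConsIn (Γ : Set Snt) (T : Thy) (φ : Snt) : Prop :=
  ∀ V : Thy, SubThy V T → ConsIn Γ V φ

/-- `φ` is `Σ_k↓Π_k`-conservative over `V`. -/
def SPCons (k : ℕ) (V : Thy) (φ : Snt) : Prop :=
  ∀ σ ∈ SigmaS k, ∀ π ∈ PiS k, Prv (add V φ) (σ ⊓ π) → Prv V (σ ⊔ π)

/-- `φ` is hereditarily `Σ_k↓Π_k`-conservative over `T`. -/
def HSPCons (k : ℕ) (T : Thy) (φ : Snt) : Prop :=
  ∀ V : Thy, SubThy V T → SPCons k V φ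

/-- The theory `S` is `Σ_k↓Π_k`-conservative over `PA`. -/
def ThySPConsPA (k : ℕ) (S : Thy) : Prop :=
  ∀ σ ∈ SigmaS k, ∀ π ∈ PiS k, Prv S (σ ⊓ π) → Prv PAAx (σ ⊔ π)

/-- `δ` is a `Δ_k(S)` sentence: `S`-provably equivalent to both a `Σ_k` sentence
and a `Π_k` sentence. -/
def IsDeltaIn (k : ℕ) (S : Thy) (δ : Snt) : Prop :=
  (∃ σ ∈ SigmaS k, Prv S (δ ⇔ σ)) ∧ ∃ π ∈ PiS k, Prv S (δ ⇔ π)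

/-- `φ` is `Δ_k(S)`-conservative over `V`. -/
def DeltaConsRel (k : ℕ) (S V : Thy) (φ : Snt) : Prop :=
  ∀ δ : Snt, IsDeltaIn k S δ → Prv (add V φ) δ → Prv V δ

/-- `φ` is `Δ_k`-conservative over `T`, i.e. `Δ_k(Th(T))`-conservative over `T`. -/
def DeltaCons (k : ℕ) (T : Thy) (φ : Snt) : Prop := DeltaConsRel k (Th T) T φ

/-- `φ` is hereditarily `Δ_k`-conservative over `T`. -/
def HDeltaCons (k : ℕ) (T : Thy) (φ : Snt) : Prop :=
  ∀ V : Thy, SubThy V T → DeltaConsRel k (Th V) V φ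

/-- `φ` is doubly `Π_k`-conservative over `T`: `φ` is `Π_k`-conservative and `¬φ` is
`Σ_k`-conservative over `T`. -/
def DCons (k : ℕ) (T : Thy) (φ : Snt) : Prop :=
  ConsIn (PiS k) T φ ∧ ConsIn (SigmaS k) T (∼φ)

/-- `φ` is hereditarily doubly `Π_k`-conservative over `T`. -/
def HDCons (k : ℕ) (T : Thy) (φ : Snt) : Prop :=
  ∀ V : Thy, SubThy V T → DCons k V φ

/-- `(T,U)` is a `B_n`-pair. -/
def Bpair (n : ℕ) (T U : Thy) : Prop :=
  (¬ ThIn (PiS n) T ⊆ Th U ∨ Con (T ∪ ThIn (PiS n) U)) ∧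
  (¬ ThIn (PiS n) U ⊆ Th T ∨ Con (U ∪ ThIn (PiS n) T))

/-- `(T,U)` is a `C_n`-pair. -/
def Cpair (n : ℕ) (T U : Thy) : Prop :=
  Con (T ∪ ThIn (PiS n) U) ∧ Con (U ∪ ThIn (PiS n) T)

/-- `(T,U)` is a `C⁻_n`-pair. -/
def Cmpair (n : ℕ) (T U : Thy) : Prop :=
  Con (T ∪ ThIn (PiS n) U) ∨ Con (U ∪ ThIn (PiS n) T)

/-- `(T,U)` is a `C^∧_n`-pair. -/
def Capair (n : ℕ) (T U : Thy) : Prop :=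
  Con (T ∪ ThIn (SigAndPiS n) U) ∧ Con (U ∪ ThIn (SigAndPiS n) T)

/-- `(T,U)` is a `C^B_n`-pair. -/
def CBpair (n : ℕ) (T U : Thy) : Prop :=
  Con (T ∪ ThIn (BSigmaS n) U)


set_option linter.all false
set_option linter.unusedSimpArgs false

section raw
variable {N : Type} [S : LA.Structure N]

def rz : N := Structure.funMap (L := LA) (M := N) (show LA.Functions 0 from Unit.unit) ![]
def rs (x : N) : N := Structure.funMap (L := LA) (M := N) (show LA.Functions 1 from Unit.unit) ![x]
def ra (x y : N) : N := Structure.funMap (L := LA) (M := N) (show LA.Functions 2 from false) ![x, y]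
def rm (x y : N) : N := Structure.funMap (L := LA) (M := N) (show LA.Functions 2 from true) ![x, y]
def rl (x y : N) : Prop := Structure.RelMap (L := LA) (M := N) (show LA.Relations 2 from Unit.unit) ![x, y]

@[simp] theorem real_vT {m : ℕ} (v : Empty → N) (xs : Fin m → N) (i : Fin m) :
    (vT i).realize (Sum.elim v xs) = xs i := rfl
@[simp] theorem real_zeroT {m : ℕ} (w : Empty ⊕ Fin m → N) :
    (zeroT : LA.Term (Empty ⊕ Fin m)).realize w = rz := by
  unfold zeroT rz
  simp only [Constants.term, Term.realize]
  congr 1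
  exact Subsingleton.elim _ _
@[simp] theorem real_succT {m : ℕ} (w : Empty ⊕ Fin m → N) (t : LA.Term (Empty ⊕ Fin m)) :
    (succT t).realize w = rs (t.realize w) := by
  unfold succT rs; exact Term.realize_functions_apply₁
@[simp] theorem real_addT {m : ℕ} (w : Empty ⊕ Fin m → N) (t u : LA.Term (Empty ⊕ Fin m)) :
    (addT t u).realize w = ra (t.realize w) (u.realize w) := by
  unfold addT ra; exact Term.realize_functions_apply₂
@[simp] theorem real_mulT {m : ℕ} (w : Empty ⊕ Fin m → N) (t u : LA.Term (Empty ⊕ Fin m)) :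
    (mulT t u).realize w = rm (t.realize w) (u.realize w) := by
  unfold mulT rm; exact Term.realize_functions_apply₂
@[simp] theorem real_leF {m : ℕ} (v : Empty → N) (xs : Fin m → N) (t u : LA.Term (Empty ⊕ Fin m)) :
    (leF t u).Realize v xs ↔ rl (t.realize (Sum.elim v xs)) (u.realize (Sum.elim v xs)) := by
  unfold leF rl; exact BoundedFormula.realize_rel₂

theorem raw_ind (h : N ⊨ PAAx) {k : ℕ} (φ : LA.BoundedFormula Empty (k + 1)) (p : Fin k → N)
    (h0 : φ.Realize default (Fin.snoc p rz))
    (hs : ∀ x, φ.Realize default (Fin.snoc p x) → φ.Realize default (Fin.snoc p (rs x))) :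
    ∀ x, φ.Realize default (Fin.snoc p x) := by
  have := h.realize_of_mem (indAxiom φ) (Or.inr ⟨k, φ, rfl⟩)
  unfold indAxiom Sentence.Realize at this
  dsimp only at this
  rw [BoundedFormula.realize_alls] at this
  have := this p
  simp only [BoundedFormula.realize_imp, BoundedFormula.realize_inf, BoundedFormula.realize_all,
    BoundedFormula.realize_bdEqual, real_vT, real_zeroT, real_succT] at this
  apply this
  constructor
  · intro a ha
    simp at ha
    rw [ha]; exact h0
  · intro a ha b hb
    have hm : k + 1 = k + 1 := rfl
    rw [BoundedFormula.realize_liftAt_one (by omega)]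
    have e : ((Fin.snoc (Fin.snoc p a : Fin (k+1) → N) b : Fin (k+2) → N) ∘
        fun i : Fin (k+1) => if (i : ℕ) < k then Fin.castSucc i else i.succ) = Fin.snoc p b := by
      funext i
      refine Fin.lastCases ?_ (fun j => ?_) i
      · simp
      · simp [Fin.snoc_castSucc]
    simp at hb
    rw [e, hb]
    exact hs a ha


theorem r_succ_ne (h : N ⊨ PAAx) (x : N) : rs x ≠ rz := by
  have := h.realize_of_mem (∀' ∼(succT (vT 0) =' zeroT)) (by unfold PAAx; simp)
  simpa [Sentence.Realize, Formula.Realize, Fin.snoc] using this x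
theorem r_succ_inj (h : N ⊨ PAAx) (x y : N) : rs x = rs y → x = y := by
  have := h.realize_of_mem (∀' ∀' ((succT (vT 0) =' succT (vT 1)) ⟹ (vT 0 =' vT 1))) (by unfold PAAx; simp)
  simpa [Sentence.Realize, Formula.Realize, Fin.snoc] using this x y
theorem r_add_zero (h : N ⊨ PAAx) (x : N) : ra x rz = x := by
  have := h.realize_of_mem (∀' (addT (vT 0) zeroT =' vT 0)) (by unfold PAAx; simp)
  simpa [Sentence.Realize, Formula.Realize, Fin.snoc] using this x
theorem r_add_succ (h : N ⊨ PAAx) (x y : N) : ra x (rs y) = rs (ra x y) := by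
  have := h.realize_of_mem (∀' ∀' (addT (vT 0) (succT (vT 1)) =' succT (addT (vT 0) (vT 1)))) (by unfold PAAx; simp)
  simpa [Sentence.Realize, Formula.Realize, Fin.snoc] using this x y
theorem r_mul_zero (h : N ⊨ PAAx) (x : N) : rm x rz = rz := by
  have := h.realize_of_mem (∀' (mulT (vT 0) zeroT =' zeroT)) (by unfold PAAx; simp)
  simpa [Sentence.Realize, Formula.Realize, Fin.snoc] using this x
theorem r_mul_succ (h : N ⊨ PAAx) (x y : N) : rm x (rs y) = ra (rm x y) x := by
  have := h.realize_of_mem (∀' ∀' (mulT (vT 0) (succT (vT 1)) =' addT (mulT (vT 0) (vT 1)) (vT 0))) (by unfold PAAx; simp)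
  simpa [Sentence.Realize, Formula.Realize, Fin.snoc] using this x y
theorem r_le (h : N ⊨ PAAx) (x y : N) : rl x y ↔ ∃ z, ra z x = y := by
  have := h.realize_of_mem (∀' ∀' (leF (vT 0) (vT 1) ⇔ ∃' (addT (vT 2) (vT 0) =' vT 1))) (by unfold PAAx; simp)
  simpa [Sentence.Realize, Formula.Realize, Fin.snoc] using this x y

theorem r_zero_add (h : N ⊨ PAAx) (x : N) : ra rz x = x := by
  have := raw_ind h (k := 0) (addT zeroT (vT 0) =' vT 0) ![] 
    (by simpa [Fin.snoc] using r_add_zero h _)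
    (by intro x hx; simp [Fin.snoc] at hx ⊢; rw [r_add_succ h, hx]) x
  simpa [Fin.snoc] using this
theorem r_succ_add (h : N ⊨ PAAx) (x y : N) : ra (rs x) y = rs (ra x y) := by
  have := raw_ind h (k := 1) (addT (succT (vT 0)) (vT 1) =' succT (addT (vT 0) (vT 1))) ![x] 
    (by simp [Fin.snoc]; rw [r_add_zero h, r_add_zero h])
    (by intro y hx; simp [Fin.snoc] at hx ⊢; rw [r_add_succ h, hx, r_add_succ h]) y
  simpa [Fin.snoc] using this
theorem r_add_comm (h : N ⊨ PAAx) (x y : N) : ra x y = ra y x := by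
  have := raw_ind h (k := 1) (addT (vT 0) (vT 1) =' (addT (vT 1) (vT 0))) ![x] 
    (by simp [Fin.snoc]; rw [r_add_zero h, r_zero_add h])
    (by intro y hx; simp [Fin.snoc] at hx ⊢; rw [r_add_succ h, hx, r_succ_add h]) y
  simpa [Fin.snoc] using this
theorem r_add_assoc (h : N ⊨ PAAx) (x y z : N) : ra (ra x y) z = ra x (ra y z) := by
  have := raw_ind h (k := 2) (addT (addT (vT 0) (vT 1)) (vT 2) =' (addT (vT 0) (addT (vT 1) (vT 2)))) ![x, y] 
    (by simp [Fin.snoc]; rw [r_add_zero h, r_add_zero h])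
    (by intro z hx; simp [Fin.snoc] at hx ⊢; rw [r_add_succ h, hx, r_add_succ h, r_add_succ h]) z
  simpa [Fin.snoc] using this
theorem r_zero_mul (h : N ⊨ PAAx) (x : N) : rm rz x = rz := by
  have := raw_ind h (k := 0) (mulT zeroT (vT 0) =' zeroT) ![] 
    (by simpa [Fin.snoc] using r_mul_zero h _)
    (by intro x hx; simp [Fin.snoc] at hx ⊢; rw [r_mul_succ h, hx, r_add_zero h]) x
  simpa [Fin.snoc] using this
theorem r_succ_mul (h : N ⊨ PAAx) (x y : N) : rm (rs x) y = ra (rm x y) y := by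
  have := raw_ind h (k := 1) (mulT (succT (vT 0)) (vT 1) =' (addT (mulT (vT 0) (vT 1)) (vT 1))) ![x] 
    (by simp [Fin.snoc]; rw [r_mul_zero h, r_mul_zero h, r_add_zero h])
    (by 
      intro y hx; simp [Fin.snoc] at hx ⊢
      rw [r_mul_succ h, hx, r_mul_succ h, r_add_succ h, r_add_succ h, r_add_assoc h, r_add_assoc h, r_add_comm h x y]) y
  simpa [Fin.snoc] using this
theorem r_mul_comm (h : N ⊨ PAAx) (x y : N) : rm x y = rm y x := by
  have := raw_ind h (k := 1) (mulT (vT 0) (vT 1) =' (mulT (vT 1) (vT 0))) ![x] 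
    (by simp [Fin.snoc]; rw [r_mul_zero h, r_zero_mul h])
    (by intro y hx; simp [Fin.snoc] at hx ⊢; rw [r_mul_succ h, hx, r_succ_mul h]) y
  simpa [Fin.snoc] using this
theorem r_mul_add (h : N ⊨ PAAx) (x y z : N) : rm x (ra y z) = ra (rm x y) (rm x z) := by
  have := raw_ind h (k := 2) (mulT (vT 0) (addT (vT 1) (vT 2)) =' (addT (mulT (vT 0) (vT 1)) (mulT (vT 0) (vT 2)))) ![x, y] 
    (by simp [Fin.snoc]; rw [r_add_zero h, r_mul_zero h, r_add_zero h])
    (by intro z hx; simp [Fin.snoc] at hx ⊢; rw [r_add_succ h, r_mul_succ h, hx, r_mul_succ h, r_add_assoc h]) z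
  simpa [Fin.snoc] using this
theorem r_mul_assoc (h : N ⊨ PAAx) (x y z : N) : rm (rm x y) z = rm x (rm y z) := by
  have := raw_ind h (k := 2) (mulT (mulT (vT 0) (vT 1)) (vT 2) =' (mulT (vT 0) (mulT (vT 1) (vT 2)))) ![x, y] 
    (by simp [Fin.snoc]; rw [r_mul_zero h, r_mul_zero h, r_mul_zero h])
    (by intro z hx; simp [Fin.snoc] at hx ⊢; rw [r_mul_succ h, hx, r_mul_succ h, r_mul_add h]) z
  simpa [Fin.snoc] using this
theorem r_add_cancel (h : N ⊨ PAAx) (x y z : N) : ra x z = ra y z → x = y := by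
  have := raw_ind h (k := 2) ((addT (vT 0) (vT 2) =' addT (vT 1) (vT 2)) ⟹ (vT 0 =' vT 1)) ![x, y] 
    (by simp [Fin.snoc]; rw [r_add_zero h, r_add_zero h]; exact id)
    (by
      intro z hx; simp [Fin.snoc] at hx ⊢; rw [r_add_succ h, r_add_succ h]
      exact fun e => hx (r_succ_inj h _ _ e)) z
  simpa [Fin.snoc] using this
theorem r_cases (h : N ⊨ PAAx) (x : N) : x = rz ∨ ∃ y, x = rs y := by
  have := raw_ind h (k := 0) ((vT 0 =' zeroT) ⊔ ∃' (vT 0 =' succT (vT 1))) ![]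
    (by simp [Fin.snoc])
    (by intro x _; simp [Fin.snoc]) x
  simpa [Fin.snoc] using this
theorem r_total (h : N ⊨ PAAx) (x y : N) : rl x y ∨ rl y x := by
  have := raw_ind h (k := 1) (leF (vT 0) (vT 1) ⊔ leF (vT 1) (vT 0)) ![x]
    (by simp [Fin.snoc]; right; rw [r_le h]; exact ⟨x, r_add_zero h x⟩)
    (by
      intro y hx; simp [Fin.snoc] at hx ⊢; simp only [r_le h] at hx ⊢
      rcases hx with ⟨z, hz⟩ | ⟨z, hz⟩
      · left; exact ⟨rs z, by rw [r_succ_add h, hz]⟩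
      · rcases r_cases h z with rfl | ⟨w, rfl⟩
        · left; exact ⟨rs rz, by rw [← hz, r_zero_add h, r_succ_add h, r_zero_add h]⟩
        · right; exact ⟨w, by rw [← hz, r_succ_add h, r_add_succ h]⟩) y
  simpa [Fin.snoc] using this
theorem r_add_eq_zero (h : N ⊨ PAAx) (x y : N) (e : ra x y = rz) : y = rz := by
  rcases r_cases h y with rfl | ⟨w, rfl⟩
  · rfl
  · rw [r_add_succ h] at e; exact absurd e (r_succ_ne h _)
end raw

/-- the canonical structure -/
instance laStr (M : Type) [CommSemiring M] [LinearOrder M] : LA.Structure M where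
  funMap {n} := match n with
    | 0 => fun _ _ => 0
    | 1 => fun _ v => v 0 + 1
    | 2 => fun (f : Bool) v => match f with | false => v 0 + v 1 | true => v 0 * v 1
    | (_ + 3) => fun (f : Empty) => f.elim
  RelMap {n} := match n with
    | 0 => fun (f : Empty) => f.elim
    | 1 => fun (f : Empty) => f.elim
    | 2 => fun _ v => v 0 ≤ v 1
    | (_ + 3) => fun (f : Empty) => f.elim

class PAM (M : Type) [CommSemiring M] [LinearOrder M] : Prop extends
    IsStrictOrderedRing M, CanonicallyOrderedAdd M where
  ind : ∀ (k : ℕ) (φ : LA.BoundedFormula Empty (k + 1)) (p : Fin k → M),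
    φ.Realize default (Fin.snoc p (0 : M)) →
    (∀ x, φ.Realize default (Fin.snoc p x) → φ.Realize default (Fin.snoc p (x + 1))) →
    ∀ x, φ.Realize default (Fin.snoc p x)

instance : PAM ℕ where
  ind k φ p h0 hs x := by
    induction x with
    | zero => exact h0
    | succ n ih => exact hs n ih

theorem exists_alg (N : Type) [S : LA.Structure N] (h : N ⊨ PAAx) :
    ∃ (_ : CommSemiring N) (_ : LinearOrder N), S = laStr N ∧ PAM N := by
  classical
  let _ : Zero N := ⟨rz⟩
  let _ : One N := ⟨rs rz⟩
  let _ : Add N := ⟨ra⟩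
  let _ : Mul N := ⟨rm⟩
  have one_m : ∀ x : N, rm (rs rz) x = x := fun x => by
    rw [r_succ_mul h, r_zero_mul h, r_zero_add h]
  let C : CommSemiring N :=
    { add_assoc := r_add_assoc h
      zero_add := r_zero_add h
      add_zero := r_add_zero h
      add_comm := r_add_comm h
      mul_assoc := r_mul_assoc h
      one_mul := one_m
      mul_one := fun x => (r_mul_comm h _ _).trans (one_m x)
      zero_mul := r_zero_mul h
      mul_zero := r_mul_zero h
      left_distrib := r_mul_add h
      right_distrib := fun x y z => by
        show rm (ra x y) z = ra (rm x z) (rm y z)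
        rw [r_mul_comm h, r_mul_add h, r_mul_comm h z x, r_mul_comm h z y]
      mul_comm := r_mul_comm h
      nsmul := nsmulRec
      npow := npowRec }
  have hle : ∀ x y : N, rl x y ↔ ∃ z, z + x = y := r_le h
  have canc : ∀ x y z : N, x + z = y + z → x = y := r_add_cancel h
  have az : ∀ x y : N, x + y = 0 → y = 0 := r_add_eq_zero h
  have suc : ∀ x : N, rs x = x + 1 := fun x => by
    show rs x = ra x (rs rz)
    rw [r_add_succ h, r_add_zero h]
  let O : LinearOrder N :=
    { le := rl
      le_refl := fun x => (hle _ _).2 ⟨0, zero_add x⟩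
      le_trans := fun x y z h1 h2 => by
        obtain ⟨a, rfl⟩ := (hle _ _).1 h1
        obtain ⟨b, rfl⟩ := (hle _ _).1 h2
        exact (hle _ _).2 ⟨b + a, by ring⟩
      le_antisymm := fun x y h1 h2 => by
        obtain ⟨a, rfl⟩ := (hle _ _).1 h1
        obtain ⟨b, hb⟩ := (hle _ _).1 h2
        have : (b + a) + x = 0 + x := by rw [zero_add, add_assoc, hb]
        have := az _ _ (canc _ _ _ this)
        rw [this, zero_add]
      le_total := r_total h
      toDecidableLE := Classical.decRel _ }
  have le_iff : ∀ x y : N, x ≤ y ↔ ∃ z, z + x = y := hle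
  have hS : S = laStr N := by
    have e1 : ∀ n (f : LA.Functions n) (v : Fin n → N), S.funMap f v = (laStr N).funMap f v := by
      intro n f v
      match n, f, v with
      | 0, f, v =>
        show S.funMap f v = rz
        unfold rz
        congr 1
        exact Subsingleton.elim _ _
      | 1, f, v =>
        show S.funMap f v = v 0 + 1
        rw [← suc]
        unfold rs
        congr 1
        funext i; fin_cases i; rfl
      | 2, false, v =>
        show _ = ra (v 0) (v 1)
        unfold ra
        congr 1
        funext i; fin_cases i <;> rfl
      | 2, true, v =>
        show _ = rm (v 0) (v 1)
        unfold rm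
        congr 1
        funext i; fin_cases i <;> rfl
      | (n+3), f, v => exact Empty.elim f
    have e2 : ∀ n (f : LA.Relations n) (v : Fin n → N), S.RelMap f v = (laStr N).RelMap f v := by
      intro n f v
      match n, f, v with
      | 0, f, v => exact Empty.elim f
      | 1, f, v => exact Empty.elim f
      | 2, f, v =>
        show _ = rl (v 0) (v 1)
        unfold rl
        congr 1
        funext i; fin_cases i <;> rfl
      | (n+3), f, v => exact Empty.elim f
    ext n f v
    · exact e1 n f v
    · exact iff_of_eq (e2 n f v)

  refine ⟨C, O, hS, ?_⟩
  have ai : ∀ x y z : N, x + z ≤ y + z → x ≤ y := by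
    intro x y z hh
    obtain ⟨w, hw⟩ := (le_iff _ _).1 hh
    exact (le_iff _ _).2 ⟨w, canc _ _ z (by rw [← hw]; ring)⟩
  have al : ∀ x y : N, x ≤ y → ∀ z, z + x ≤ z + y := by
    intro x y hh z
    obtain ⟨w, rfl⟩ := (le_iff _ _).1 hh
    exact (le_iff _ _).2 ⟨w, by ring⟩
  have z01 : (0:N) ≤ 1 := (le_iff _ _).2 ⟨1, add_zero _⟩
  have ne01 : (0:N) ≠ 1 := fun e => r_succ_ne h rz e.symm
  have canon : CanonicallyOrderedAdd N :=
    { exists_add_of_le := by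
        intro a b hh
        obtain ⟨w, rfl⟩ := (le_iff _ _).1 hh
        exact ⟨w, add_comm _ _⟩
      le_add_self := fun a b => (le_iff _ _).2 ⟨b, rfl⟩
      le_self_add := fun a b => (le_iff _ _).2 ⟨b, add_comm _ _⟩ }
  have zz : ∀ x y : N, x * y = 0 → x = 0 ∨ y = 0 := by
    intro x y e
    rcases r_cases h y with rfl | ⟨w, rfl⟩
    · right; rfl
    · left
      rw [suc, mul_add, mul_one] at e
      exact az _ _ e
  have ml : ∀ a b c : N, a < b → 0 < c → a * c < b * c := by
    intro a b c hab hc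
    obtain ⟨w, hw⟩ := (le_iff _ _).1 hab.le
    subst hw
    refine lt_of_le_of_ne ((le_iff _ _).2 ⟨w * c, by ring⟩) fun e => ?_
    have : w * c = 0 := canc _ _ (a * c) (by rw [zero_add, ← add_mul, ← e])
    rcases zz _ _ this with h1 | h1
    · rw [h1, zero_add] at hab; exact lt_irrefl _ hab
    · rw [h1] at hc; exact lt_irrefl _ hc
  have sor : IsStrictOrderedRing N :=
    { add_le_add_left := fun a b hh c => by rw [add_comm a, add_comm b]; exact al a b hh c
      le_of_add_le_add_left := fun a b c hh => ai _ _ a (by rw [add_comm b, add_comm c]; exact hh)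
      zero_le_one := z01
      exists_pair_ne := ⟨0, 1, ne01⟩
      mul_lt_mul_of_pos_left := fun a ha b c hh => by
        show a * b < a * c
        rw [mul_comm a b, mul_comm a c]; exact ml _ _ _ hh ha
      mul_lt_mul_of_pos_right := fun a ha b c hh => ml _ _ _ hh ha }
  refine { sor, canon with ind := ?_ }
  intro k φ p h0 hs
  rw [← hS] at *
  exact raw_ind h φ p h0 (fun x hx => by rw [suc]; exact hs x hx)

theorem prv_iff {T : Thy} (hT : ExtPA T) (φ : Snt) : Prv T φ ↔
    ∀ (M : Type) [CommSemiring M] [LinearOrder M] [PAM M], M ⊨ T → M ⊨ φ := by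
  constructor
  · intro h M _ _ _ hM
    have : Nonempty M := ⟨0⟩
    exact (h.realize_sentence M)
  · intro h
    unfold Prv
    rw [Theory.models_sentence_iff]
    intro N
    have hN : (N : Type) ⊨ PAAx := by
      rw [Theory.model_iff]
      intro ψ hψ
      exact (hT ψ hψ).realize_sentence N
    obtain ⟨C, O, hS, hP⟩ := exists_alg N hN
    have key : ∀ (S : LA.Structure N), S = laStr N → @Theory.Model LA N S T →
       @Sentence.Realize LA N S φ := by
      rintro S rfl hm
      exact h N hm
    exact key _ hS N.is_model

theorem not_prv {T : Thy} (hT : ExtPA T) {φ : Snt} (h : ¬ Prv T φ) :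
    ∃ (M : Type) (_ : CommSemiring M) (_ : LinearOrder M) (_ : PAM M), M ⊨ T ∧ ¬ M ⊨ φ := by
  rw [prv_iff hT] at h
  push Not at h
  obtain ⟨M, a, b, c, d⟩ := h
  exact ⟨M, a, b, c, d⟩

theorem extPA_add {T : Thy} (hT : ExtPA T) (φ : Snt) : ExtPA (add T φ) := by
  intro ψ hψ
  have := hT ψ hψ
  unfold Prv at this ⊢
  rw [Theory.models_sentence_iff] at this ⊢
  intro N
  have hm : (N : Type) ⊨ T := N.is_model.mono (Set.subset_insert _ _)
  exact this (Theory.ModelType.of T N)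

section basic
variable {M : Type} [CommSemiring M] [LinearOrder M]

@[simp] theorem rz_eq : (rz : M) = 0 := rfl
@[simp] theorem rs_eq (x : M) : rs x = x + 1 := rfl
@[simp] theorem ra_eq (x y : M) : ra x y = x + y := rfl
@[simp] theorem rm_eq (x y : M) : rm x y = x * y := rfl
@[simp] theorem rl_eq (x y : M) : rl x y ↔ x ≤ y := Iff.rfl

variable [PAM M]

theorem succ_le_of_lt {x y : M} (h : x < y) : x + 1 ≤ y := by
  obtain ⟨z, rfl⟩ := exists_add_of_le h.le
  have := PAM.ind 0 ((vT 0 =' zeroT) ⊔ ∃' (vT 0 =' succT (vT 1)) : LA.BoundedFormula Empty 1) (![] : Fin 0 → M)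
    (by simp [Fin.snoc])
    (by intro x _; simp [Fin.snoc]) z
  simp [Fin.snoc] at this
  rcases this with rfl | ⟨w, rfl⟩
  · simp at h
  · rw [← add_assoc, add_right_comm]; exact le_self_add

theorem lt_succ_iff' {x y : M} : x < y + 1 ↔ x ≤ y := by
  constructor
  · intro h
    by_contra hc
    exact absurd (succ_le_of_lt (not_le.1 hc)) (not_le.2 h)
  · intro h; exact lt_of_le_of_lt h (lt_add_one y)

theorem succ_le_iff' {x y : M} : x + 1 ≤ y ↔ x < y :=
  ⟨fun h => lt_of_lt_of_le (lt_add_one x) h, succ_le_of_lt⟩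

theorem nat_initial (n : ℕ) (x : M) (h : x ≤ n) : ∃ m : ℕ, x = m ∧ m ≤ n := by
  induction n generalizing x with
  | zero => exact ⟨0, by simpa using h, le_rfl⟩
  | succ n ih =>
    rcases eq_or_lt_of_le h with rfl | h
    · exact ⟨n + 1, rfl, le_rfl⟩
    · push_cast at h
      obtain ⟨m, rfl, hm⟩ := ih x (lt_succ_iff'.1 h)
      exact ⟨m, rfl, by omega⟩

theorem exists_succ_of_pos {x : M} (h : 0 < x) : ∃ y, x = y + 1 := by
  obtain ⟨z, hz⟩ := exists_add_of_le (succ_le_of_lt h)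
  exact ⟨z, by rw [hz]; ring⟩

end basic

set_option linter.all false
set_option linter.unusedSimpArgs false

/-- the empty assignment -/
abbrev ed (M : Type) : Empty → M := default

abbrev UP (k : ℕ) := ∀ (M : Type) [CommSemiring M] [LinearOrder M], (Fin k → M) → Prop
abbrev UF (k : ℕ) := ∀ (M : Type) [CommSemiring M] [LinearOrder M], (Fin k → M) → M

def Trm {k : ℕ} (f : UF k) : Prop := ∃ t : LA.Term (Empty ⊕ Fin k),
  ∀ (M : Type) [CommSemiring M] [LinearOrder M] [PAM M] (v : Fin k → M),
    t.realize (Sum.elim default v) = f M v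

theorem Trm.var {k : ℕ} (i : Fin k) : Trm (fun M _ _ v => v i) := ⟨vT i, fun M _ _ _ v => rfl⟩
theorem Trm.add {k : ℕ} {f g : UF k} (hf : Trm f) (hg : Trm g) : Trm (fun M _ _ v => f M v + g M v) := by
  obtain ⟨t, ht⟩ := hf
  obtain ⟨u, hu⟩ := hg
  exact ⟨addT t u, fun M _ _ _ v => by simp [ht, hu]⟩
theorem Trm.mul {k : ℕ} {f g : UF k} (hf : Trm f) (hg : Trm g) : Trm (fun M _ _ v => f M v * g M v) := by
  obtain ⟨t, ht⟩ := hf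
  obtain ⟨u, hu⟩ := hg
  exact ⟨mulT t u, fun M _ _ _ v => by simp [ht, hu]⟩
theorem Trm.zero {k : ℕ} : Trm (k := k) (fun M _ _ v => 0) :=
  ⟨zeroT, fun M _ _ _ v => by simp⟩
theorem Trm.one {k : ℕ} : Trm (k := k) (fun M _ _ v => 1) :=
  ⟨succT zeroT, fun M _ _ _ v => by simp⟩
theorem Trm.cast {k : ℕ} (n : ℕ) : Trm (k := k) (fun M _ _ v => (n : M)) := by
  induction n with
  | zero => simpa using Trm.zero
  | succ n ih => simpa using ih.add Trm.one
theorem Trm.subst {k m : ℕ} {f : UF m} (hf : Trm f) {g : Fin m → UF k} (hg : ∀ i, Trm (g i)) :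
    Trm (fun M _ _ v => f M (fun i => g i M v)) := by
  obtain ⟨t, ht⟩ := hf
  choose u hu using hg
  refine ⟨t.subst (Sum.elim Empty.elim u), fun M _ _ _ v => ?_⟩
  rw [Term.realize_subst]
  refine Eq.trans ?_ (ht M _)
  congr 1
  funext i
  rcases i with i | i
  · exact i.elim
  · simp [hu]
theorem Trm.init {k : ℕ} {f : UF k} (hf : Trm f) : Trm (fun M _ _ (v : Fin (k+1) → M) => f M (Fin.init v)) :=
  hf.subst (fun i => Trm.var (Fin.castSucc i))

/-! ### Delta0 -/

def Dl0 {k : ℕ} (P : UP k) : Prop := ∃ φ : LA.BoundedFormula Empty k, IsDelta0 φ ∧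
  ∀ (M : Type) [CommSemiring M] [LinearOrder M] [PAM M] (v : Fin k → M),
    φ.Realize default v ↔ P M v

theorem Dl0.congr {k : ℕ} {P Q : UP k} (hP : Dl0 P)
    (h : ∀ (M : Type) [CommSemiring M] [LinearOrder M] [PAM M] (v : Fin k → M), P M v ↔ Q M v) : Dl0 Q := by
  obtain ⟨φ, h1, h2⟩ := hP
  exact ⟨φ, h1, fun M _ _ _ v => (h2 M v).trans (h M v)⟩
theorem Dl0.eq {k : ℕ} {f g : UF k} (hf : Trm f) (hg : Trm g) : Dl0 (fun M _ _ v => f M v = g M v) := by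
  obtain ⟨t, ht⟩ := hf
  obtain ⟨u, hu⟩ := hg
  exact ⟨t =' u, .equal _ _, fun M _ _ _ v => by simp [ht, hu]⟩
theorem Dl0.le {k : ℕ} {f g : UF k} (hf : Trm f) (hg : Trm g) : Dl0 (fun M _ _ v => f M v ≤ g M v) := by
  obtain ⟨t, ht⟩ := hf
  obtain ⟨u, hu⟩ := hg
  exact ⟨leF t u, .le _ _, fun M _ _ _ v => by simp [ht, hu]⟩
theorem Dl0.lt {k : ℕ} {f g : UF k} (hf : Trm f) (hg : Trm g) : Dl0 (fun M _ _ v => f M v < g M v) :=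
  (Dl0.le (hf.add Trm.one) hg).congr fun M _ _ _ v => succ_le_iff'
theorem Dl0.false {k : ℕ} : Dl0 (k := k) (fun M _ _ v => False) :=
  ⟨⊥, .falsum, fun M _ _ _ v => by simp⟩
theorem Dl0.imp {k : ℕ} {P Q : UP k} (hP : Dl0 P) (hQ : Dl0 Q) : Dl0 (fun M _ _ v => P M v → Q M v) := by
  obtain ⟨t, t', ht⟩ := hP
  obtain ⟨u, u', hu⟩ := hQ
  exact ⟨t ⟹ u, .imp t' u', fun M _ _ _ v => by simp [ht, hu]⟩
theorem Dl0.not {k : ℕ} {P : UP k} (hP : Dl0 P) : Dl0 (fun M _ _ v => ¬ P M v) :=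
  hP.imp Dl0.false
theorem Dl0.true {k : ℕ} : Dl0 (k := k) (fun M _ _ v => True) :=
  Dl0.false.not.congr fun M _ _ _ v => by simp
theorem Dl0.and {k : ℕ} {P Q : UP k} (hP : Dl0 P) (hQ : Dl0 Q) : Dl0 (fun M _ _ v => P M v ∧ Q M v) :=
  (hP.imp hQ.not).not.congr fun M _ _ _ v => by simp
theorem Dl0.or {k : ℕ} {P Q : UP k} (hP : Dl0 P) (hQ : Dl0 Q) : Dl0 (fun M _ _ v => P M v ∨ Q M v) :=
  (hP.not.imp hQ).congr fun M _ _ _ v => by tauto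
theorem Dl0.iff {k : ℕ} {P Q : UP k} (hP : Dl0 P) (hQ : Dl0 Q) : Dl0 (fun M _ _ v => P M v ↔ Q M v) :=
  ((hP.imp hQ).and (hQ.imp hP)).congr fun M _ _ _ v => by tauto
theorem Dl0.ne {k : ℕ} {f g : UF k} (hf : Trm f) (hg : Trm g) : Dl0 (fun M _ _ v => f M v ≠ g M v) :=
  (Dl0.eq hf hg).not
theorem Dl0.ball {k : ℕ} {f : UF k} (hf : Trm f)
    {P : ∀ (M : Type) [CommSemiring M] [LinearOrder M], (Fin k → M) → M → Prop}
    (hP : Dl0 (fun M _ _ (v : Fin (k+1) → M) => P M (Fin.init v) (v (Fin.last k)))) :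
    Dl0 (fun M _ _ v => ∀ x, x ≤ f M v → P M v x) := by
  obtain ⟨t, ht⟩ := hf
  obtain ⟨u, u', hu⟩ := hP
  refine ⟨_, .ball t u', fun M _ _ _ v => ?_⟩
  simp [hu, Term.realize_relabel]
  have : ∀ x : M, (Sum.elim (ed M) (Fin.snoc v x : Fin (k+1) → M) ∘ Sum.map id Fin.castSucc) = Sum.elim (ed M) v := by
    intro x
    funext i
    rcases i with i | i
    · exact i.elim
    · simp
  simp [this, ht]
theorem Dl0.bex {k : ℕ} {f : UF k} (hf : Trm f)
    {P : ∀ (M : Type) [CommSemiring M] [LinearOrder M], (Fin k → M) → M → Prop}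
    (hP : Dl0 (fun M _ _ (v : Fin (k+1) → M) => P M (Fin.init v) (v (Fin.last k)))) :
    Dl0 (fun M _ _ v => ∃ x, x ≤ f M v ∧ P M v x) :=
  (Dl0.ball hf (P := fun M _ _ v x => ¬ P M v x) hP.not).not.congr fun M _ _ _ v => by push Not; rfl
theorem Dl0.ball' {k : ℕ} {f : UF k} (hf : Trm f)
    {P : ∀ (M : Type) [CommSemiring M] [LinearOrder M], (Fin k → M) → M → Prop}
    (hP : Dl0 (fun M _ _ (v : Fin (k+1) → M) => P M (Fin.init v) (v (Fin.last k)))) :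
    Dl0 (fun M _ _ v => ∀ x, x < f M v → P M v x) :=
  (Dl0.ball hf (P := fun M _ _ v x => x < f M v → P M v x)
    ((Dl0.lt (Trm.var _) hf.init).imp hP)).congr fun M _ _ _ v =>
      ⟨fun h x hx => h x hx.le hx, fun h x _ hx => h x hx⟩
theorem Dl0.bex' {k : ℕ} {f : UF k} (hf : Trm f)
    {P : ∀ (M : Type) [CommSemiring M] [LinearOrder M], (Fin k → M) → M → Prop}
    (hP : Dl0 (fun M _ _ (v : Fin (k+1) → M) => P M (Fin.init v) (v (Fin.last k)))) :
    Dl0 (fun M _ _ v => ∃ x, x < f M v ∧ P M v x) :=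
  (Dl0.ball' hf (P := fun M _ _ v x => ¬ P M v x) hP.not).not.congr fun M _ _ _ v => by push Not; rfl

theorem Dl0.subst {k m : ℕ} {P : UP m} (hP : Dl0 P) {g : Fin m → UF k} (hg : ∀ i, Trm (g i)) :
    Dl0 (fun M _ _ v => P M (fun i => g i M v)) := by
  obtain ⟨φ, h1, h2⟩ := hP
  have key : ∀ {m : ℕ} (φ : LA.BoundedFormula Empty m), IsDelta0 φ → ∀ {k : ℕ} (g : Fin m → UF k),
      (∀ i, Trm (g i)) → Dl0 (fun M _ _ v => φ.Realize default (fun i => g i M v)) := by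
    intro m φ h
    have ht : ∀ {m k : ℕ} (t : LA.Term (Empty ⊕ Fin m)) (g : Fin m → UF k), (∀ i, Trm (g i)) →
        Trm (fun M _ _ v => t.realize (Sum.elim default (fun i => g i M v))) :=
      fun t g hg => Trm.subst (f := fun M _ _ v => t.realize (Sum.elim default v)) ⟨t, fun M _ _ _ v => rfl⟩ hg
    have hs : ∀ {m k : ℕ} (g : Fin m → UF k), (∀ i, Trm (g i)) → 
        ∀ i, Trm ((fun i M _ _ v => (Fin.snoc (fun i => g i M (Fin.init v)) (v (Fin.last k)) : Fin (m+1) → M) i : Fin (m+1) → UF (k+1)) i) := by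
      intro m k g hg i
      refine Fin.lastCases ?_ (fun j => ?_) i
      · simpa using Trm.var _
      · simpa using (hg j).init
    have hr : ∀ {m : ℕ} (t : LA.Term (Empty ⊕ Fin m)) (M : Type) [CommSemiring M] [LinearOrder M] (v : Fin m → M) (x : M),
        (t.relabel (Sum.map id Fin.castSucc)).realize (Sum.elim default (Fin.snoc v x : Fin (m+1) → M)) = t.realize (Sum.elim (ed M) v) := by
      intro m t M _ _ v x
      rw [Term.realize_relabel]
      congr 1
      funext i
      rcases i with i | i
      · exact i.elim
      · simp
    induction h with
    | falsum => intro k g hg; simpa using Dl0.false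
    | equal t u => 
      intro k g hg
      simp only [BoundedFormula.realize_bdEqual]
      exact Dl0.eq (ht t g hg) (ht u g hg)
    | le t u =>
      intro k g hg
      simp only [real_leF, rl_eq]
      exact Dl0.le (ht t g hg) (ht u g hg)
    | imp h1 h2 ih1 ih2 => 
      intro k g hg
      simp only [BoundedFormula.realize_imp]
      exact Dl0.imp (ih1 g hg) (ih2 g hg)
    | @ball m t φ h ih =>
      intro k g hg
      refine (Dl0.ball (ht t g hg) (P := fun M _ _ v x => φ.Realize default (Fin.snoc (fun i => g i M v) x)) (ih _ (hs g hg))).congr ?_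
      intro M _ _ _ v
      simp [hr]
    | @bex m t φ h ih =>
      intro k g hg
      refine (Dl0.bex (ht t g hg) (P := fun M _ _ v x => φ.Realize default (Fin.snoc (fun i => g i M v) x)) (ih _ (hs g hg))).congr ?_
      intro M _ _ _ v
      simp [hr]
  exact (key φ h1 g hg).congr fun M _ _ _ v => h2 M _

theorem Dl0.init {k : ℕ} {P : UP k} (hP : Dl0 P) : Dl0 (fun M _ _ (v : Fin (k+1) → M) => P M (Fin.init v)) :=
  hP.subst (fun i => Trm.var (Fin.castSucc i))

theorem term_abs {m : ℕ} (t : LA.Term (Empty ⊕ Fin m)) (M : Type) [CommSemiring M] [LinearOrder M]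
    (v : Fin m → ℕ) : ((t.realize (Sum.elim (ed ℕ) v) : ℕ) : M) =
      t.realize (Sum.elim (ed M) (fun i => (v i : M))) := by
  induction t with
  | var i => 
    rcases i with i | i
    · exact i.elim
    · rfl
  | @func l f ts ih =>
    match l, f, ts, ih with
    | 0, f, ts, ih => exact Nat.cast_zero
    | 1, f, ts, ih =>
      show (((ts 0).realize _ + 1 : ℕ) : M) = (ts 0).realize _ + 1
      rw [← ih]; push_cast; rfl
    | 2, false, ts, ih =>
      show (((ts 0).realize _ + (ts 1).realize _ : ℕ) : M) = (ts 0).realize _ + (ts 1).realize _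
      rw [← ih, ← ih]; push_cast; rfl
    | 2, true, ts, ih =>
      show (((ts 0).realize _ * (ts 1).realize _ : ℕ) : M) = (ts 0).realize _ * (ts 1).realize _
      rw [← ih, ← ih]; push_cast; rfl
    | (n+3), f, ts, ih => exact Empty.elim f

theorem Dl0.abs {k : ℕ} {P : UP k} (hP : Dl0 P) (M : Type) [CommSemiring M] [LinearOrder M] [PAM M]
    (v : Fin k → ℕ) : P ℕ v ↔ P M (fun i => (v i : M)) := by
  obtain ⟨φ, h1, h2⟩ := hP
  rw [← h2, ← h2]
  clear h2 P
  have hr : ∀ {m : ℕ} (t : LA.Term (Empty ⊕ Fin m)) (M : Type) [CommSemiring M] [LinearOrder M] (v : Fin m → M) (x : M),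
        (t.relabel (Sum.map id Fin.castSucc)).realize (Sum.elim default (Fin.snoc v x : Fin (m+1) → M)) = t.realize (Sum.elim (ed M) v) := by
      intro m t M _ _ v x
      rw [Term.realize_relabel]
      congr 1
      funext i
      rcases i with i | i
      · exact i.elim
      · simp
  have hsn : ∀ {m : ℕ} (v : Fin m → ℕ) (x : ℕ), (fun i => ((Fin.snoc v x : Fin (m+1) → ℕ) i : M)) = (Fin.snoc (fun i => (v i : M)) (x : M) : Fin (m+1) → M) := by
    intro m v x
    funext i
    refine Fin.lastCases ?_ (fun j => ?_) i <;> simp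
  induction h1 with
  | falsum => simp
  | equal t u => simp only [BoundedFormula.realize_bdEqual, ← term_abs]; exact (Nat.cast_inj (R := M)).symm
  | le t u => simp only [real_leF, rl_eq, ← term_abs]; exact (Nat.cast_le (α := M)).symm
  | imp h1 h2 ih1 ih2 => simp only [BoundedFormula.realize_imp, ih1, ih2]
  | ball t h ih =>
    simp only [BoundedFormula.realize_all, BoundedFormula.realize_imp, real_leF, rl_eq, hr, real_vT, Fin.snoc_last, ← term_abs, ih]
    constructor
    · intro hh x hx
      obtain ⟨n, rfl, hn⟩ := nat_initial _ _ hx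
      rw [← hsn]
      exact hh n hn
    · intro hh x hx
      rw [hsn]
      exact hh x (Nat.cast_le.2 hx)
  | bex t h ih =>
    simp only [BoundedFormula.realize_ex, BoundedFormula.realize_inf, real_leF, rl_eq, hr, real_vT, Fin.snoc_last, ← term_abs, ih]
    constructor
    · rintro ⟨x, hx, hh⟩
      exact ⟨x, Nat.cast_le.2 hx, by rw [← hsn]; exact hh⟩
    · rintro ⟨x, hx, hh⟩
      obtain ⟨n, rfl, hn⟩ := nat_initial _ _ hx
      exact ⟨n, hn, by rw [hsn]; exact hh⟩

/-! ### definable -/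

def Df {k : ℕ} (P : UP k) : Prop := ∃ φ : LA.BoundedFormula Empty k,
  ∀ (M : Type) [CommSemiring M] [LinearOrder M] [PAM M] (v : Fin k → M),
    φ.Realize default v ↔ P M v

theorem Dl0.df {k : ℕ} {P : UP k} (hP : Dl0 P) : Df P := by
  obtain ⟨φ, h1, h2⟩ := hP
  exact ⟨φ, h2⟩
theorem Df.congr {k : ℕ} {P Q : UP k} (hP : Df P)
    (h : ∀ (M : Type) [CommSemiring M] [LinearOrder M] [PAM M] (v : Fin k → M), P M v ↔ Q M v) : Df Q := by
  obtain ⟨φ, h2⟩ := hP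
  exact ⟨φ, fun M _ _ _ v => (h2 M v).trans (h M v)⟩
theorem Df.imp {k : ℕ} {P Q : UP k} (hP : Df P) (hQ : Df Q) : Df (fun M _ _ v => P M v → Q M v) := by
  obtain ⟨t, ht⟩ := hP
  obtain ⟨u, hu⟩ := hQ
  exact ⟨t ⟹ u, fun M _ _ _ v => by simp [ht, hu]⟩
theorem Df.not {k : ℕ} {P : UP k} (hP : Df P) : Df (fun M _ _ v => ¬ P M v) :=
  hP.imp Dl0.false.df
theorem Df.and {k : ℕ} {P Q : UP k} (hP : Df P) (hQ : Df Q) : Df (fun M _ _ v => P M v ∧ Q M v) :=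
  (hP.imp hQ.not).not.congr fun M _ _ _ v => by simp
theorem Df.or {k : ℕ} {P Q : UP k} (hP : Df P) (hQ : Df Q) : Df (fun M _ _ v => P M v ∨ Q M v) :=
  (hP.not.imp hQ).congr fun M _ _ _ v => by tauto
theorem Df.iff {k : ℕ} {P Q : UP k} (hP : Df P) (hQ : Df Q) : Df (fun M _ _ v => P M v ↔ Q M v) :=
  ((hP.imp hQ).and (hQ.imp hP)).congr fun M _ _ _ v => by tauto
theorem Df.all {k : ℕ} 
    {P : ∀ (M : Type) [CommSemiring M] [LinearOrder M], (Fin k → M) → M → Prop}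
    (hP : Df (fun M _ _ (v : Fin (k+1) → M) => P M (Fin.init v) (v (Fin.last k)))) :
    Df (fun M _ _ v => ∀ x, P M v x) := by
  obtain ⟨u, hu⟩ := hP
  exact ⟨∀' u, fun M _ _ _ v => by simp [hu]⟩
theorem Df.ex {k : ℕ} 
    {P : ∀ (M : Type) [CommSemiring M] [LinearOrder M], (Fin k → M) → M → Prop}
    (hP : Df (fun M _ _ (v : Fin (k+1) → M) => P M (Fin.init v) (v (Fin.last k)))) :
    Df (fun M _ _ v => ∃ x, P M v x) := by
  obtain ⟨u, hu⟩ := hP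
  exact ⟨∃' u, fun M _ _ _ v => by simp [hu]⟩

theorem Df.subst {k m : ℕ} {P : UP m} (hP : Df P) {g : Fin m → UF k} (hg : ∀ i, Trm (g i)) :
    Df (fun M _ _ v => P M (fun i => g i M v)) := by
  obtain ⟨φ, h2⟩ := hP
  have key : ∀ {m : ℕ} (φ : LA.BoundedFormula Empty m), ∀ {k : ℕ} (g : Fin m → UF k),
      (∀ i, Trm (g i)) → Df (fun M _ _ v => φ.Realize default (fun i => g i M v)) := by
    intro m φ 
    have ht : ∀ {m k : ℕ} (t : LA.Term (Empty ⊕ Fin m)) (g : Fin m → UF k), (∀ i, Trm (g i)) →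
        Trm (fun M _ _ v => t.realize (Sum.elim default (fun i => g i M v))) :=
      fun t g hg => Trm.subst (f := fun M _ _ v => t.realize (Sum.elim default v)) ⟨t, fun M _ _ _ v => rfl⟩ hg
    have hs : ∀ {m k : ℕ} (g : Fin m → UF k), (∀ i, Trm (g i)) → 
        ∀ i, Trm ((fun i M _ _ v => (Fin.snoc (fun i => g i M (Fin.init v)) (v (Fin.last k)) : Fin (m+1) → M) i : Fin (m+1) → UF (k+1)) i) := by
      intro m k g hg i
      refine Fin.lastCases ?_ (fun j => ?_) i
      · simpa using Trm.var _
      · simpa using (hg j).init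
    induction φ with
    | falsum => intro k g hg; exact Dl0.false.df
    | equal t u => 
      intro k g hg
      exact (Dl0.eq (ht t g hg) (ht u g hg)).df
    | @rel n l R ts =>
      intro k g hg
      match l, R, ts with
      | 0, R, ts => exact Empty.elim R
      | 1, R, ts => exact Empty.elim R
      | 2, R, ts => exact (Dl0.le (ht (ts 0) g hg) (ht (ts 1) g hg)).df
      | (l+3), R, ts => exact Empty.elim R
    | imp h1 h2 ih1 ih2 => 
      intro k g hg
      simp only [BoundedFormula.realize_imp]
      exact Df.imp (ih1 g hg) (ih2 g hg)
    | all φ ih =>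
      intro k g hg
      refine (Df.all (P := fun M _ _ v x => φ.Realize default (Fin.snoc (fun i => g i M v) x)) (ih _ (hs g hg))).congr ?_
      intro M _ _ _ v
      simp
  exact (key φ g hg).congr fun M _ _ _ v => h2 M _

theorem Df.init {k : ℕ} {P : UP k} (hP : Df P) : Df (fun M _ _ (v : Fin (k+1) → M) => P M (Fin.init v)) :=
  hP.subst (fun i => Trm.var (Fin.castSucc i))

theorem Df.induct {k : ℕ} {P : UP (k+1)} (hP : Df P) {M : Type} [CommSemiring M] [LinearOrder M] [PAM M]
    (p : Fin k → M) (h0 : P M (Matrix.vecCons 0 p))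
    (hs : ∀ x, P M (Matrix.vecCons x p) → P M (Matrix.vecCons (x + 1) p)) (x : M) :
    P M (Matrix.vecCons x p) := by
  obtain ⟨φ, hφ⟩ := Df.subst hP (g := fun i => (Matrix.vecCons (fun M _ _ v => v (Fin.last k)) 
     (fun j : Fin k => (fun M _ _ v => v j.castSucc : UF (k+1)))) i)
     (fun i => by refine Fin.cases ?_ (fun j => ?_) i <;> exact Trm.var _)
  have e : ∀ x : M, φ.Realize default (Fin.snoc p x) ↔ P M (Matrix.vecCons x p) := by
    intro x
    refine (hφ M _).trans (iff_of_eq ?_)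
    dsimp only
    congr 1
    funext i
    refine Fin.cases ?_ (fun j => ?_) i <;> simp
  have := PAM.ind k φ p ((e _).2 h0) (fun x hx => (e _).2 (hs x ((e _).1 hx))) x
  exact (e _).1 this

theorem Df.strong_induct {k : ℕ} {P : UP (k+1)} (hP : Df P) {M : Type} [CommSemiring M] [LinearOrder M] [PAM M]
    (p : Fin k → M) 
    (hs : ∀ x, (∀ y < x, P M (Matrix.vecCons y p)) → P M (Matrix.vecCons x p)) (x : M) :
    P M (Matrix.vecCons x p) := by
  have hQ : Df (k := k+1) (fun M _ _ v => ∀ y, y < v 0 → P M (Matrix.vecCons y (fun i => v i.succ))) := by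
    apply Df.all (P := fun M _ _ v y => y < v 0 → P M (Matrix.vecCons y (fun i => v i.succ)))
    apply Df.imp
    · exact (Dl0.lt (Trm.var _) (Trm.var (Fin.castSucc 0))).df
    · have := Df.subst (k := k+2) hP (g := Matrix.vecCons (fun M _ _ v => v (Fin.last _)) (fun i => (fun M _ _ v => v i.succ.castSucc)))
        (fun i => by refine Fin.cases ?_ (fun j => ?_) i <;> exact Trm.var _)
      refine this.congr ?_
      intro M _ _ _ v
      apply iff_of_eq
      congr 1
      funext i
      refine Fin.cases ?_ (fun j => ?_) i <;> simp [Fin.init]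
  have := Df.induct hQ p (by simp) (by
    intro x ih y hy
    rcases eq_or_lt_of_le (lt_succ_iff'.1 hy) with rfl | hy
    · exact hs _ ih
    · exact ih y hy) (x + 1)
  exact this x (lt_add_one x)

/-! ### Sigma_k and Pi_k -/

def SigP (n : ℕ) {k : ℕ} (P : UP k) : Prop := ∃ φ : LA.BoundedFormula Empty k, IsSigmaFml n φ ∧
  ∀ (M : Type) [CommSemiring M] [LinearOrder M] [PAM M] (v : Fin k → M),
    φ.Realize default v ↔ P M v
def PiP (n : ℕ) {k : ℕ} (P : UP k) : Prop := ∃ φ : LA.BoundedFormula Empty k, IsPiFml n φ ∧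
  ∀ (M : Type) [CommSemiring M] [LinearOrder M] [PAM M] (v : Fin k → M),
    φ.Realize default v ↔ P M v

theorem SigP.df {n k : ℕ} {P : UP k} (hP : SigP n P) : Df P := by
  obtain ⟨φ, h1, h2⟩ := hP
  exact ⟨φ, h2⟩
theorem PiP.df {n k : ℕ} {P : UP k} (hP : PiP n P) : Df P := by
  obtain ⟨φ, h1, h2⟩ := hP
  exact ⟨φ, h2⟩
theorem SigP.congr {n k : ℕ} {P Q : UP k} (hP : SigP n P)
    (h : ∀ (M : Type) [CommSemiring M] [LinearOrder M] [PAM M] (v : Fin k → M), P M v ↔ Q M v) : SigP n Q := by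
  obtain ⟨φ, h1, h2⟩ := hP
  exact ⟨φ, h1, fun M _ _ _ v => (h2 M v).trans (h M v)⟩
theorem PiP.congr {n k : ℕ} {P Q : UP k} (hP : PiP n P)
    (h : ∀ (M : Type) [CommSemiring M] [LinearOrder M] [PAM M] (v : Fin k → M), P M v ↔ Q M v) : PiP n Q := by
  obtain ⟨φ, h1, h2⟩ := hP
  exact ⟨φ, h1, fun M _ _ _ v => (h2 M v).trans (h M v)⟩
theorem SigP.dl0 {k : ℕ} {P : UP k} : SigP 0 P ↔ Dl0 P := by
  constructor
  · rintro ⟨φ, h1, h2⟩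
    cases h1 with
    | ofDelta0 h => exact ⟨φ, h, h2⟩
  · rintro ⟨φ, h1, h2⟩
    exact ⟨φ, .ofDelta0 h1, h2⟩
theorem PiP.dl0 {k : ℕ} {P : UP k} : PiP 0 P ↔ Dl0 P := by
  constructor
  · rintro ⟨φ, h1, h2⟩
    cases h1 with
    | ofDelta0 h => exact ⟨φ, h, h2⟩
  · rintro ⟨φ, h1, h2⟩
    exact ⟨φ, .ofDelta0 h1, h2⟩
theorem PiP.sig {n k : ℕ} {P : UP k} (h : PiP n P) : SigP (n+1) P := by
  obtain ⟨φ, h1, h2⟩ := h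
  exact ⟨φ, .ofPi h1, h2⟩
theorem SigP.pi {n k : ℕ} {P : UP k} (h : SigP n P) : PiP (n+1) P := by
  obtain ⟨φ, h1, h2⟩ := h
  exact ⟨φ, .ofSigma h1, h2⟩
theorem SigP.ex {n k : ℕ} 
    {P : ∀ (M : Type) [CommSemiring M] [LinearOrder M], (Fin k → M) → M → Prop}
    (hP : SigP (n+1) (fun M _ _ (v : Fin (k+1) → M) => P M (Fin.init v) (v (Fin.last k)))) :
    SigP (n+1) (fun M _ _ v => ∃ x, P M v x) := by
  obtain ⟨u, h1, hu⟩ := hP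
  exact ⟨∃' u, .ex h1, fun M _ _ _ v => by simp [hu]⟩
theorem PiP.all {n k : ℕ} 
    {P : ∀ (M : Type) [CommSemiring M] [LinearOrder M], (Fin k → M) → M → Prop}
    (hP : PiP (n+1) (fun M _ _ (v : Fin (k+1) → M) => P M (Fin.init v) (v (Fin.last k)))) :
    PiP (n+1) (fun M _ _ v => ∀ x, P M v x) := by
  obtain ⟨u, h1, hu⟩ := hP
  exact ⟨∀' u, .all h1, fun M _ _ _ v => by simp [hu]⟩

theorem sigma_rec {n : ℕ} {C : ∀ {m : ℕ}, LA.BoundedFormula Empty m → Prop}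
    (h1 : ∀ {m} (φ : LA.BoundedFormula Empty m), IsPiFml n φ → C φ)
    (h2 : ∀ {m} (φ : LA.BoundedFormula Empty (m+1)), IsSigmaFml (n+1) φ → C φ → C (∃' φ)) :
    ∀ {m} (φ : LA.BoundedFormula Empty m), IsSigmaFml (n+1) φ → C φ
  | _, _, .ofPi h => h1 _ h
  | _, _, .ex h => h2 _ h (sigma_rec h1 h2 _ h)

theorem pi_rec {n : ℕ} {C : ∀ {m : ℕ}, LA.BoundedFormula Empty m → Prop}
    (h1 : ∀ {m} (φ : LA.BoundedFormula Empty m), IsSigmaFml n φ → C φ)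
    (h2 : ∀ {m} (φ : LA.BoundedFormula Empty (m+1)), IsPiFml (n+1) φ → C φ → C (∀' φ)) :
    ∀ {m} (φ : LA.BoundedFormula Empty m), IsPiFml (n+1) φ → C φ
  | _, _, .ofSigma h => h1 _ h
  | _, _, .all h => h2 _ h (pi_rec h1 h2 _ h)

theorem sigP_piP_comb (n : ℕ) : ∀ {k : ℕ} (φ : LA.BoundedFormula Empty k), 
    (IsSigmaFml n φ → ∀ A : UP k, Dl0 A → SigP n (fun M _ _ v => A M v ∧ φ.Realize default v) ∧
      SigP n (fun M _ _ v => A M v → φ.Realize default v)) ∧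
    (IsPiFml n φ → ∀ A : UP k, Dl0 A → PiP n (fun M _ _ v => A M v ∧ φ.Realize default v) ∧
      PiP n (fun M _ _ v => A M v → φ.Realize default v)) := by
  induction n with
  | zero =>
    intro k φ
    constructor
    · intro h A hA
      have : Dl0 (fun M _ _ v => φ.Realize default v) := by
        cases h with
        | ofDelta0 h => exact ⟨φ, h, fun _ _ _ _ _ => Iff.rfl⟩
      exact ⟨SigP.dl0.2 (hA.and this), SigP.dl0.2 (hA.imp this)⟩
    · intro h A hA
      have : Dl0 (fun M _ _ v => φ.Realize default v) := by
        cases h with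
        | ofDelta0 h => exact ⟨φ, h, fun _ _ _ _ _ => Iff.rfl⟩
      exact ⟨PiP.dl0.2 (hA.and this), PiP.dl0.2 (hA.imp this)⟩
  | succ n ih =>
    intro k φ
    constructor
    · intro h
      revert h
      apply sigma_rec (n := n) (C := fun {k} φ => ∀ A : UP k, Dl0 A → SigP (n+1) (fun M _ _ v => A M v ∧ φ.Realize default v) ∧
          SigP (n+1) (fun M _ _ v => A M v → φ.Realize default v))
      · intro m φ h A hA
        exact ⟨((ih _).2 h A hA).1.sig, ((ih _).2 h A hA).2.sig⟩
      · intro m φ h ihh A hA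
        have := ihh _ hA.init
        constructor
        · refine (SigP.ex (P := fun M _ _ v x => A M v ∧ φ.Realize default (Fin.snoc v x)) (this.1.congr ?_)).congr ?_
          · intro M _ _ _ v; simp
          · intro M _ _ _ v; simp
        · refine (SigP.ex (P := fun M _ _ v x => A M v → φ.Realize default (Fin.snoc v x)) (this.2.congr ?_)).congr ?_
          · intro M _ _ _ v; simp
          · intro M _ _ _ v
            simp
            constructor
            · rintro ⟨x, hx⟩ a
              exact ⟨x, hx a⟩
            · intro hx
              by_cases a : A M v
              · obtain ⟨x, hx⟩ := hx a
                exact ⟨x, fun _ => hx⟩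
              · exact ⟨0, fun a' => absurd a' a⟩
    · intro h
      revert h
      apply pi_rec (n := n) (C := fun {k} φ => ∀ A : UP k, Dl0 A → PiP (n+1) (fun M _ _ v => A M v ∧ φ.Realize default v) ∧
          PiP (n+1) (fun M _ _ v => A M v → φ.Realize default v))
      · intro m φ h A hA
        exact ⟨((ih _).1 h A hA).1.pi, ((ih _).1 h A hA).2.pi⟩
      · intro m φ h ihh A hA
        have := ihh _ hA.init
        constructor
        · refine (PiP.all (P := fun M _ _ v x => A M v ∧ φ.Realize default (Fin.snoc v x)) (this.1.congr ?_)).congr ?_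
          · intro M _ _ _ v; simp
          · intro M _ _ _ v
            have : Nonempty M := ⟨0⟩
            simp [forall_and]
        · refine (PiP.all (P := fun M _ _ v x => A M v → φ.Realize default (Fin.snoc v x)) (this.2.congr ?_)).congr ?_
          · intro M _ _ _ v; simp
          · intro M _ _ _ v
            simp
            tauto

theorem SigP.and_dl0 {n k : ℕ} {A P : UP k} (hA : Dl0 A) (hP : SigP n P) : SigP n (fun M _ _ v => A M v ∧ P M v) := by
  obtain ⟨φ, h1, h2⟩ := hP
  exact ((sigP_piP_comb n φ).1 h1 A hA).1.congr fun M _ _ _ v => by rw [h2]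
theorem SigP.imp_dl0 {n k : ℕ} {A P : UP k} (hA : Dl0 A) (hP : SigP n P) : SigP n (fun M _ _ v => A M v → P M v) := by
  obtain ⟨φ, h1, h2⟩ := hP
  exact ((sigP_piP_comb n φ).1 h1 A hA).2.congr fun M _ _ _ v => by rw [h2]
theorem PiP.and_dl0 {n k : ℕ} {A P : UP k} (hA : Dl0 A) (hP : PiP n P) : PiP n (fun M _ _ v => A M v ∧ P M v) := by
  obtain ⟨φ, h1, h2⟩ := hP
  exact ((sigP_piP_comb n φ).2 h1 A hA).1.congr fun M _ _ _ v => by rw [h2]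
theorem PiP.imp_dl0 {n k : ℕ} {A P : UP k} (hA : Dl0 A) (hP : PiP n P) : PiP n (fun M _ _ v => A M v → P M v) := by
  obtain ⟨φ, h1, h2⟩ := hP
  exact ((sigP_piP_comb n φ).2 h1 A hA).2.congr fun M _ _ _ v => by rw [h2]
theorem PiP.ball {n k : ℕ} {f : UF k} (hf : Trm f)
    {P : ∀ (M : Type) [CommSemiring M] [LinearOrder M], (Fin k → M) → M → Prop}
    (hP : PiP n (fun M _ _ (v : Fin (k+1) → M) => P M (Fin.init v) (v (Fin.last k)))) :
    PiP n (fun M _ _ v => ∀ x, x ≤ f M v → P M v x) := by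
  cases n with
  | zero => exact PiP.dl0.2 (Dl0.ball hf (PiP.dl0.1 hP))
  | succ n => 
    exact PiP.all (P := fun M _ _ v x => x ≤ f M v → P M v x)
      (PiP.imp_dl0 (Dl0.le (Trm.var _) hf.init) hP)

theorem Trm.comp2 {k : ℕ} {F : ∀ (M : Type) [CommSemiring M] [LinearOrder M], M → M → M}
    (h : Trm (k := 2) (fun M _ _ v => F M (v 0) (v 1))) {f g : UF k} (hf : Trm f) (hg : Trm g) :
    Trm (fun M _ _ v => F M (f M v) (g M v)) := 
  h.subst (g := ![f, g]) (by intro i; fin_cases i <;> assumption)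
theorem Dl0.comp1 {k : ℕ} {F : ∀ (M : Type) [CommSemiring M] [LinearOrder M], M → Prop}
    (h : Dl0 (k := 1) (fun M _ _ v => F M (v 0))) {f : UF k} (hf : Trm f)  :
    Dl0 (fun M _ _ v => F M (f M v)) := 
  h.subst (g := ![f]) (by intro i; fin_cases i <;> assumption)
theorem Dl0.comp2 {k : ℕ} {F : ∀ (M : Type) [CommSemiring M] [LinearOrder M], M → M → Prop}
    (h : Dl0 (k := 2) (fun M _ _ v => F M (v 0) (v 1))) {f g : UF k} (hf : Trm f) (hg : Trm g) :
    Dl0 (fun M _ _ v => F M (f M v) (g M v)) := 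
  h.subst (g := ![f, g]) (by intro i; fin_cases i <;> assumption)
theorem Dl0.comp3 {k : ℕ} {F : ∀ (M : Type) [CommSemiring M] [LinearOrder M], M → M → M → Prop}
    (h : Dl0 (k := 3) (fun M _ _ v => F M (v 0) (v 1) (v 2))) {f g l : UF k} (hf : Trm f) (hg : Trm g) (hl : Trm l) :
    Dl0 (fun M _ _ v => F M (f M v) (g M v) (l M v)) := 
  h.subst (g := ![f, g, l]) (by intro i; fin_cases i <;> assumption)
theorem Dl0.comp4 {k : ℕ} {F : ∀ (M : Type) [CommSemiring M] [LinearOrder M], M → M → M → M → Prop}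
    (h : Dl0 (k := 4) (fun M _ _ v => F M (v 0) (v 1) (v 2) (v 3))) {f g l l2 : UF k} (hf : Trm f) (hg : Trm g) (hl : Trm l)
    (hl2 : Trm l2) :
    Dl0 (fun M _ _ v => F M (f M v) (g M v) (l M v) (l2 M v)) := 
  h.subst (g := ![f, g, l, l2]) (by intro i; fin_cases i <;> assumption)
theorem Df.comp1 {k : ℕ} {F : ∀ (M : Type) [CommSemiring M] [LinearOrder M], M → Prop}
    (h : Df (k := 1) (fun M _ _ v => F M (v 0))) {f : UF k} (hf : Trm f)  :
    Df (fun M _ _ v => F M (f M v)) := 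
  h.subst (g := ![f]) (by intro i; fin_cases i <;> assumption)
theorem Df.comp2 {k : ℕ} {F : ∀ (M : Type) [CommSemiring M] [LinearOrder M], M → M → Prop}
    (h : Df (k := 2) (fun M _ _ v => F M (v 0) (v 1))) {f g : UF k} (hf : Trm f) (hg : Trm g) :
    Df (fun M _ _ v => F M (f M v) (g M v)) := 
  h.subst (g := ![f, g]) (by intro i; fin_cases i <;> assumption)
theorem Df.comp3 {k : ℕ} {F : ∀ (M : Type) [CommSemiring M] [LinearOrder M], M → M → M → Prop}
    (h : Df (k := 3) (fun M _ _ v => F M (v 0) (v 1) (v 2))) {f g l : UF k} (hf : Trm f) (hg : Trm g) (hl : Trm l) :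
    Df (fun M _ _ v => F M (f M v) (g M v) (l M v)) := 
  h.subst (g := ![f, g, l]) (by intro i; fin_cases i <;> assumption)

/-- pairing -/
def pr {M : Type} [CommSemiring M] (x y : M) : M := (x + y) * (x + y) + x


theorem Trm.pr {k : ℕ} {f g : UF k} (hf : Trm f) (hg : Trm g) :
    Trm (fun M _ _ v => pr (f M v) (g M v)) := 
  Trm.comp2 (F := fun M _ _ x y => Guaspari.pr x y) (by unfold Guaspari.pr; exact (by repeat' (first | assumption | exact Trm.var _ | exact Trm.zero | exact Trm.one | exact Trm.cast _ | with_reducible apply Trm.add | with_reducible apply Trm.mul))) hf hg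




set_option linter.all false
set_option linter.unusedSimpArgs false


section coding
variable {M : Type} [CommSemiring M] [LinearOrder M]

def Mem (x X : M) : Prop := ∃ c ≤ X, ∃ d ≤ X, ∃ b ≤ X, X = pr (pr c d) b ∧ x < b ∧
  ∃ q ≤ X, c = (1 + (x + 1) * d) * q

theorem Dl0.mem {k : ℕ} {f g : UF k} (hf : Trm f) (hg : Trm g) :
    Dl0 (fun M _ _ v => Mem (f M v) (g M v)) := 
  Dl0.comp2 (F := fun M _ _ x y => Mem x y) (by unfold Mem; exact (by repeat' (first | assumption | exact Trm.var _ | exact Trm.zero | exact Trm.one | exact Trm.cast _ | with_reducible apply Trm.add | with_reducible apply Trm.mul | with_reducible apply Trm.pr | with_reducible apply Dl0.ball | with_reducible apply Dl0.ball' | with_reducible apply Dl0.bex | with_reducible apply Dl0.bex' | with_reducible apply Dl0.and | with_reducible apply Dl0.or | with_reducible apply Dl0.iff | with_reducible apply Dl0.eq | with_reducible apply Dl0.le | with_reducible apply Dl0.lt | with_reducible apply Dl0.ne | exact Dl0.true | exact Dl0.false | with_reducible apply Dl0.not | with_reducible apply Dl0.imp))) hf hg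

variable [PAM M]

theorem le_pr_left (x y : M) : x ≤ pr x y := le_add_self
theorem le_sq (x : M) : x ≤ x * x := by
  rcases eq_or_lt_of_le (zero_le : 0 ≤ x) with h | h
  · rw [← h]; simp
  · exact le_mul_of_one_le_left zero_le (by simpa using succ_le_of_lt h)
theorem le_pr_right (x y : M) : y ≤ pr x y := by
  unfold pr
  calc y ≤ x + y := le_add_self
    _ ≤ (x + y) * (x + y) := le_sq _
    _ ≤ _ := le_self_add
theorem pr_inj {x y x' y' : M} (h : pr x y = pr x' y') : x = x' ∧ y = y' := by
  have key : ∀ x y x' y' : M, x + y < x' + y' → pr x y < pr x' y' := by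
    intro x y x' y' h
    unfold pr
    have h1 := succ_le_of_lt h
    calc (x + y) * (x + y) + x ≤ (x + y) * (x + y) + (x + y) := by gcongr; exact le_self_add
      _ < (x + y + 1) * (x + y + 1) := by
        have : (x + y + 1) * (x + y + 1) = (x + y) * (x + y) + (x + y) + ((x + y) + 1) := by ring
        rw [this]
        exact lt_add_of_pos_right _ (by positivity)
      _ ≤ (x' + y') * (x' + y') := by gcongr
      _ ≤ _ := le_self_add
  rcases lt_trichotomy (x + y) (x' + y') with h1 | h1 | h1
  · exact absurd h (key _ _ _ _ h1).ne
  · unfold pr at h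
    rw [h1] at h
    have := add_left_cancel h
    subst this
    exact ⟨rfl, add_left_cancel h1⟩
  · exact absurd h (key _ _ _ _ h1).ne'
theorem pr_eq_iff {x y x' y' : M} : pr x y = pr x' y' ↔ x = x' ∧ y = y' :=
  ⟨pr_inj, fun h => by rw [h.1, h.2]⟩
theorem pr_mono {x y x' y' : M} (h1 : x ≤ x') (h2 : y ≤ y') : pr x y ≤ pr x' y' := by
  unfold pr; gcongr

theorem Mem.lt {x X : M} (h : Mem x X) : x < X := by
  obtain ⟨c, _, d, _, b, hb, _, h, _⟩ := h
  exact lt_of_lt_of_le h hb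

def Reg (c m : M) : Prop := ∀ x, m ∣ c * x → m ∣ x

theorem dvd_of_add {m x y : M} (hm : 0 < m) (h : m ∣ m * x + y) : m ∣ y := by
  obtain ⟨q, hq⟩ := h
  have : x ≤ q := by
    by_contra hc
    have := mul_lt_mul_of_pos_left (not_le.1 hc) hm
    rw [← hq] at this
    exact absurd this (not_lt.2 le_self_add)
  obtain ⟨r, rfl⟩ := exists_add_of_le this
  rw [mul_add] at hq
  exact ⟨r, add_left_cancel hq⟩

theorem reg_d (i d : M) : Reg d (1 + i * d) := by
  intro x hx
  obtain ⟨q, hq⟩ := hx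
  refine dvd_of_add (x := i * q) (by positivity) ?_
  refine ⟨x, ?_⟩
  calc (1 + i * d) * (i * q) + x = i * ((1 + i * d) * q) + x := by ring
    _ = i * (d * x) + x := by rw [hq]
    _ = _ := by ring

theorem reg_mm {a d : M} (hd : ∀ j ≤ a, 0 < j → j ∣ d) {i b : M} (hi : i < a) (hb : b < a) (hne : i ≠ b) :
    Reg (1 + (b + 1) * d) (1 + (i + 1) * d) := by
  intro x hx
  have hk : ∃ k ≤ a, 0 < k ∧ (1 + (i+1) * d) ∣ k * d * x := by
    rcases lt_or_gt_of_ne hne with h | h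
    · obtain ⟨k, rfl⟩ := exists_add_of_le h.le
      refine ⟨k, le_trans le_add_self hb.le, ?_, ?_⟩
      · exact (pos_of_lt_add_right h)
      · refine dvd_of_add (x := x) (by positivity) ?_
        convert hx using 1
        ring
    · obtain ⟨k, rfl⟩ := exists_add_of_le h.le
      refine ⟨k, le_trans le_add_self hi.le, pos_of_lt_add_right h, ?_⟩
      obtain ⟨q, hq⟩ := hx
      refine dvd_of_add (x := q) (by positivity) ⟨x, ?_⟩
      rw [← hq]; ring
  obtain ⟨k, hka, hk, hkx⟩ := hk
  obtain ⟨l, hl⟩ := hd k hka hk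
  have h2 : (1 + (i+1) * d) ∣ d * (d * x) := by
    have := hkx.mul_left l
    convert this using 1
    calc d * (d * x) = (k * l) * (d * x) := by rw [← hl]
      _ = _ := by ring
  exact reg_d _ _ _ (reg_d _ _ _ h2)

theorem exists_lcm (a : M) : ∃ d : M, 0 < d ∧ ∀ j ≤ a, 0 < j → ∃ q, d = j * q := by
  refine Df.induct (P := fun M _ _ v => ∃ d : M, 0 < d ∧ ∀ j ≤ v 0, 0 < j → ∃ q, d = j * q) (by repeat' (first | assumption | with_reducible apply Df.all | with_reducible apply Df.ex | with_reducible apply Df.and | with_reducible apply Df.or | with_reducible apply Df.iff | with_reducible apply Df.not | with_reducible apply Df.imp | with_reducible apply Dl0.df | exact Trm.var _ | exact Trm.zero | exact Trm.one | exact Trm.cast _ | with_reducible apply Trm.add | with_reducible apply Trm.mul | with_reducible apply Trm.pr | with_reducible apply Dl0.eq | with_reducible apply Dl0.le | with_reducible apply Dl0.lt | with_reducible apply Dl0.ne | exact Dl0.true | exact Dl0.false)) ![] ?_ ?_ a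
  · refine ⟨1, one_pos, ?_⟩
    intro j hj h
    exact absurd h (not_lt.2 hj)
  · rintro x ⟨d, hd, h⟩
    refine ⟨d * (x + 1), by positivity, ?_⟩
    intro j hj hj0
    rcases eq_or_lt_of_le hj with h1 | h1
    · refine ⟨d, ?_⟩
      rw [h1]
      exact mul_comm _ _
    · obtain ⟨q, hq⟩ := h j (lt_succ_iff'.1 h1) hj0
      exact ⟨q * (x + 1), by rw [hq]; ring⟩

def codeE (D : M → Prop) (a d b : M) : Prop := ∃ c, ∀ i < a, ((i < b ∧ D i) → ∃ q, c = (1 + (i + 1) * d) * q) ∧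
  (¬ (i < b ∧ D i) → ∀ x, (∃ q, c * x = (1 + (i + 1) * d) * q) → ∃ q, x = (1 + (i + 1) * d) * q)

theorem code_ex (D : M → Prop) (a : M) (hind : ∀ d, codeE D a d 0 → (∀ b, codeE D a d b → codeE D a d (b + 1)) → codeE D a d a) :
    ∃ X : M, ∀ x, Mem x X ↔ x < a ∧ D x := by
  obtain ⟨d, hd0, hd⟩ := exists_lcm a
  obtain ⟨c, hc⟩ := hind d (by
    refine ⟨1, fun i hi => ⟨fun h => absurd h.1 (not_lt.2 zero_le), fun _ x hx => ?_⟩⟩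
    simpa using hx) (by
    rintro b ⟨c, hc⟩
    by_cases hb : b < a ∧ D b
    · refine ⟨c * (1 + (b + 1) * d), fun i hi => ?_⟩
      obtain ⟨h1, h2⟩ := hc i hi
      constructor
      · rintro ⟨h3, h4⟩
        rcases eq_or_lt_of_le (lt_succ_iff'.1 h3) with rfl | h3
        · exact ⟨c, mul_comm _ _⟩
        · obtain ⟨q, rfl⟩ := h1 ⟨h3, h4⟩
          exact ⟨q * (1 + (b + 1) * d), by ring⟩
      · intro h3 x hx
        have hib : i ≠ b := by
          rintro rfl
          exact h3 ⟨lt_add_one _, hb.2⟩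
        have h4 : ¬ (i < b ∧ D i) := fun h => h3 ⟨lt_of_lt_of_le h.1 le_self_add, h.2⟩
        rw [mul_assoc] at hx
        exact reg_mm hd hi hb.1 hib x (h2 h4 _ hx)
    · refine ⟨c, fun i hi => ?_⟩
      obtain ⟨h1, h2⟩ := hc i hi
      have : (i < b + 1 ∧ D i) ↔ (i < b ∧ D i) := by
        constructor
        · rintro ⟨h3, h4⟩
          rcases eq_or_lt_of_le (lt_succ_iff'.1 h3) with rfl | h3
          · exact absurd ⟨hi, h4⟩ hb
          · exact ⟨h3, h4⟩
        · rintro ⟨h3, h4⟩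
          exact ⟨lt_of_lt_of_le h3 le_self_add, h4⟩
      rw [this]
      exact ⟨h1, h2⟩)
  have lec : c ≤ pr (pr c d) a := (le_pr_left _ _).trans (le_pr_left _ _)
  refine ⟨pr (pr c d) a, fun x => ⟨?_, ?_⟩⟩
  · rintro ⟨c', _, d', _, a', _, h, hx, q, hq, h'⟩
    obtain ⟨h1, rfl⟩ := pr_inj h
    obtain ⟨rfl, rfl⟩ := pr_inj h1
    refine ⟨hx, ?_⟩
    by_contra hD
    obtain ⟨r, hr⟩ := (hc x hx).2 (fun h => hD h.2) 1 ⟨q, by rw [mul_one]; exact h'⟩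
    have hr0 : 0 < r := by
      by_contra h0
      have : r = 0 := le_antisymm (not_lt.1 h0) zero_le
      rw [this, mul_zero] at hr
      exact one_ne_zero hr
    have : 1 * 1 < (1 + (x + 1) * d) * r := by
      apply mul_lt_mul_of_lt_of_le_of_pos_of_nonneg
      · exact lt_add_of_pos_right _ (by positivity)
      · simpa using succ_le_of_lt hr0
      · exact one_pos
      · positivity
    rw [← hr, one_mul] at this
    exact lt_irrefl _ this
  · rintro ⟨hx, hD⟩
    obtain ⟨q, hq⟩ := (hc x hx).1 ⟨hx, hD⟩
    refine ⟨c, lec, d, (le_pr_right _ _).trans (le_pr_left _ _), a, le_pr_right _ _, rfl, hx, q, ?_, hq⟩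
    refine le_trans ?_ lec
    rw [hq]
    exact le_mul_of_one_le_left zero_le le_self_add

theorem Df.code {k : ℕ} {P : UP (k+1)} (hP : Df P) (p : Fin k → M) (a : M) :
    ∃ X : M, ∀ x, Mem x X ↔ x < a ∧ P M (Matrix.vecCons x p) := by
  apply code_ex
  intro d h0 hs
  have hP' : Df (k := k + 5) (fun M _ _ v => P M (Matrix.vecCons (v (Fin.last _)) (fun j : Fin k => v j.succ.succ.succ.castSucc.castSucc))) := by
    refine (Df.subst (k := k+5) hP (g := Matrix.vecCons (fun M _ _ v => v (Fin.last _)) (fun j => (fun M _ _ v => v j.succ.succ.succ.castSucc.castSucc)))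
        (fun i => by refine Fin.cases ?_ (fun j => ?_) i <;> exact Trm.var _)).congr ?_
    intro M _ _ _ v
    apply iff_of_eq
    congr 1
    funext i
    refine Fin.cases ?_ (fun j => ?_) i <;> simp
  refine Df.induct (k := k + 2) (P := fun M _ _ v => codeE (fun i => P M (Matrix.vecCons i (fun j : Fin k => v j.succ.succ.succ))) (v 2) (v 1) (v 0)) 
    ?_ (Matrix.vecCons d (Matrix.vecCons a p)) h0 hs a
  simp only [codeE]
  exact (by repeat' (first | assumption | with_reducible apply Df.all | with_reducible apply Df.ex | with_reducible apply Df.and | with_reducible apply Df.or | with_reducible apply Df.iff | with_reducible apply Df.not | with_reducible apply Df.imp | with_reducible apply Dl0.df | exact Trm.var _ | exact Trm.zero | exact Trm.one | exact Trm.cast _ | with_reducible apply Trm.add | with_reducible apply Trm.mul | with_reducible apply Trm.pr | with_reducible apply Dl0.eq | with_reducible apply Dl0.le | with_reducible apply Dl0.lt | with_reducible apply Dl0.ne | exact Dl0.true | exact Dl0.false))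

theorem code_nat (D : ℕ → Prop) (a : ℕ) : ∃ X : ℕ, ∀ x, Mem x X ↔ x < a ∧ D x := by
  apply code_ex
  intro d h0 hs
  have : ∀ b, codeE D a d b := by
    intro b
    induction b with
    | zero => exact h0
    | succ b ih => exact hs b ih
  exact this a

theorem code_nat_finset (s : Finset ℕ) : ∃ X : ℕ, ∀ x, Mem x X ↔ x ∈ s := by
  obtain ⟨X, hX⟩ := code_nat (· ∈ s) (s.sup id + 1)
  refine ⟨X, fun x => (hX x).trans ⟨fun h => h.2, fun h => ⟨?_, h⟩⟩⟩
  exact Nat.lt_succ_of_le (Finset.le_sup (f := id) h)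

end coding
set_option linter.all false
set_option linter.unusedSimpArgs false


/-- combinator terms denoting functions of one variable -/
inductive Tm : Type
  | atm (i : ℕ) : Tm
  | bin (i : ℕ) (t u : Tm) : Tm
  | comp (t u : Tm) : Tm
  | ball (t u : Tm) : Tm

def Tm.cod : Tm → ℕ
  | .atm i => pr 0 i
  | .bin i t u => pr 1 (pr i (pr t.cod u.cod))
  | .comp t u => pr 2 (pr t.cod u.cod)
  | .ball t u => pr 3 (pr t.cod u.cod)

section val
variable {M : Type} [CommSemiring M] [LinearOrder M]

def AtR (i a y : M) : Prop :=
  (i = 0 ∧ y = a) ∨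
  (i = 1 ∧ ((∃ x ≤ a, ∃ z ≤ a, a = pr x z ∧ y = x) ∨ (¬ (∃ x ≤ a, ∃ z ≤ a, a = pr x z) ∧ y = 0))) ∨
  (i ≠ 0 ∧ i ≠ 1 ∧ ((∃ x ≤ a, ∃ z ≤ a, a = pr x z ∧ y = z) ∨ (¬ (∃ x ≤ a, ∃ z ≤ a, a = pr x z) ∧ y = 0)))
def BinR (i z w y : M) : Prop :=
  (i = 0 ∧ y = z + w) ∨ (i = 1 ∧ y = z * w) ∨ (i ≠ 0 ∧ i ≠ 1 ∧ ((z = w ∧ y = 1) ∨ (z ≠ w ∧ y = 0)))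

theorem Dl0.atR {k : ℕ} {f g h : UF k} (hf : Trm f) (hg : Trm g) (hh : Trm h) :
    Dl0 (fun M _ _ v => AtR (f M v) (g M v) (h M v)) :=
  Dl0.comp3 (F := fun M _ _ x y z => AtR x y z) (by unfold AtR; exact (by repeat' (first | assumption | exact Trm.var _ | exact Trm.zero | exact Trm.one | exact Trm.cast _ | with_reducible apply Trm.add | with_reducible apply Trm.mul | with_reducible apply Trm.pr | with_reducible apply Dl0.ball | with_reducible apply Dl0.ball' | with_reducible apply Dl0.bex | with_reducible apply Dl0.bex' | with_reducible apply Dl0.and | with_reducible apply Dl0.or | with_reducible apply Dl0.iff | with_reducible apply Dl0.eq | with_reducible apply Dl0.le | with_reducible apply Dl0.lt | with_reducible apply Dl0.ne | with_reducible apply Dl0.mem | exact Dl0.true | exact Dl0.false | with_reducible apply Dl0.not | with_reducible apply Dl0.imp))) hf hg hh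
theorem Dl0.binR {k : ℕ} {f g h l : UF k} (hf : Trm f) (hg : Trm g) (hh : Trm h) (hl : Trm l) :
    Dl0 (fun M _ _ v => BinR (f M v) (g M v) (h M v) (l M v)) :=
  Dl0.comp4 (F := fun M _ _ x y z w => BinR x y z w) (by unfold BinR; exact (by repeat' (first | assumption | exact Trm.var _ | exact Trm.zero | exact Trm.one | exact Trm.cast _ | with_reducible apply Trm.add | with_reducible apply Trm.mul | with_reducible apply Trm.pr | with_reducible apply Dl0.ball | with_reducible apply Dl0.ball' | with_reducible apply Dl0.bex | with_reducible apply Dl0.bex' | with_reducible apply Dl0.and | with_reducible apply Dl0.or | with_reducible apply Dl0.iff | with_reducible apply Dl0.eq | with_reducible apply Dl0.le | with_reducible apply Dl0.lt | with_reducible apply Dl0.ne | with_reducible apply Dl0.mem | exact Dl0.true | exact Dl0.false | with_reducible apply Dl0.not | with_reducible apply Dl0.imp))) hf hg hh hl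

noncomputable def atV (i a : M) : M := Classical.epsilon (h := ⟨0⟩) (fun y => AtR i a y)
open Classical in
noncomputable def binV (i z w : M) : M := if i = 0 then z + w else if i = 1 then z * w else if z = w then 1 else 0

open Classical in
noncomputable def Tm.val : Tm → M → M
  | .atm i, a => atV (i : M) a
  | .bin i t u, a => binV (i : M) (t.val a) (u.val a)
  | .comp t u, a => t.val (u.val a)
  | .ball t u, a => if ∀ x ≤ t.val a, u.val (pr a x) ≠ 0 then 1 else 0

def Jus (X x : M) : Prop := ∃ t ≤ x, ∃ a ≤ x, ∃ y ≤ x, x = pr t (pr a y) ∧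
  ((∃ i ≤ t, t = pr 0 i ∧ AtR i a y) ∨
   (∃ i ≤ t, ∃ u ≤ t, ∃ w ≤ t, ∃ z1 ≤ X, ∃ z2 ≤ X, t = pr 1 (pr i (pr u w)) ∧ Mem (pr u (pr a z1)) X ∧
      Mem (pr w (pr a z2)) X ∧ BinR i z1 z2 y) ∨
   (∃ u ≤ t, ∃ w ≤ t, ∃ z ≤ X, t = pr 2 (pr u w) ∧ Mem (pr w (pr a z)) X ∧ Mem (pr u (pr z y)) X) ∨
   (∃ u ≤ t, ∃ w ≤ t, ∃ z ≤ X, t = pr 3 (pr u w) ∧ Mem (pr u (pr a z)) X ∧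
     ((y = 1 ∧ ∀ x ≤ z, ∃ r ≤ X, r ≠ 0 ∧ Mem (pr w (pr (pr a x) r)) X) ∨
      (y = 0 ∧ ∃ x ≤ z, Mem (pr w (pr (pr a x) 0)) X))))

def Cert (X : M) : Prop := ∀ x ≤ X, Mem x X → Jus X x

theorem Trm.two {k : ℕ} : Trm (k := k) (fun M _ _ v => 2) :=
  (Trm.cast (k := k) 2)
theorem Trm.three {k : ℕ} : Trm (k := k) (fun M _ _ v => 3) :=
  (Trm.cast (k := k) 3)

theorem Dl0.jus : Dl0 (k := 2) (fun M _ _ v => Jus (v 0) (v 1)) := by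
  unfold Jus
  repeat' (first | exact Trm.var _ | exact Trm.zero | exact Trm.one | exact Trm.two | exact Trm.three | exact Trm.cast _ | with_reducible apply Trm.add | with_reducible apply Trm.mul | with_reducible apply Trm.pr | with_reducible apply Dl0.ball | with_reducible apply Dl0.ball' | with_reducible apply Dl0.bex | with_reducible apply Dl0.bex' | with_reducible apply Dl0.and | with_reducible apply Dl0.or | with_reducible apply Dl0.iff | with_reducible apply Dl0.eq | with_reducible apply Dl0.le | with_reducible apply Dl0.lt | with_reducible apply Dl0.ne | with_reducible apply Dl0.mem | with_reducible apply Dl0.atR | with_reducible apply Dl0.binR | with_reducible apply Dl0.not | with_reducible apply Dl0.imp)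
theorem Dl0.cert {k : ℕ} {f : UF k} (hf : Trm f) : Dl0 (fun M _ _ v => Cert (f M v)) := 
  Dl0.comp1 (F := fun M _ _ x => Cert x) (by
    have : Dl0 (k := 2) (fun M _ _ v => Mem (v 1) (v 0) → Jus (v 0) (v 1)) := (Dl0.mem (Trm.var _) (Trm.var _)).imp Dl0.jus
    exact Dl0.ball (P := fun M _ _ v x => Mem x (v 0) → Jus (v 0) x) (Trm.var _) this) hf

variable [PAM M]

theorem cast_pr (x y : ℕ) : ((pr x y : ℕ) : M) = pr (x : M) (y : M) := by unfold pr; push_cast; rfl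

theorem atR_iff (i a y : M) : AtR i a y ↔ y = atV i a := by
  have key : ∃ y0, ∀ y, AtR i a y ↔ y = y0 := by
    unfold AtR
    by_cases h0 : i = 0
    · refine ⟨a, fun y => ?_⟩
      subst h0
      simp
    by_cases hp : ∃ x ≤ a, ∃ z ≤ a, a = pr x z
    · have hp' := hp
      obtain ⟨x, hx, z, hz, h⟩ := hp
      by_cases h1 : i = 1
      · refine ⟨x, fun y => ?_⟩
        simp only [h0, h1, hp', not_true, false_and, or_false, true_and, false_or, ne_eq, not_false_iff, one_ne_zero]
        constructor
        · rintro ⟨x', _, z', _, h', rfl⟩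
          rw [h] at h'
          exact (pr_inj h').1.symm
        · rintro rfl
          exact ⟨y, hx, z, hz, h, rfl⟩
      · refine ⟨z, fun y => ?_⟩
        simp only [h0, h1, hp', not_true, false_and, or_false, true_and, false_or, ne_eq, not_false_iff, one_ne_zero]
        constructor
        · rintro ⟨x', _, z', _, h', rfl⟩
          rw [h] at h'
          exact (pr_inj h').2.symm
        · rintro rfl
          exact ⟨x, hx, y, hz, h, rfl⟩
    · refine ⟨0, fun y => ?_⟩
      have hp2 : ¬ ∃ x ≤ a, ∃ z ≤ a, a = pr x z ∧ y = x := fun ⟨x, hx, z, hz, h, _⟩ => hp ⟨x, hx, z, hz, h⟩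
      have hp3 : ¬ ∃ x ≤ a, ∃ z ≤ a, a = pr x z ∧ y = z := fun ⟨x, hx, z, hz, h, _⟩ => hp ⟨x, hx, z, hz, h⟩
      simp only [h0, hp, hp2, hp3]
      tauto
  obtain ⟨y0, hy⟩ := key
  have h2 : AtR i a (atV i a) := Classical.epsilon_spec (p := fun y => AtR i a y) ⟨y0, (hy y0).2 rfl⟩
  rw [hy] at h2
  rw [hy, h2]

theorem binR_iff (i z w y : M) : BinR i z w y ↔ y = binV i z w := by
  unfold BinR binV
  by_cases h0 : i = 0
  · simp [h0]
  by_cases h1 : i = 1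
  · simp [h1]
  by_cases h2 : z = w <;> simp [h0, h1, h2]

theorem at0 (a : M) : (Tm.atm 0).val a = a := by
  refine ((atR_iff _ _ _).1 ?_).symm
  exact Or.inl ⟨by simp, rfl⟩
theorem at1 (a b : M) : (Tm.atm 1).val (pr a b) = a := by
  refine ((atR_iff _ _ _).1 ?_).symm
  exact Or.inr (Or.inl ⟨by simp, Or.inl ⟨a, le_pr_left _ _, b, le_pr_right _ _, rfl, rfl⟩⟩)
theorem at2 (a b : M) : (Tm.atm 2).val (pr a b) = b := by
  refine ((atR_iff _ _ _).1 ?_).symm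
  refine Or.inr (Or.inr ⟨by simp, ?_, Or.inl ⟨a, le_pr_left _ _, b, le_pr_right _ _, rfl, rfl⟩⟩)
  norm_num

theorem pr_tag {i j : ℕ} {x y : M} (h : pr (i : M) x = pr (j : M) y) : i = j ∧ x = y :=
  ⟨Nat.cast_injective (pr_inj h).1, (pr_inj h).2⟩

theorem jus_elim {X : M} (hX : Cert X) {t a y : M} (h : Mem (pr t (pr a y)) X) :
    ((∃ i, t = pr ((0 : ℕ) : M) i ∧ AtR i a y) ∨
   (∃ i u w z1 z2, t = pr ((1 : ℕ) : M) (pr i (pr u w)) ∧ Mem (pr u (pr a z1)) X ∧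
      Mem (pr w (pr a z2)) X ∧ BinR i z1 z2 y) ∨
   (∃ u w z, t = pr ((2 : ℕ) : M) (pr u w) ∧ Mem (pr w (pr a z)) X ∧ Mem (pr u (pr z y)) X) ∨
   (∃ u w z, t = pr ((3 : ℕ) : M) (pr u w) ∧ Mem (pr u (pr a z)) X ∧
     ((y = 1 ∧ ∀ x ≤ z, ∃ r, r ≠ 0 ∧ Mem (pr w (pr (pr a x) r)) X) ∨
      (y = 0 ∧ ∃ x ≤ z, Mem (pr w (pr (pr a x) 0)) X)))) := by
  obtain ⟨t', _, a', _, y', _, he, h⟩ := hX _ h.lt.le h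
  obtain ⟨rfl, h2⟩ := pr_inj he
  obtain ⟨rfl, rfl⟩ := pr_inj h2
  push_cast
  rcases h with ⟨i, _, h⟩ | ⟨i, _, u, _, w, _, z1, _, z2, _, h⟩ | ⟨u, _, w, _, z, _, h⟩ | ⟨u, _, w, _, z, _, h1, h2, h⟩
  · exact Or.inl ⟨i, h⟩
  · exact Or.inr (Or.inl ⟨i, u, w, z1, z2, h⟩)
  · exact Or.inr (Or.inr (Or.inl ⟨u, w, z, h⟩))
  · refine Or.inr (Or.inr (Or.inr ⟨u, w, z, h1, h2, ?_⟩))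
    rcases h with ⟨h3, h4⟩ | h
    · left
      refine ⟨h3, fun x hx => ?_⟩
      obtain ⟨r, _, hr⟩ := h4 x hx
      exact ⟨r, hr⟩
    · exact Or.inr h

theorem cert_correct {X : M} (hX : Cert X) (t : Tm) : ∀ a y : M, Mem (pr (t.cod : M) (pr a y)) X → y = t.val a := by
  induction t with
  | atm i =>
    intro a y h
    rw [Tm.cod, cast_pr] at h
    rcases jus_elim hX h with ⟨i', h, h'⟩ | ⟨i', u, w, z1, z2, h, _⟩ | ⟨u, w, z, h, _⟩ | ⟨u, w, z, h, _⟩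
    · obtain ⟨_, rfl⟩ := pr_tag h
      exact (atR_iff _ _ _).1 h'
    all_goals exact absurd (pr_tag h).1 (by norm_num)
  | bin i t u iht ihu => 
    intro a y h
    rw [Tm.cod, cast_pr] at h
    rcases jus_elim hX h with ⟨i', h, h'⟩ | ⟨i', u, w, z1, z2, h, h1, h2, h3⟩ | ⟨u, w, z, h, _⟩ | ⟨u, w, z, h, _⟩
    rotate_left
    · have := (pr_tag h).2
      rw [cast_pr, cast_pr] at this
      obtain ⟨rfl, h4⟩ := pr_inj this
      obtain ⟨rfl, rfl⟩ := pr_inj h4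
      rw [binR_iff] at h3
      rw [h3, iht _ _ h1, ihu _ _ h2]
      rfl
    all_goals exact absurd (pr_tag h).1 (by norm_num)
  | comp t u iht ihu =>
    intro a y h
    rw [Tm.cod, cast_pr] at h
    rcases jus_elim hX h with ⟨i', h, h'⟩ | ⟨i', u, w, z1, z2, h, _⟩ | ⟨u, w, z, h, h1, h2⟩ | ⟨u, w, z, h, _⟩
    rotate_left 2
    · have := (pr_tag h).2
      rw [cast_pr] at this
      obtain ⟨rfl, rfl⟩ := pr_inj this
      rw [iht _ _ h2, ihu _ _ h1]
      rfl
    all_goals exact absurd (pr_tag h).1 (by norm_num)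
  | ball t u iht ihu => 
    intro a y h
    rw [Tm.cod, cast_pr] at h
    rcases jus_elim hX h with ⟨i', h, h'⟩ | ⟨i', u, w, z1, z2, h, _⟩ | ⟨u, w, z, h, _⟩ | ⟨u, w, z, h, h1, h2⟩
    rotate_left 3
    · have := (pr_tag h).2
      rw [cast_pr] at this
      obtain ⟨rfl, rfl⟩ := pr_inj this
      have h3 := iht _ _ h1
      subst h3
      rw [Tm.val]
      rcases h2 with ⟨rfl, h2⟩ | ⟨rfl, x, hx, h2⟩
      · rw [if_pos]
        intro x hx
        obtain ⟨r, hr, hm⟩ := h2 x hx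
        rwa [← ihu _ _ hm]
      · rw [if_neg]
        intro hh
        exact hh x hx (ihu _ _ h2).symm
    all_goals exact absurd (pr_tag h).1 (by norm_num)

theorem le_of_mem {u a z Y : M} (h : Mem (pr u (pr a z)) Y) : z ≤ Y :=
  ((le_pr_right _ _).trans (le_pr_right _ _)).trans h.lt.le

theorem jus_atm {Y a : M} {i : ℕ} : Jus Y (pr ((Tm.atm i).cod : M) (pr a ((Tm.atm i).val a))) := by
  refine ⟨_, le_pr_left _ _, a, (le_pr_left _ _).trans (le_pr_right _ _), _, (le_pr_right _ _).trans (le_pr_right _ _), rfl, ?_⟩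
  refine Or.inl ⟨i, ?_, ?_, ?_⟩
  · rw [Tm.cod, cast_pr]; exact le_pr_right _ _
  · rw [Tm.cod, cast_pr]; simp
  · exact (atR_iff _ _ _).2 rfl
theorem jus_bin {Y a : M} {i : ℕ} {t u : Tm} (h1 : Mem (pr (t.cod : M) (pr a (t.val a))) Y)
    (h2 : Mem (pr (u.cod : M) (pr a (u.val a))) Y) :
    Jus Y (pr ((Tm.bin i t u).cod : M) (pr a ((Tm.bin i t u).val a))) := by
  refine ⟨_, le_pr_left _ _, a, (le_pr_left _ _).trans (le_pr_right _ _), _, (le_pr_right _ _).trans (le_pr_right _ _), rfl, ?_⟩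
  rw [Tm.cod, cast_pr, cast_pr, cast_pr]
  refine Or.inr (Or.inl ⟨i, ?_, t.cod, ?_, u.cod, ?_, _, le_of_mem h1, _, le_of_mem h2, by simp, h1, h2, ?_⟩)
  · exact (le_pr_left _ _).trans (le_pr_right _ _)
  · exact ((le_pr_left _ _).trans (le_pr_right _ _)).trans (le_pr_right _ _)
  · exact ((le_pr_right _ _).trans (le_pr_right _ _)).trans (le_pr_right _ _)
  · exact (binR_iff _ _ _ _).2 rfl
theorem jus_comp {Y a : M} {t u : Tm} (h1 : Mem (pr (u.cod : M) (pr a (u.val a))) Y)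
    (h2 : Mem (pr (t.cod : M) (pr (u.val a) (t.val (u.val a)))) Y) :
    Jus Y (pr ((Tm.comp t u).cod : M) (pr a ((Tm.comp t u).val a))) := by
  refine ⟨_, le_pr_left _ _, a, (le_pr_left _ _).trans (le_pr_right _ _), _, (le_pr_right _ _).trans (le_pr_right _ _), rfl, ?_⟩
  rw [Tm.cod, cast_pr, cast_pr]
  refine Or.inr (Or.inr (Or.inl ⟨t.cod, ?_, u.cod, ?_, _, le_of_mem h1, by simp, h1, h2⟩))
  · exact ((le_pr_left _ _).trans (le_pr_right _ _))
  · exact ((le_pr_right _ _).trans (le_pr_right _ _))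
theorem jus_ball {Y a : M} {t u : Tm} (h1 : Mem (pr (t.cod : M) (pr a (t.val a))) Y)
    (h2 : ∀ x ≤ t.val a, Mem (pr (u.cod : M) (pr (pr a x) (u.val (pr a x)))) Y) :
    Jus Y (pr ((Tm.ball t u).cod : M) (pr a ((Tm.ball t u).val a))) := by
  refine ⟨_, le_pr_left _ _, a, (le_pr_left _ _).trans (le_pr_right _ _), _, (le_pr_right _ _).trans (le_pr_right _ _), rfl, ?_⟩
  rw [Tm.cod, cast_pr, cast_pr]
  refine Or.inr (Or.inr (Or.inr ⟨t.cod, ?_, u.cod, ?_, _, le_of_mem h1, by simp, h1, ?_⟩))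
  · exact ((le_pr_left _ _).trans (le_pr_right _ _))
  · exact ((le_pr_right _ _).trans (le_pr_right _ _))
  · rw [Tm.val]
    split_ifs with h
    · left
      exact ⟨rfl, fun x hx => ⟨_, le_of_mem (h2 x hx), h x hx, h2 x hx⟩⟩
    · right
      push Not at h
      obtain ⟨x, hx, h⟩ := h
      refine ⟨rfl, x, hx, ?_⟩
      have := h2 x hx
      rwa [h] at this

theorem Jus.mono {X Y x : M} (hXY : ∀ z, Mem z X → Mem z Y) (h : Jus X x) : Jus Y x := by
  obtain ⟨t', h1, a', h2, y', h3, he, h⟩ := h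
  refine ⟨t', h1, a', h2, y', h3, he, ?_⟩
  rcases h with h | ⟨i, h4, u, h5, w, h6, z1, h7, z2, h8, h9, h10, h11, h12⟩ | ⟨u, h5, w, h6, z, h7, h8, h9, h10⟩ | ⟨u, h5, w, h6, z, h7, h8, h9, h10⟩
  · exact Or.inl h
  · exact Or.inr (Or.inl ⟨i, h4, u, h5, w, h6, z1, le_of_mem (hXY _ h10), z2, le_of_mem (hXY _ h11), h9, hXY _ h10, hXY _ h11, h12⟩)
  · exact Or.inr (Or.inr (Or.inl ⟨u, h5, w, h6, z, le_of_mem (hXY _ h9), h8, hXY _ h9, hXY _ h10⟩))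
  · refine Or.inr (Or.inr (Or.inr ⟨u, h5, w, h6, z, le_of_mem (hXY _ h9), h8, hXY _ h9, ?_⟩))
    rcases h10 with ⟨h11, h12⟩ | ⟨h11, x, hx, h12⟩
    · left
      refine ⟨h11, fun x hx => ?_⟩
      obtain ⟨r, h13, h14, h15⟩ := h12 x hx
      exact ⟨r, le_of_mem (hXY _ h15), h14, hXY _ h15⟩
    · right
      exact ⟨h11, x, hx, hXY _ h12⟩

theorem Df.val (t : Tm) : ∀ {k : ℕ} {f g : UF k}, Trm f → Trm g → Df (fun M _ _ v => g M v = t.val (f M v)) := by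
  induction t with
  | atm i => 
    intro k f g hf hg
    refine ((Dl0.atR (Trm.cast i) hf hg).df).congr fun M _ _ _ v => ?_
    exact atR_iff _ _ _
  | bin i t u iht ihu =>
    intro k f g hf hg
    have : Df (k := k) (fun M _ _ v => ∃ x, ∃ y, x = t.val (f M v) ∧ y = u.val (f M v) ∧ BinR (i : M) x y (g M v)) := by
      apply Df.ex (P := fun M _ _ v x => ∃ y, x = t.val (f M v) ∧ y = u.val (f M v) ∧ BinR (i : M) x y (g M v))
      apply Df.ex (P := fun M _ _ v y => v (Fin.last k) = t.val (f M (Fin.init v)) ∧ y = u.val (f M (Fin.init v)) ∧ BinR (i : M) (v (Fin.last k)) y (g M (Fin.init v)))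
      apply Df.and (iht hf.init.init (Trm.var (Fin.castSucc (Fin.last k)))) (Df.and (ihu hf.init.init (Trm.var _)) (Dl0.df _))
      exact Dl0.binR (Trm.cast i) (Trm.var (Fin.castSucc (Fin.last k))) (Trm.var _) hg.init.init
    refine this.congr fun M _ _ _ v => ?_
    simp [binR_iff, Tm.val]
  | comp t u iht ihu =>
    intro k f g hf hg
    have : Df (k := k) (fun M _ _ v => ∃ x, x = u.val (f M v) ∧ g M v = t.val x) := by
      apply Df.ex (P := fun M _ _ v x => x = u.val (f M v) ∧ g M v = t.val x)
      exact Df.and (ihu hf.init (Trm.var _)) (iht (Trm.var _) hg.init)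
    refine this.congr fun M _ _ _ v => ?_
    simp [Tm.val]
  | ball t u iht ihu =>
    intro k f g hf hg
    have h1 : Df (k := k) (fun M _ _ v => ∃ z, z = t.val (f M v) ∧ ∀ x, x ≤ z → ¬ (0 = u.val (pr (f M v) x))) := by
      apply Df.ex (P := fun M _ _ v z => z = t.val (f M v) ∧ ∀ x, x ≤ z → ¬ (0 = u.val (pr (f M v) x)))
      refine Df.and (iht hf.init (Trm.var _)) ?_
      apply Df.all (P := fun M _ _ v x => x ≤ v (Fin.last k) → ¬ (0 = u.val (pr (f M (Fin.init v)) x)))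
      refine Df.imp (Dl0.le (Trm.var _) (Trm.var (Fin.castSucc (Fin.last k)))).df (Df.not ?_)
      exact ihu (Trm.pr hf.init.init (Trm.var _)) Trm.zero
    refine ((h1.and (Dl0.eq hg Trm.one).df).or (h1.not.and (Dl0.eq hg Trm.zero).df)).congr fun M _ _ _ v => ?_
    have : (∃ z, z = t.val (f M v) ∧ ∀ x, x ≤ z → ¬ (0 = u.val (pr (f M v) x))) ↔ ∀ x ≤ t.val (f M v), u.val (pr (f M v) x) ≠ 0 := by
      simp [eq_comm]
    rw [this, Tm.val]
    split_ifs with h <;> tauto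

theorem cert_step (t : Tm) {b X1 X2 c : M} (h1 : Cert X1) (h2 : Cert X2) (hc : ∀ a < b, t.val a ≤ c)
    (hj : ∀ Y, (∀ x, Mem x X1 → Mem x Y) → (∀ x, Mem x X2 → Mem x Y) → ∀ a < b, Jus Y (pr (t.cod : M) (pr a (t.val a)))) :
    ∃ X, Cert X ∧ ∀ a < b, Mem (pr (t.cod : M) (pr a (t.val a))) X := by
  have hD : Df (k := 4) (fun M _ _ v => Mem (v 0) (v 1) ∨ Mem (v 0) (v 2) ∨ ∃ a, ∃ y, a < v 3 ∧ y = t.val a ∧ v 0 = pr (t.cod : M) (pr a y)) := by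
    refine (Dl0.mem (Trm.var _) (Trm.var _)).df.or ((Dl0.mem (Trm.var _) (Trm.var _)).df.or ?_)
    apply Df.ex (P := fun M _ _ v a => ∃ y, a < v 3 ∧ y = t.val a ∧ v 0 = pr (t.cod : M) (pr a y))
    apply Df.ex (P := fun M _ _ v y => v 4 < v 3 ∧ y = t.val (v 4) ∧ v 0 = pr (t.cod : M) (pr (v 4) y))
    refine Df.and (Dl0.lt (Trm.var (4 : Fin 6)) (Trm.var (3 : Fin 6))).df (Df.and (Df.val t (Trm.var (4 : Fin 6)) (Trm.var (5 : Fin 6))) ?_)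
    exact (Dl0.eq (Trm.var (0 : Fin 6)) ((Trm.cast _).pr ((Trm.var (4 : Fin 6)).pr (Trm.var (5 : Fin 6))))).df
  obtain ⟨X, hX⟩ := hD.code ![X1, X2, b] (X1 + X2 + pr (t.cod : M) (pr b c) + 1)
  have i1 : ∀ x, Mem x X1 → Mem x X := fun x h => (hX x).2 ⟨by
    refine lt_of_lt_of_le h.lt ?_
    rw [add_assoc, add_assoc]
    exact le_self_add, Or.inl h⟩
  have i2 : ∀ x, Mem x X2 → Mem x X := fun x h => (hX x).2 ⟨by
    refine lt_of_lt_of_le h.lt ?_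
    rw [add_comm X1, add_assoc, add_assoc]
    exact le_self_add, Or.inr (Or.inl h)⟩
  have i3 : ∀ a < b, Mem (pr (t.cod : M) (pr a (t.val a))) X := by
    intro a ha
    refine (hX _).2 ⟨?_, Or.inr (Or.inr ⟨a, _, ha, rfl, rfl⟩)⟩
    refine lt_succ_iff'.2 ?_
    refine le_trans ?_ le_add_self
    exact pr_mono le_rfl (pr_mono ha.le (hc a ha))
  refine ⟨X, ?_, i3⟩
  intro x _ hx
  obtain ⟨_, h | h | ⟨a, y, ha, hy, h⟩⟩ := (hX x).1 hx
  · exact (h1 x (Mem.lt h).le h).mono i1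
  · exact (h2 x (Mem.lt h).le h).mono i2
  · have h : x = pr (t.cod : M) (pr a y) := h
    subst hy
    rw [h]
    exact hj X i1 i2 a ha

theorem cert_ex (t : Tm) : ∀ b : M, ∃ X, Cert X ∧ ∀ a < b, Mem (pr (t.cod : M) (pr a (t.val a))) X := by
  have hempty : ∃ X : M, Cert X ∧ ∀ x, ¬ Mem x X := by
    have hD : Df (k := 1) (fun M _ _ v => False) := Dl0.false.df
    obtain ⟨X, hX⟩ := hD.code ![] (0 : M)
    exact ⟨X, fun x _ h => ((hX x).1 h).2.elim, fun x h => ((hX x).1 h).2.elim⟩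
  obtain ⟨E, hE, _⟩ := hempty
  induction t with
  | atm i =>
    intro b
    refine cert_step (c := b) _ hE hE ?_ (fun Y _ _ a ha => jus_atm)
    intro a ha
    refine le_trans ?_ ha.le
    have : AtR (i : M) a ((Tm.atm i).val a) := (atR_iff _ _ _).2 rfl
    rcases this with ⟨_, h⟩ | ⟨_, ⟨x, h1, z, h2, h3, h⟩ | ⟨_, h⟩⟩ | ⟨_, _, ⟨x, h1, z, h2, h3, h⟩ | ⟨_, h⟩⟩
    · exact h.le
    · rw [h]; exact h1
    · rw [h]; exact zero_le
    · rw [h]; exact h2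
    · rw [h]; exact zero_le
  | bin i t u iht ihu =>
    intro b
    obtain ⟨X1, h1, h1'⟩ := iht b
    obtain ⟨X2, h2, h2'⟩ := ihu b
    refine cert_step (c := (X1 + X2) * (X1 + X2) + (X1 + X2) + 1) _ h1 h2 ?_ (fun Y hY1 hY2 a ha => jus_bin (hY1 _ (h1' a ha)) (hY2 _ (h2' a ha)))
    intro a ha
    have l1 := le_of_mem (h1' a ha)
    have l2 := le_of_mem (h2' a ha)
    rw [Tm.val, binV]
    split_ifs
    · refine (add_le_add l1 l2).trans (le_trans ?_ le_self_add)
      exact le_add_self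
    · refine (mul_le_mul' (l1.trans (le_self_add : X1 ≤ X1 + X2)) (l2.trans (le_add_self : X2 ≤ X1 + X2))).trans ?_
      rw [add_assoc]
      exact le_self_add
    · exact le_add_self
    · exact zero_le
  | comp t u iht ihu =>
    intro b
    obtain ⟨X1, h1, h1'⟩ := ihu b
    obtain ⟨X2, h2, h2'⟩ := iht (X1 + 1)
    refine cert_step (c := X2) _ h1 h2 ?_ (fun Y hY1 hY2 a ha => jus_comp (hY1 _ (h1' a ha)) (hY2 _ (h2' _ ?_)))
    · intro a ha
      exact le_of_mem (h2' _ (lt_succ_iff'.2 (le_of_mem (h1' a ha))))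
    · exact (lt_succ_iff'.2 (le_of_mem (h1' a ha)))
  | ball t u iht ihu =>
    intro b
    obtain ⟨X1, h1, h1'⟩ := iht b
    obtain ⟨X2, h2, h2'⟩ := ihu (pr b X1 + 1)
    refine cert_step (c := 1) _ h1 h2 ?_ (fun Y hY1 hY2 a ha => jus_ball (hY1 _ (h1' a ha)) (fun x hx => hY2 _ (h2' _ ?_)))
    · intro a ha
      rw [Tm.val]
      split_ifs
      · exact le_rfl
      · exact zero_le
    · exact lt_succ_iff'.2 (pr_mono ha.le (hx.trans (le_of_mem (h1' a ha))))

end val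
set_option linter.all false
set_option linter.unusedSimpArgs false

section univ
variable {M : Type} [CommSemiring M] [LinearOrder M]

mutual
def USig : ∀ (k : ℕ), M → M → Prop
  | 0, e, b => ∀ a ≤ b, ∀ y ≤ b, ∀ X ≤ b, b = pr a (pr y X) → Cert X → ¬ Mem (pr e (pr (pr a y) 0)) X
  | (k+1), e, a => ∃ u, UPi k e (pr a u)
def UPi : ∀ (k : ℕ), M → M → Prop
  | 0, e, b => ∃ a ≤ b, ∃ y ≤ b, ∃ X ≤ b, b = pr a (pr y X) ∧ Cert X ∧ ∃ r ≤ b, r ≠ 0 ∧ Mem (pr e (pr (pr a y) r)) X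
  | (k+1), e, a => ∀ u, USig k e (pr a u)
end

mutual
def NSig : ∀ (k : ℕ), Tm → M → Prop
  | 0, t, a => t.val a ≠ 0
  | (k+1), t, a => ∃ u, NPi k t (pr a u)
def NPi : ∀ (k : ℕ), Tm → M → Prop
  | 0, t, a => t.val a ≠ 0
  | (k+1), t, a => ∀ u, NSig k t (pr a u)
end

variable [PAM M]

theorem univ_nf (k : ℕ) : (∀ (t : Tm) (a : M), USig (k+1) (t.cod : M) a ↔ NSig (k+1) t a) ∧
    (∀ (t : Tm) (a : M), UPi (k+1) (t.cod : M) a ↔ NPi (k+1) t a) := by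
  induction k with
  | zero =>
    constructor
    · intro t a
      simp only [USig, UPi, NSig, NPi]
      constructor
      · rintro ⟨u, a', _, y, _, X, _, h, hX, r, _, hr, hm⟩
        obtain ⟨rfl, rfl⟩ := pr_inj h
        refine ⟨y, ?_⟩
        rw [← cert_correct hX t _ _ hm]
        exact hr
      · rintro ⟨y, hy⟩
        obtain ⟨X, hX, h⟩ := cert_ex t (pr a y + 1)
        have hm := h (pr a y) (lt_add_one _)
        exact ⟨pr y X, a, le_pr_left _ _, y, (le_pr_left _ _).trans (le_pr_right _ _), X, (le_pr_right _ _).trans (le_pr_right _ _), rfl,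
          hX, _, (le_of_mem hm).trans ((le_pr_right _ _).trans (le_pr_right _ _)), hy, hm⟩
    · intro t a
      simp only [USig, UPi, NSig, NPi]
      constructor
      · intro h y hy
        obtain ⟨X, hX, h'⟩ := cert_ex t (pr a y + 1)
        have hm := h' (pr a y) (lt_add_one _)
        rw [hy] at hm
        exact h (pr y X) a (le_pr_left _ _) y ((le_pr_left _ _).trans (le_pr_right _ _)) X ((le_pr_right _ _).trans (le_pr_right _ _)) rfl hX hm
      · intro h u a' _ y _ X _ he hX hm
        obtain ⟨rfl, rfl⟩ := pr_inj he
        exact h y (cert_correct hX t _ _ hm).symm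
  | succ k ih =>
    constructor
    · intro t a
      rw [USig, NSig]
      exact exists_congr fun u => ih.2 t _
    · intro t a
      rw [UPi, NPi]
      exact forall_congr' fun u => ih.1 t _

def Tm.env : Tm := .atm 0
def Tm.F : Tm := .atm 1
def Tm.G : Tm := .atm 2
def Tm.one : Tm := .bin 2 .env .env
def Tm.zero : Tm := .bin 2 .env (.bin 0 .env .one)
def Tm.not (t : Tm) : Tm := .bin 2 t .zero
def Tm.add (t u : Tm) : Tm := .bin 0 t u
def Tm.mul (t u : Tm) : Tm := .bin 1 t u
def Tm.eq (t u : Tm) : Tm := .bin 2 t u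
def Tm.imp (t u : Tm) : Tm := .not (.mul t (.not u))

theorem val_env (a : M) : Tm.env.val a = a := at0 a
theorem val_F (a b : M) : Tm.F.val (pr a b) = a := at1 a b
theorem val_G (a b : M) : Tm.G.val (pr a b) = b := at2 a b
theorem val_add (t u : Tm) (a : M) : (t.add u).val a = t.val a + u.val a := by simp [Tm.add, Tm.val, binV]
theorem val_mul (t u : Tm) (a : M) : (t.mul u).val a = t.val a * u.val a := by simp [Tm.mul, Tm.val, binV]
open Classical in
theorem val_eq (t u : Tm) (a : M) : (t.eq u).val a = if t.val a = u.val a then 1 else 0 := by simp [Tm.eq, Tm.val, binV]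
theorem val_one (a : M) : Tm.one.val a = 1 := by
  show (Tm.env.eq Tm.env).val a = 1
  simp [val_eq]
theorem val_zero (a : M) : Tm.zero.val a = 0 := by
  show (Tm.env.eq (Tm.env.add Tm.one)).val a = 0
  simp [val_eq, val_add, val_one]
theorem val_not (t : Tm) (a : M) : t.not.val a ≠ 0 ↔ ¬ t.val a ≠ 0 := by
  show (t.eq Tm.zero).val a ≠ 0 ↔ _
  simp [val_eq, val_zero]
theorem val_imp (t u : Tm) (a : M) : (t.imp u).val a ≠ 0 ↔ (t.val a ≠ 0 → u.val a ≠ 0) := by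
  rw [Tm.imp, val_not, val_mul, mul_ne_zero_iff, val_not]
  tauto
theorem val_eq' (t u : Tm) (a : M) : (t.eq u).val a ≠ 0 ↔ t.val a = u.val a := by
  simp [val_eq]
theorem val_comp (t u : Tm) (a : M) : (t.comp u).val a = t.val (u.val a) := rfl
theorem val_ball (t u : Tm) (a : M) : (t.ball u).val a ≠ 0 ↔ ∀ x ≤ t.val a, u.val (pr a x) ≠ 0 := by
  rw [Tm.val]
  split_ifs with h
  · simpa using h
  · simpa using h

theorem nf_not (k : ℕ) : (∀ (t : Tm) (a : M), NSig k t.not a ↔ ¬ NPi k t a) ∧ (∀ (t : Tm) (a : M), NPi k t.not a ↔ ¬ NSig k t a) := by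
  induction k with
  | zero => 
    simp only [NSig, NPi]
    exact ⟨fun t a => val_not t a, fun t a => val_not t a⟩
  | succ k ih =>
    simp only [NSig, NPi]
    constructor
    · intro t a
      simp [ih.2]
    · intro t a
      simp [ih.1]

end univ

def RSig (k : ℕ) {m : ℕ} (G : UP m) : Prop := ∀ ρ : Fin m → Tm, ∃ t : Tm,
  ∀ (M : Type) [CommSemiring M] [LinearOrder M] [PAM M] (a : M), NSig k t a ↔ G M (fun i => (ρ i).val a)
def RPi (k : ℕ) {m : ℕ} (G : UP m) : Prop := ∀ ρ : Fin m → Tm, ∃ t : Tm,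
  ∀ (M : Type) [CommSemiring M] [LinearOrder M] [PAM M] (a : M), NPi k t a ↔ G M (fun i => (ρ i).val a)

theorem rep_term {m : ℕ} (T : LA.Term (Empty ⊕ Fin m)) (ρ : Fin m → Tm) : ∃ t : Tm, 
  ∀ (M : Type) [CommSemiring M] [LinearOrder M] [PAM M] (a : M), t.val a = T.realize (Sum.elim (ed M) (fun i => (ρ i).val a)) := by
  induction T with
  | var i => 
    rcases i with i | i
    · exact i.elim
    · exact ⟨ρ i, fun _ _ _ _ _ => rfl⟩
  | @func l f ts ih =>
    match l, f, ts, ih with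
    | 0, f, ts, ih => exact ⟨.zero, fun M _ _ _ a => val_zero a⟩
    | 1, f, ts, ih =>
      obtain ⟨t, ht⟩ := ih 0
      refine ⟨t.add .one, fun M _ _ _ a => ?_⟩
      show _ = (ts 0).realize _ + 1
      rw [val_add, val_one, ht]
    | 2, false, ts, ih =>
      obtain ⟨t, ht⟩ := ih 0
      obtain ⟨u, hu⟩ := ih 1
      refine ⟨t.add u, fun M _ _ _ a => ?_⟩
      show _ = (ts 0).realize _ + (ts 1).realize _
      rw [val_add, ht, hu]
    | 2, true, ts, ih =>
      obtain ⟨t, ht⟩ := ih 0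
      obtain ⟨u, hu⟩ := ih 1
      refine ⟨t.mul u, fun M _ _ _ a => ?_⟩
      show _ = (ts 0).realize _ * (ts 1).realize _
      rw [val_mul, ht, hu]
    | (n+3), f, ts, ih => exact Empty.elim f

theorem up_val {m : ℕ} (ρ : Fin m → Tm) (M : Type) [CommSemiring M] [LinearOrder M] [PAM M] (a x : M) :
    (fun i => ((Fin.snoc (fun i => (ρ i).comp Tm.F) Tm.G : Fin (m+1) → Tm) i).val (pr a x)) = (Fin.snoc (fun i => (ρ i).val a) x : Fin (m+1) → M) := by
  funext i
  refine Fin.lastCases ?_ (fun j => ?_) i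
  · simp [val_G]
  · simp [val_comp, val_F]

theorem rep_delta {m : ℕ} (φ : LA.BoundedFormula Empty m) (h : IsDelta0 φ) : ∀ ρ : Fin m → Tm, ∃ t : Tm,
  ∀ (M : Type) [CommSemiring M] [LinearOrder M] [PAM M] (a : M), t.val a ≠ 0 ↔ φ.Realize (ed M) (fun i => (ρ i).val a) := by
  have hr : ∀ {m : ℕ} (t : LA.Term (Empty ⊕ Fin m)) (M : Type) [CommSemiring M] [LinearOrder M] (v : Fin m → M) (x : M),
        (t.relabel (Sum.map id Fin.castSucc)).realize (Sum.elim default (Fin.snoc v x : Fin (m+1) → M)) = t.realize (Sum.elim (ed M) v) := by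
      intro m t M _ _ v x
      rw [Term.realize_relabel]
      congr 1
      funext i
      rcases i with i | i
      · exact i.elim
      · simp
  induction h with
  | falsum => exact fun ρ => ⟨.zero, fun M _ _ _ a => by simp [val_zero]⟩
  | equal T U => 
    intro ρ
    obtain ⟨t, ht⟩ := rep_term T ρ
    obtain ⟨u, hu⟩ := rep_term U ρ
    refine ⟨t.eq u, fun M _ _ _ a => ?_⟩
    rw [val_eq', ht, hu]
    rfl
  | le T U => 
    intro ρ
    obtain ⟨t, ht⟩ := rep_term T ρ
    obtain ⟨u, hu⟩ := rep_term U ρ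
    refine ⟨.not (.ball u (.not (.eq .G (t.comp .F)))), fun M _ _ _ a => ?_⟩
    rw [val_not, val_ball]
    simp only [val_not, val_eq', val_G, val_comp, val_F, ht, hu, real_leF, rl_eq]
    simp
  | imp h1 h2 ih1 ih2 => 
    intro ρ
    obtain ⟨t, ht⟩ := ih1 ρ
    obtain ⟨u, hu⟩ := ih2 ρ
    refine ⟨t.imp u, fun M _ _ _ a => ?_⟩
    rw [val_imp, ht, hu]
    rfl
  | ball T h ih =>
    intro ρ
    obtain ⟨t, ht⟩ := rep_term T ρ
    obtain ⟨u, hu⟩ := ih (Fin.snoc (fun i => (ρ i).comp Tm.F) Tm.G)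
    refine ⟨t.ball u, fun M _ _ _ a => ?_⟩
    rw [val_ball, ht]
    simp only [hu, up_val, BoundedFormula.realize_all, BoundedFormula.realize_imp, real_leF, rl_eq, hr, real_vT, Fin.snoc_last]
  | bex T h ih =>
    intro ρ
    obtain ⟨t, ht⟩ := rep_term T ρ
    obtain ⟨u, hu⟩ := ih (Fin.snoc (fun i => (ρ i).comp Tm.F) Tm.G)
    refine ⟨.not (t.ball (.not u)), fun M _ _ _ a => ?_⟩
    rw [val_not, val_ball, ht]
    simp only [val_not, hu, up_val, BoundedFormula.realize_ex, BoundedFormula.realize_inf, real_leF, rl_eq, hr, real_vT, Fin.snoc_last]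
    push Not
    rfl


theorem rep_all (k : ℕ) : (∀ {m : ℕ} (φ : LA.BoundedFormula Empty m), IsSigmaFml k φ → RSig k (fun M _ _ v => φ.Realize default v)) ∧
    (∀ {m : ℕ} (φ : LA.BoundedFormula Empty m), IsPiFml k φ → RPi k (fun M _ _ v => φ.Realize default v)) := by
  induction k with
  | zero =>
    constructor
    · intro m φ h ρ
      cases h with
      | ofDelta0 h => 
        obtain ⟨t, ht⟩ := rep_delta φ h ρ
        exact ⟨t, fun M _ _ _ a => by rw [NSig]; exact ht M a⟩
    · intro m φ h ρ
      cases h with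
      | ofDelta0 h => 
        obtain ⟨t, ht⟩ := rep_delta φ h ρ
        exact ⟨t, fun M _ _ _ a => by rw [NPi]; exact ht M a⟩
  | succ k ih =>
    have hρ : ∀ {m : ℕ} (ρ : Fin (m+1) → Tm) (M : Type) [CommSemiring M] [LinearOrder M] [PAM M] (a : M),
      (fun i => ((Fin.snoc (Fin.snoc (Fin.init ρ) (Tm.F.comp (ρ (Fin.last m))) : Fin (m+1) → Tm) (Tm.G.comp (ρ (Fin.last m))) : Fin (m+2) → Tm) i).val a) =
       (Fin.snoc (Fin.snoc (fun i : Fin m => (ρ i.castSucc).val a) (Tm.F.val ((ρ (Fin.last m)).val a)) : Fin (m+1) → M) (Tm.G.val ((ρ (Fin.last m)).val a)) : Fin (m+2) → M) := by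
      intro m ρ M _ _ _ a
      funext i
      refine Fin.lastCases ?_ (fun j => ?_) i
      · simp [val_comp]
      · refine Fin.lastCases ?_ (fun j => ?_) j
        · simp [val_comp]
        · simp [val_comp, Fin.init]
    constructor
    · have claim : ∀ {m : ℕ} (φ : LA.BoundedFormula Empty m), IsSigmaFml (k+1) φ → ∃ G : UP (m+1), RPi k G ∧
          ∀ (M : Type) [CommSemiring M] [LinearOrder M] [PAM M] (v : Fin m → M), φ.Realize default v ↔ ∃ y, G M (Fin.snoc v y) := by
        apply sigma_rec
        · intro m φ h
          refine ⟨fun M _ _ v => φ.Realize default (Fin.init v), ?_, ?_⟩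
          · intro ρ
            exact ih.2 φ h (Fin.init ρ)
          · intro M _ _ _ v
            have : Nonempty M := ⟨0⟩
            simp
        · intro m φ _ ⟨G, hG, h⟩
          refine ⟨fun M _ _ v => G M (Fin.snoc (Fin.snoc (Fin.init v) (Tm.F.val (v (Fin.last m)))) (Tm.G.val (v (Fin.last m)))), ?_, ?_⟩
          · intro ρ
            obtain ⟨t, ht⟩ := hG (Fin.snoc (Fin.snoc (Fin.init ρ) (Tm.F.comp (ρ (Fin.last m))) : Fin (m+1) → Tm) (Tm.G.comp (ρ (Fin.last m))))
            refine ⟨t, fun M _ _ _ a => (ht M a).trans (iff_of_eq ?_)⟩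
            rw [hρ]
            rfl
          · intro M _ _ _ v
            rw [BoundedFormula.realize_ex]
            simp only [h, Fin.init_snoc, Fin.snoc_last]
            constructor
            · rintro ⟨x, y, hxy⟩
              exact ⟨pr x y, by rw [val_F, val_G]; exact hxy⟩
            · rintro ⟨y, hy⟩
              exact ⟨_, _, hy⟩
      intro m φ hφ ρ
      obtain ⟨G, hG, h⟩ := claim φ hφ
      obtain ⟨t, ht⟩ := hG (Fin.snoc (fun i => (ρ i).comp Tm.F) Tm.G)
      refine ⟨t, fun M _ _ _ a => ?_⟩
      rw [NSig]
      simp only [ht, up_val]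
      exact (h M _).symm
    · have claim : ∀ {m : ℕ} (φ : LA.BoundedFormula Empty m), IsPiFml (k+1) φ → ∃ G : UP (m+1), RSig k G ∧
          ∀ (M : Type) [CommSemiring M] [LinearOrder M] [PAM M] (v : Fin m → M), φ.Realize default v ↔ ∀ y, G M (Fin.snoc v y) := by
        apply pi_rec
        · intro m φ h
          refine ⟨fun M _ _ v => φ.Realize default (Fin.init v), ?_, ?_⟩
          · intro ρ
            exact ih.1 φ h (Fin.init ρ)
          · intro M _ _ _ v
            have : Nonempty M := ⟨0⟩
            simp
        · intro m φ _ ⟨G, hG, h⟩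
          refine ⟨fun M _ _ v => G M (Fin.snoc (Fin.snoc (Fin.init v) (Tm.F.val (v (Fin.last m)))) (Tm.G.val (v (Fin.last m)))), ?_, ?_⟩
          · intro ρ
            obtain ⟨t, ht⟩ := hG (Fin.snoc (Fin.snoc (Fin.init ρ) (Tm.F.comp (ρ (Fin.last m))) : Fin (m+1) → Tm) (Tm.G.comp (ρ (Fin.last m))))
            refine ⟨t, fun M _ _ _ a => (ht M a).trans (iff_of_eq ?_)⟩
            rw [hρ]
            rfl
          · intro M _ _ _ v
            rw [BoundedFormula.realize_all]
            simp only [h, Fin.init_snoc, Fin.snoc_last]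
            constructor
            · intro hh y
              exact hh _ _
            · intro hh x y
              have := hh (pr x y)
              rwa [val_F, val_G] at this
      intro m φ hφ ρ
      obtain ⟨G, hG, h⟩ := claim φ hφ
      obtain ⟨t, ht⟩ := hG (Fin.snoc (fun i => (ρ i).comp Tm.F) Tm.G)
      refine ⟨t, fun M _ _ _ a => ?_⟩
      rw [NPi]
      simp only [ht, up_val]
      exact (h M _).symm

/-- universality -/
theorem univ_sigma {k : ℕ} {σ : Snt} (h : IsSigmaFml (k+1) σ) : ∃ e : ℕ, 
    ∀ (M : Type) [CommSemiring M] [LinearOrder M] [PAM M], (∃ w, UPi k (e : M) (pr 0 w)) ↔ M ⊨ σ := by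
  obtain ⟨t, ht⟩ := (rep_all (k+1)).1 σ h Fin.elim0
  refine ⟨t.cod, fun M _ _ _ => ?_⟩
  rw [show (∃ w, UPi k (t.cod : M) (pr 0 w)) ↔ USig (k+1) (t.cod : M) 0 from by rw [USig], (univ_nf k).1, ht]
  apply iff_of_eq
  unfold Sentence.Realize Formula.Realize
  congr
  exact Subsingleton.elim _ _
theorem univ_pi {k : ℕ} {σ : Snt} (h : IsPiFml (k+1) σ) : ∃ e : ℕ, 
    ∀ (M : Type) [CommSemiring M] [LinearOrder M] [PAM M], (∃ w, UPi k (e : M) (pr 0 w)) ↔ ¬ M ⊨ σ := by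
  obtain ⟨t, ht⟩ := (rep_all (k+1)).2 σ h Fin.elim0
  refine ⟨t.not.cod, fun M _ _ _ => ?_⟩
  rw [show (∃ w, UPi k (t.not.cod : M) (pr 0 w)) ↔ USig (k+1) (t.not.cod : M) 0 from by rw [USig], (univ_nf k).1, (nf_not _).1, ht]
  apply iff_of_eq
  unfold Sentence.Realize Formula.Realize
  congr
  exact Subsingleton.elim _ _

theorem univ_def (k : ℕ) : (∀ {m : ℕ} {f g : UF m}, Trm f → Trm g → SigP k (fun M _ _ v => USig k (f M v) (g M v))) ∧
    (∀ {m : ℕ} {f g : UF m}, Trm f → Trm g → PiP k (fun M _ _ v => UPi k (f M v) (g M v))) := by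
  induction k with
  | zero =>
    constructor
    · intro m f g hf hg
      refine SigP.dl0.2 (Dl0.comp2 (F := fun M _ _ x y => USig 0 x y) ?_ hf hg)
      simp only [USig]
      repeat' (first | exact Trm.var _ | exact Trm.zero | with_reducible apply Trm.pr | with_reducible apply Dl0.ball | with_reducible apply Dl0.eq | with_reducible apply Dl0.mem | with_reducible apply Dl0.cert | with_reducible apply Dl0.not | with_reducible apply Dl0.imp)
    · intro m f g hf hg
      refine PiP.dl0.2 (Dl0.comp2 (F := fun M _ _ x y => UPi 0 x y) ?_ hf hg)
      simp only [UPi]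
      repeat' (first | exact Trm.var _ | exact Trm.zero | with_reducible apply Trm.pr | with_reducible apply Dl0.bex | with_reducible apply Dl0.and | with_reducible apply Dl0.eq | with_reducible apply Dl0.ne | with_reducible apply Dl0.mem | with_reducible apply Dl0.cert | with_reducible apply Dl0.not | with_reducible apply Dl0.imp)
  | succ k ih =>
    constructor
    · intro m f g hf hg
      simp only [USig]
      apply SigP.ex (P := fun M _ _ v u => UPi k (f M v) (pr (g M v) u))
      exact (ih.2 hf.init (hg.init.pr (Trm.var _))).sig
    · intro m f g hf hg
      simp only [UPi]
      apply PiP.all (P := fun M _ _ v u => USig k (f M v) (pr (g M v) u))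
      exact (ih.1 hf.init (hg.init.pr (Trm.var _))).pi

set_option linter.all false
set_option linter.unusedSimpArgs false

/-! ### recursively enumerable relations on the naturals -/

def Sig1 {k : ℕ} (R : (Fin k → ℕ) → Prop) : Prop :=
  ∃ P : UP (k+1), Dl0 P ∧ ∀ v, R v ↔ ∃ B, P ℕ (Fin.snoc v B)

theorem Sig1.congr {k : ℕ} {R S : (Fin k → ℕ) → Prop} (h : Sig1 R) (e : ∀ v, R v ↔ S v) : Sig1 S := by
  obtain ⟨P, h1, h2⟩ := h
  exact ⟨P, h1, fun v => (e v).symm.trans (h2 v)⟩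

theorem Dl0.sig1 {k : ℕ} {P : UP k} (h : Dl0 P) : Sig1 (P ℕ) :=
  ⟨_, h.init, fun v => by simp⟩

theorem Sig1.and {k : ℕ} {R S : (Fin k → ℕ) → Prop} (hR : Sig1 R) (hS : Sig1 S) : Sig1 (fun v => R v ∧ S v) := by
  obtain ⟨P, h1, h2⟩ := hR
  obtain ⟨Q, h3, h4⟩ := hS
  refine ⟨fun M _ _ v => (∃ x ≤ v (Fin.last k), P M (Fin.snoc (Fin.init v) x)) ∧ (∃ x ≤ v (Fin.last k), Q M (Fin.snoc (Fin.init v) x)), ?_, ?_⟩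
  · have aux : ∀ {P : UP (k+1)}, Dl0 P → Dl0 (k := k+1) (fun M _ _ v => ∃ x ≤ v (Fin.last k), P M (Fin.snoc (Fin.init v) x)) := by
      intro P h1
      apply Dl0.bex (P := fun M _ _ v x => P M (Fin.snoc (Fin.init v) x)) (Trm.var _)
      refine (h1.subst (g := Fin.snoc (fun i => (fun M _ _ v => v i.castSucc.castSucc : UF (k+2))) (fun M _ _ v => v (Fin.last _))) ?_).congr ?_
      · intro i
        refine Fin.lastCases ?_ (fun j => ?_) i
        · simpa using Trm.var _
        · simpa using Trm.var _
      · intro M _ _ _ v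
        apply iff_of_eq
        congr 1
        funext i
        refine Fin.lastCases ?_ (fun j => ?_) i <;> simp [Fin.init]
    exact (aux h1).and (aux h3)
  · intro v
    simp only [h2, h4, Fin.init_snoc, Fin.snoc_last]
    constructor
    · rintro ⟨⟨x, hx⟩, ⟨y, hy⟩⟩
      exact ⟨max x y, ⟨x, le_max_left _ _, hx⟩, ⟨y, le_max_right _ _, hy⟩⟩
    · rintro ⟨B, ⟨x, _, hx⟩, ⟨y, _, hy⟩⟩
      exact ⟨⟨x, hx⟩, ⟨y, hy⟩⟩

theorem Sig1.or {k : ℕ} {R S : (Fin k → ℕ) → Prop} (hR : Sig1 R) (hS : Sig1 S) : Sig1 (fun v => R v ∨ S v) := by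
  obtain ⟨P, h1, h2⟩ := hR
  obtain ⟨Q, h3, h4⟩ := hS
  refine ⟨fun M _ _ v => P M v ∨ Q M v, h1.or h3, fun v => ?_⟩
  simp only [h2, h4, exists_or]

theorem Sig1.ex {k : ℕ} {R : (Fin k → ℕ) → ℕ → Prop} 
    (h : Sig1 (fun v : Fin (k+1) → ℕ => R (Fin.init v) (v (Fin.last k)))) : Sig1 (fun v => ∃ x, R v x) := by
  obtain ⟨P, h1, h2⟩ := h
  refine ⟨fun M _ _ v => ∃ x ≤ v (Fin.last k), ∃ y ≤ v (Fin.last k), P M (Fin.snoc (Fin.snoc (Fin.init v) x) y), ?_, ?_⟩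
  · apply Dl0.bex (P := fun M _ _ v x => ∃ y ≤ v (Fin.last k), P M (Fin.snoc (Fin.snoc (Fin.init v) x) y)) (Trm.var _)
    apply Dl0.bex (P := fun M _ _ v y => P M (Fin.snoc (Fin.snoc (Fin.init (Fin.init v)) (v (Fin.last _))) y)) (Trm.var (Fin.castSucc (Fin.last k)))
    refine (h1.subst (g := Fin.snoc (Fin.snoc (fun i => (fun M _ _ v => v i.castSucc.castSucc.castSucc : UF (k+3))) (fun M _ _ v => v (Fin.castSucc (Fin.last _)))) (fun M _ _ v => v (Fin.last _))) ?_).congr ?_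
    · intro i
      refine Fin.lastCases ?_ (fun j => ?_) i
      · simpa using Trm.var _
      · refine Fin.lastCases ?_ (fun j => ?_) j
        · simpa using Trm.var _
        · simpa using Trm.var _
    · intro M _ _ _ v
      apply iff_of_eq
      congr 1
      funext i
      refine Fin.lastCases ?_ (fun j => ?_) i
      · simp [Fin.init]
      · refine Fin.lastCases ?_ (fun j => ?_) j <;> simp [Fin.init]
  · intro v
    have h2' : ∀ x, R v x ↔ ∃ B, P ℕ (Fin.snoc (Fin.snoc v x) B) := by
      intro x
      have := h2 (Fin.snoc v x)
      simpa using this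
    simp only [h2', Fin.init_snoc, Fin.snoc_last]
    constructor
    · rintro ⟨x, B, h⟩
      exact ⟨max x B, x, le_max_left _ _, B, le_max_right _ _, h⟩
    · rintro ⟨_, x, _, B, _, h⟩
      exact ⟨x, B, h⟩

theorem Sig1.rename {k m : ℕ} {R : (Fin m → ℕ) → Prop} (h : Sig1 R) (s : Fin m → Fin k) : Sig1 (fun v : Fin k → ℕ => R (fun i => v (s i))) := by
  obtain ⟨P, h1, h2⟩ := h
  refine ⟨fun M _ _ v => P M (Fin.snoc (fun i => v (s i).castSucc) (v (Fin.last k))), ?_, ?_⟩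
  · refine (h1.subst (g := Fin.snoc (fun i => (fun M _ _ v => v (s i).castSucc : UF (k+1))) (fun M _ _ v => v (Fin.last _))) ?_).congr ?_
    · intro i
      refine Fin.lastCases ?_ (fun j => ?_) i
      · simpa using Trm.var _
      · simpa using Trm.var _
    · intro M _ _ _ v
      apply iff_of_eq
      congr 1
      funext i
      refine Fin.lastCases ?_ (fun j => ?_) i <;> simp [Fin.init]
  · intro v
    simp [h2]

theorem Sig1.ball_var {k : ℕ} {R : (Fin k → ℕ) → ℕ → Prop} (j : Fin k)
    (h : Sig1 (fun v : Fin (k+1) → ℕ => R (Fin.init v) (v (Fin.last k)))) : Sig1 (fun v => ∀ x ≤ v j, R v x) := by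
  obtain ⟨P, h1, h2⟩ := h
  refine ⟨fun M _ _ v => ∀ x ≤ v j.castSucc, ∃ y ≤ v (Fin.last k), P M (Fin.snoc (Fin.snoc (Fin.init v) x) y), ?_, ?_⟩
  · apply Dl0.ball (P := fun M _ _ v x => ∃ y ≤ v (Fin.last k), P M (Fin.snoc (Fin.snoc (Fin.init v) x) y)) (Trm.var _)
    apply Dl0.bex (P := fun M _ _ v y => P M (Fin.snoc (Fin.snoc (Fin.init (Fin.init v)) (v (Fin.last _))) y)) (Trm.var (Fin.castSucc (Fin.last k)))
    refine (h1.subst (g := Fin.snoc (Fin.snoc (fun i => (fun M _ _ v => v i.castSucc.castSucc.castSucc : UF (k+3))) (fun M _ _ v => v (Fin.castSucc (Fin.last _)))) (fun M _ _ v => v (Fin.last _))) ?_).congr ?_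
    · intro i
      refine Fin.lastCases ?_ (fun j => ?_) i
      · simpa using Trm.var _
      · refine Fin.lastCases ?_ (fun j => ?_) j
        · simpa using Trm.var _
        · simpa using Trm.var _
    · intro M _ _ _ v
      apply iff_of_eq
      congr 1
      funext i
      refine Fin.lastCases ?_ (fun j => ?_) i
      · simp [Fin.init]
      · refine Fin.lastCases ?_ (fun j => ?_) j <;> simp [Fin.init]
  · intro v
    have h2' : ∀ x, R v x ↔ ∃ B, P ℕ (Fin.snoc (Fin.snoc v x) B) := by
      intro x
      have := h2 (Fin.snoc v x)
      simpa using this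
    simp only [h2', Fin.init_snoc, Fin.snoc_last, Fin.snoc_castSucc]
    constructor
    · intro h
      have : ∀ x, ∃ B, x ≤ v j → P ℕ (Fin.snoc (Fin.snoc v x) B) := by
        intro x
        by_cases hx : x ≤ v j
        · obtain ⟨B, hB⟩ := h x hx
          exact ⟨B, fun _ => hB⟩
        · exact ⟨0, fun h => absurd h hx⟩
      choose B hB using this
      refine ⟨(Finset.range (v j + 1)).sup B, fun x hx => ⟨B x, ?_, hB x hx⟩⟩
      exact Finset.le_sup (f := B) (Finset.mem_range.2 (Nat.lt_succ_of_le hx))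
    · rintro ⟨_, h⟩ x hx
      obtain ⟨B, _, h⟩ := h x hx
      exact ⟨B, h⟩

def SF {k : ℕ} (f : (Fin k → ℕ) → ℕ) : Prop := Sig1 (fun v : Fin (k+1) → ℕ => v (Fin.last k) = f (Fin.init v))

theorem SF.var {k : ℕ} (i : Fin k) : SF (fun v => v i) :=
  Dl0.sig1 (Dl0.eq (Trm.var _) (Trm.var i.castSucc))
theorem SF.const {k : ℕ} (n : ℕ) : SF (k := k) (fun v => n) :=
  (Dl0.sig1 (Dl0.eq (Trm.var (Fin.last k)) (Trm.cast n))).congr fun v => by simp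

theorem SF.init {k : ℕ} {f : (Fin k → ℕ) → ℕ} (h : SF f) : SF (fun v : Fin (k+1) → ℕ => f (Fin.init v)) := by
  refine (Sig1.rename h (Fin.snoc (fun i => i.castSucc.castSucc) (Fin.last _))).congr fun v => ?_
  have : (Fin.init fun i => v ((Fin.snoc (fun i => i.castSucc.castSucc) (Fin.last _) : Fin (k+1) → Fin (k+2)) i)) = Fin.init (Fin.init v) := by
    funext i
    simp [Fin.init]
  simp only [this, Fin.snoc_last]

/-- substitute a function for the last variable -/
theorem Sig1.sub {k : ℕ} {R : (Fin k → ℕ) → ℕ → Prop} 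
    (h : Sig1 (fun v : Fin (k+1) → ℕ => R (Fin.init v) (v (Fin.last k)))) {f : (Fin k → ℕ) → ℕ} (hf : SF f) : Sig1 (fun v => R v (f v)) := by
  refine (Sig1.ex (R := fun v x => x = f v ∧ R v x) (Sig1.and hf h)).congr fun v => ?_
  simp

theorem Sig1.comp1 {k : ℕ} {R : ℕ → Prop} (h : Sig1 (k := 1) (fun v => R (v 0))) {f : (Fin k → ℕ) → ℕ} (hf : SF f) :
    Sig1 (fun v => R (f v)) :=
  Sig1.sub (R := fun v x => R x) (h.rename ![Fin.last _]) hf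
theorem Sig1.comp2 {k : ℕ} {R : ℕ → ℕ → Prop} (h : Sig1 (k := 2) (fun v => R (v 0) (v 1))) {f g : (Fin k → ℕ) → ℕ} (hf : SF f) (hg : SF g) :
    Sig1 (fun v => R (f v) (g v)) :=
  Sig1.sub (R := fun v x => R x (g v)) (Sig1.sub (R := fun v x => R (v (Fin.last k)) x) (h.rename ![Fin.castSucc (Fin.last _), Fin.last _]) hg.init) hf
theorem Sig1.comp3 {k : ℕ} {R : ℕ → ℕ → ℕ → Prop} (h : Sig1 (k := 3) (fun v => R (v 0) (v 1) (v 2))) {f g l : (Fin k → ℕ) → ℕ} (hf : SF f) (hg : SF g) (hl : SF l) :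
    Sig1 (fun v => R (f v) (g v) (l v)) :=
  Sig1.sub (R := fun v x => R x (g v) (l v)) (Sig1.sub (R := fun v x => R (v (Fin.last k)) x (l (Fin.init v))) 
    (Sig1.sub (R := fun v x => R (v (Fin.castSucc (Fin.last k))) (v (Fin.last _)) x)
      (h.rename ![Fin.castSucc (Fin.castSucc (Fin.last _)), Fin.castSucc (Fin.last _), Fin.last _]) hl.init.init) hg.init) hf
theorem Sig1.comp4 {k : ℕ} {R : ℕ → ℕ → ℕ → ℕ → Prop} (h : Sig1 (k := 4) (fun v => R (v 0) (v 1) (v 2) (v 3))) {f g l m : (Fin k → ℕ) → ℕ} (hf : SF f) (hg : SF g) (hl : SF l) (hm : SF m) :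
    Sig1 (fun v => R (f v) (g v) (l v) (m v)) :=
  Sig1.sub (R := fun v x => R x (g v) (l v) (m v)) (Sig1.sub (R := fun v x => R (v (Fin.last k)) x (l (Fin.init v)) (m (Fin.init v))) 
    (Sig1.sub (R := fun v x => R (v (Fin.castSucc (Fin.last k))) (v (Fin.last _)) x (m (Fin.init (Fin.init v))))
     (Sig1.sub (R := fun v x => R (v (Fin.castSucc (Fin.castSucc (Fin.last k)))) (v (Fin.castSucc (Fin.last _))) (v (Fin.last _)) x)
      (h.rename ![Fin.castSucc (Fin.castSucc (Fin.castSucc (Fin.last _))), Fin.castSucc (Fin.castSucc (Fin.last _)), Fin.castSucc (Fin.last _), Fin.last _]) hm.init.init.init) hl.init.init) hg.init) hf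

theorem SF.comp1 {k : ℕ} {F : ℕ → ℕ} (h : SF (k := 1) (fun v => F (v 0))) {f : (Fin k → ℕ) → ℕ} (hf : SF f) : SF (fun v => F (f v)) :=
  Sig1.comp2 (R := fun x y => y = F x) h hf.init (SF.var (Fin.last k))
theorem SF.comp2 {k : ℕ} {F : ℕ → ℕ → ℕ} (h : SF (k := 2) (fun v => F (v 0) (v 1))) {f g : (Fin k → ℕ) → ℕ} (hf : SF f) (hg : SF g) : SF (fun v => F (f v) (g v)) :=
  Sig1.comp3 (R := fun x y z => z = F x y) h hf.init hg.init (SF.var (Fin.last k))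

theorem Sig1.ball {k : ℕ} {R : (Fin k → ℕ) → ℕ → Prop} {f : (Fin k → ℕ) → ℕ} (hf : SF f)
    (h : Sig1 (fun v : Fin (k+1) → ℕ => R (Fin.init v) (v (Fin.last k)))) : Sig1 (fun v => ∀ x ≤ f v, R v x) := by
  have := Sig1.ball_var (R := fun v x => R (Fin.init v) x) (Fin.last k) (h.rename (Fin.snoc (fun i => i.castSucc.castSucc) (Fin.last _))|>.congr (by
    intro v
    have : (Fin.init fun i => v ((Fin.snoc (fun i => i.castSucc.castSucc) (Fin.last _) : Fin (k+1) → Fin (k+2)) i)) = Fin.init (Fin.init v) := by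
      funext i
      simp [Fin.init]
    simp only [this, Fin.snoc_last]))
  exact Sig1.sub (R := fun v z => ∀ x ≤ z, R v x) this hf

theorem SF.add {k : ℕ} {f g : (Fin k → ℕ) → ℕ} (hf : SF f) (hg : SF g) : SF (fun v => f v + g v) :=
  SF.comp2 (F := fun x y => x + y) (Dl0.sig1 (Dl0.eq (Trm.var (2 : Fin 3)) ((Trm.var 0).add (Trm.var 1)))) hf hg
theorem SF.mul {k : ℕ} {f g : (Fin k → ℕ) → ℕ} (hf : SF f) (hg : SF g) : SF (fun v => f v * g v) :=
  SF.comp2 (F := fun x y => x * y) (Dl0.sig1 (Dl0.eq (Trm.var (2 : Fin 3)) ((Trm.var 0).mul (Trm.var 1)))) hf hg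
theorem SF.pr {k : ℕ} {f g : (Fin k → ℕ) → ℕ} (hf : SF f) (hg : SF g) : SF (fun v => pr (f v) (g v)) :=
  SF.comp2 (F := fun x y => Guaspari.pr x y) (Dl0.sig1 (Dl0.eq (Trm.var (2 : Fin 3)) ((Trm.var 0).pr (Trm.var 1)))) hf hg
theorem SF.pair {k : ℕ} {f g : (Fin k → ℕ) → ℕ} (hf : SF f) (hg : SF g) : SF (fun v => Nat.pair (f v) (g v)) :=
  SF.comp2 (F := Nat.pair) ((Dl0.sig1 (k := 3) (P := fun M _ _ v => (v 0 < v 1 ∧ v 2 = v 1 * v 1 + v 0) ∨ (v 1 ≤ v 0 ∧ v 2 = v 0 * v 0 + v 0 + v 1)) (by repeat' (first | assumption | exact Trm.var _ | exact Trm.zero | exact Trm.one | exact Trm.cast _ | with_reducible apply Trm.add | with_reducible apply Trm.mul | with_reducible apply Trm.pr | with_reducible apply Dl0.ball | with_reducible apply Dl0.ball' | with_reducible apply Dl0.bex | with_reducible apply Dl0.bex' | with_reducible apply Dl0.and | with_reducible apply Dl0.or | with_reducible apply Dl0.iff | with_reducible apply Dl0.eq | with_reducible apply Dl0.le | with_reducible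 apply Dl0.lt | with_reducible apply Dl0.ne | exact Dl0.true | exact Dl0.false | with_reducible apply Dl0.not | with_reducible apply Dl0.imp))).congr fun v => by
    show _ ↔ v 2 = Nat.pair (v 0) (v 1)
    unfold Nat.pair
    split_ifs with h
    · simp [h, not_le.2 h]
    · simp [h, not_lt.1 h]) hf hg
theorem Sig1.eq {k : ℕ} {f g : (Fin k → ℕ) → ℕ} (hf : SF f) (hg : SF g) : Sig1 (fun v => f v = g v) :=
  Sig1.comp2 (R := fun x y => x = y) (Dl0.sig1 (Dl0.eq (Trm.var (0 : Fin 2)) (Trm.var 1))) hf hg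
theorem Sig1.le {k : ℕ} {f g : (Fin k → ℕ) → ℕ} (hf : SF f) (hg : SF g) : Sig1 (fun v => f v ≤ g v) :=
  Sig1.comp2 (R := fun x y => x ≤ y) (Dl0.sig1 (Dl0.le (Trm.var (0 : Fin 2)) (Trm.var 1))) hf hg
theorem Sig1.lt {k : ℕ} {f g : (Fin k → ℕ) → ℕ} (hf : SF f) (hg : SF g) : Sig1 (fun v => f v < g v) :=
  Sig1.comp2 (R := fun x y => x < y) (Dl0.sig1 (Dl0.lt (Trm.var (0 : Fin 2)) (Trm.var 1))) hf hg
theorem Sig1.ne {k : ℕ} {f g : (Fin k → ℕ) → ℕ} (hf : SF f) (hg : SF g) : Sig1 (fun v => f v ≠ g v) :=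
  Sig1.comp2 (R := fun x y => x ≠ y) (Dl0.sig1 (Dl0.ne (Trm.var (0 : Fin 2)) (Trm.var 1))) hf hg
theorem Sig1.mem {k : ℕ} {f g : (Fin k → ℕ) → ℕ} (hf : SF f) (hg : SF g) : Sig1 (fun v => Mem (f v) (g v)) :=
  Sig1.comp2 (R := fun x y => Mem x y) (Dl0.sig1 (Dl0.mem (Trm.var (0 : Fin 2)) (Trm.var 1))) hf hg
theorem Sig1.nmem {k : ℕ} {f g : (Fin k → ℕ) → ℕ} (hf : SF f) (hg : SF g) : Sig1 (fun v => ¬ Mem (f v) (g v)) :=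
  Sig1.comp2 (R := fun x y => ¬ Mem x y) (Dl0.sig1 (Dl0.not (Dl0.mem (Trm.var (0 : Fin 2)) (Trm.var 1)))) hf hg

/-- monotone stages -/
theorem Sig1.stage {k : ℕ} {R : (Fin k → ℕ) → Prop} (h : Sig1 R) : ∃ P : UP (k+1), Dl0 P ∧ (∀ v, R v ↔ ∃ B, P ℕ (Fin.snoc v B)) ∧
    ∀ v B B', B ≤ B' → P ℕ (Fin.snoc v B) → P ℕ (Fin.snoc v B') := by
  obtain ⟨P, h1, h2⟩ := h
  refine ⟨fun M _ _ v => ∃ x ≤ v (Fin.last k), P M (Fin.snoc (Fin.init v) x), ?_, ?_, ?_⟩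
  · apply Dl0.bex (P := fun M _ _ v x => P M (Fin.snoc (Fin.init v) x)) (Trm.var _)
    refine (h1.subst (g := Fin.snoc (fun i => (fun M _ _ v => v i.castSucc.castSucc : UF (k+2))) (fun M _ _ v => v (Fin.last _))) ?_).congr ?_
    · intro i
      refine Fin.lastCases ?_ (fun j => ?_) i
      · simpa using Trm.var _
      · simpa using Trm.var _
    · intro M _ _ _ v
      apply iff_of_eq
      congr 1
      funext i
      refine Fin.lastCases ?_ (fun j => ?_) i <;> simp [Fin.init]
  · intro v
    simp only [h2, Fin.init_snoc, Fin.snoc_last]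
    exact ⟨fun ⟨B, h⟩ => ⟨B, B, le_rfl, h⟩, fun ⟨_, B, _, h⟩ => ⟨B, h⟩⟩
  · intro v B B' hB
    simp only [Fin.init_snoc, Fin.snoc_last]
    exact fun ⟨x, hx, h⟩ => ⟨x, hx.trans hB, h⟩



/-! ### inductive definitions -/

inductive Der (B : ℕ → Prop) (R : ℕ → ℕ → ℕ → Prop) : ℕ → Prop
  | base {c} : B c → Der B R c
  | step {a b c} : Der B R a → Der B R b → R a b c → Der B R c

theorem Sig1.der {B : ℕ → Prop} {R : ℕ → ℕ → ℕ → Prop} (hB : Sig1 (k := 1) (fun v => B (v 0)))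
    (hR : Sig1 (k := 3) (fun v => R (v 0) (v 1) (v 2))) : Sig1 (k := 1) (fun v => Der B R (v 0)) := by
  have hB' : ∀ {k : ℕ} {f : (Fin k → ℕ) → ℕ}, SF f → Sig1 (fun v => B (f v)) := fun hf => hB.comp1 hf
  have hR' : ∀ {k : ℕ} {f g l : (Fin k → ℕ) → ℕ}, SF f → SF g → SF l → Sig1 (fun v => R (f v) (g v) (l v)) := fun hf hg hl => hR.comp3 hf hg hl
  have key : Sig1 (k := 1) (fun v => ∃ X, ∃ n, Mem (pr n (v 0)) X ∧ ∀ i ≤ X, ∀ d ≤ X, ¬ Mem (pr i d) X ∨ (B d ∨ 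
      ∃ a, ∃ b, ∃ j, ∃ l, j < i ∧ l < i ∧ Mem (pr j a) X ∧ Mem (pr l b) X ∧ R a b d)) := by
    repeat' (first | exact SF.var _ | with_reducible apply SF.pr | with_reducible apply Sig1.ball | with_reducible apply Sig1.ex | with_reducible apply Sig1.and | with_reducible apply Sig1.or | with_reducible apply Sig1.lt | with_reducible apply Sig1.mem | with_reducible apply Sig1.nmem | with_reducible apply hB' | with_reducible apply hR')
  refine key.congr fun v => ?_
  generalize v 0 = c
  constructor
  · rintro ⟨X, n, hm, h⟩
    have : ∀ i d, Mem (pr i d) X → Der B R d := by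
      intro i
      induction i using Nat.strong_induction_on with
      | _ i ih =>
        intro d hd
        rcases h i ((le_pr_left _ _).trans hd.lt.le) d ((le_pr_right _ _).trans hd.lt.le) with h | h | ⟨a, b, j, l, hj, hl, h1, h2, h3⟩
        · exact absurd hd h
        · exact .base h
        · exact .step (ih _ hj _ h1) (ih _ hl _ h2) h3
    exact this _ _ hm
  · intro h
    have : ∃ (s : Finset ℕ) (n : ℕ), pr n c ∈ s ∧ ∀ i d, pr i d ∈ s → (B d ∨ 
      ∃ a, ∃ b, ∃ j, ∃ l, j < i ∧ l < i ∧ pr j a ∈ s ∧ pr l b ∈ s ∧ R a b d) := by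
      induction h with
      | @base c h =>
        refine ⟨{pr 0 c}, 0, by simp, ?_⟩
        intro i d hd
        rw [Finset.mem_singleton] at hd
        obtain ⟨rfl, rfl⟩ := pr_inj hd
        exact Or.inl h
      | @step a b c _ _ h iha ihb =>
        obtain ⟨s, n, hs, h1⟩ := iha
        obtain ⟨t, m, ht, h2⟩ := ihb
        refine ⟨insert (pr (max n m + 1) c) (s ∪ t), max n m + 1, by simp, ?_⟩
        intro i d hd
        rw [Finset.mem_insert, Finset.mem_union] at hd
        rcases hd with hd | hd | hd
        · obtain ⟨rfl, rfl⟩ := pr_inj hd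
          refine Or.inr ⟨a, b, n, m, ?_, ?_, ?_, ?_, h⟩
          · exact Nat.lt_succ_of_le (le_max_left _ _)
          · exact Nat.lt_succ_of_le (le_max_right _ _)
          · simp [hs]
          · simp [ht]
        · rcases h1 i d hd with h | ⟨a, b, j, l, hj, hl, h1, h2, h3⟩
          · exact Or.inl h
          · exact Or.inr ⟨a, b, j, l, hj, hl, by simp [h1], by simp [h2], h3⟩
        · rcases h2 i d hd with h | ⟨a, b, j, l, hj, hl, h1, h2, h3⟩
          · exact Or.inl h
          · exact Or.inr ⟨a, b, j, l, hj, hl, by simp [h1], by simp [h2], h3⟩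
    obtain ⟨s, n, hs, h⟩ := this
    obtain ⟨X, hX⟩ := code_nat_finset s
    refine ⟨X, n, (hX _).2 hs, ?_⟩
    intro i _ d _
    by_cases hd : Mem (pr i d) X
    · right
      simpa only [hX] using h i d ((hX _).1 hd)
    · exact Or.inl hd

set_option linter.all false
set_option linter.unusedSimpArgs false

/-! ### partial recursive functions have recursively enumerable graphs -/

theorem sig1_partrec {f : ℕ →. ℕ} (h : Nat.Partrec f) : Sig1 (k := 2) (fun v => v 1 ∈ f (v 0)) := by
  induction h with
  | zero => exact ((by repeat' (first | assumption | exact SF.var _ | exact SF.const _ | with_reducible apply SF.add | with_reducible apply SF.mul | with_reducible apply SF.pr | with_reducible apply SF.pair | with_reducible apply Sig1.ball | with_reducible apply Sig1.ex | with_reducible apply Sig1.and | with_reducible apply Sig1.or | with_reducible apply Sig1.eq | with_reducible apply Sig1.le | with_reducible apply Sig1.lt | with_reducible apply Sig1.ne | with_reducible apply Sig1.mem | with_reducible apply Sig1.nmem)) : Sig1 (k := 2) (fun v => v 1 = 0)).congr fun v => by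
              show v 1 = 0 ↔ v 1 ∈ Part.some 0
              simp
  | succ => exact ((by repeat' (first | assumption | exact SF.var _ | exact SF.const _ | with_reducible apply SF.add | with_reducible apply SF.mul | with_reducible apply SF.pr | with_reducible apply SF.pair | with_reducible apply Sig1.ball | with_reducible apply Sig1.ex | with_reducible apply Sig1.and | with_reducible apply Sig1.or | with_reducible apply Sig1.eq | with_reducible apply Sig1.le | with_reducible apply Sig1.lt | with_reducible apply Sig1.ne | with_reducible apply Sig1.mem | with_reducible apply Sig1.nmem)) : Sig1 (k := 2) (fun v => v 1 = v 0 + 1)).congr fun v => by simp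
  | left => exact ((by repeat' (first | assumption | exact SF.var _ | exact SF.const _ | with_reducible apply SF.add | with_reducible apply SF.mul | with_reducible apply SF.pr | with_reducible apply SF.pair | with_reducible apply Sig1.ball | with_reducible apply Sig1.ex | with_reducible apply Sig1.and | with_reducible apply Sig1.or | with_reducible apply Sig1.eq | with_reducible apply Sig1.le | with_reducible apply Sig1.lt | with_reducible apply Sig1.ne | with_reducible apply Sig1.mem | with_reducible apply Sig1.nmem)) : Sig1 (k := 2) (fun v => ∃ x, v 0 = Nat.pair (v 1) x)).congr fun v => by
              simp only [PFun.coe_val, Part.mem_some_iff]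
              constructor
              · rintro ⟨x, h⟩; simp [h]
              · rintro h; exact ⟨(Nat.unpair (v 0)).2, by simp [h]⟩
  | right => exact ((by repeat' (first | assumption | exact SF.var _ | exact SF.const _ | with_reducible apply SF.add | with_reducible apply SF.mul | with_reducible apply SF.pr | with_reducible apply SF.pair | with_reducible apply Sig1.ball | with_reducible apply Sig1.ex | with_reducible apply Sig1.and | with_reducible apply Sig1.or | with_reducible apply Sig1.eq | with_reducible apply Sig1.le | with_reducible apply Sig1.lt | with_reducible apply Sig1.ne | with_reducible apply Sig1.mem | with_reducible apply Sig1.nmem)) : Sig1 (k := 2) (fun v => ∃ x, v 0 = Nat.pair x (v 1))).congr fun v => by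
              simp only [PFun.coe_val, Part.mem_some_iff]
              constructor
              · rintro ⟨x, h⟩; simp [h]
              · rintro h; exact ⟨(Nat.unpair (v 0)).1, by simp [h]⟩
  | @pair f g _ _ hf hg =>
    have hf' : ∀ {k : ℕ} {a b : (Fin k → ℕ) → ℕ}, SF a → SF b → Sig1 (fun v => b v ∈ f (a v)) := fun ha hb => hf.comp2 (R := fun x y => y ∈ f x) ha hb
    have hg' : ∀ {k : ℕ} {a b : (Fin k → ℕ) → ℕ}, SF a → SF b → Sig1 (fun v => b v ∈ g (a v)) := fun ha hb => hg.comp2 (R := fun x y => y ∈ g x) ha hb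
    have : Sig1 (k := 2) (fun v => ∃ x, ∃ y, x ∈ f (v 0) ∧ y ∈ g (v 0) ∧ v 1 = Nat.pair x y) := by
      repeat' (first | exact SF.var _ | exact SF.const _ | with_reducible apply hf' | with_reducible apply hg' | with_reducible apply SF.add | with_reducible apply SF.mul | with_reducible apply SF.pair | with_reducible apply Sig1.ball | with_reducible apply Sig1.ex | with_reducible apply Sig1.and | with_reducible apply Sig1.or | with_reducible apply Sig1.eq | with_reducible apply Sig1.le | with_reducible apply Sig1.lt | with_reducible apply Sig1.ne)
    refine this.congr fun v => ?_
    simp [Seq.seq, eq_comm]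
  | @comp f g _ _ hf hg =>
    have hf' : ∀ {k : ℕ} {a b : (Fin k → ℕ) → ℕ}, SF a → SF b → Sig1 (fun v => b v ∈ f (a v)) := fun ha hb => hf.comp2 (R := fun x y => y ∈ f x) ha hb
    have hg' : ∀ {k : ℕ} {a b : (Fin k → ℕ) → ℕ}, SF a → SF b → Sig1 (fun v => b v ∈ g (a v)) := fun ha hb => hg.comp2 (R := fun x y => y ∈ g x) ha hb
    have : Sig1 (k := 2) (fun v => ∃ x, x ∈ g (v 0) ∧ v 1 ∈ f x) := by
      repeat' (first | exact SF.var _ | exact SF.const _ | with_reducible apply hf' | with_reducible apply hg' | with_reducible apply SF.add | with_reducible apply SF.mul | with_reducible apply SF.pair | with_reducible apply Sig1.ball | with_reducible apply Sig1.ex | with_reducible apply Sig1.and | with_reducible apply Sig1.or | with_reducible apply Sig1.eq | with_reducible apply Sig1.le | with_reducible apply Sig1.lt | with_reducible apply Sig1.ne)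
    refine this.congr fun v => ?_
    exact Part.mem_bind_iff.symm
  | @prec f g _ _ hf hg =>
    have hf' : ∀ {k : ℕ} {a b : (Fin k → ℕ) → ℕ}, SF a → SF b → Sig1 (fun v => b v ∈ f (a v)) := fun ha hb => hf.comp2 (R := fun x y => y ∈ f x) ha hb
    have hg' : ∀ {k : ℕ} {a b : (Fin k → ℕ) → ℕ}, SF a → SF b → Sig1 (fun v => b v ∈ g (a v)) := fun ha hb => hg.comp2 (R := fun x y => y ∈ g x) ha hb
    have h1 : Sig1 (k := 1) (fun v => ∃ a, ∃ i, v 0 = Nat.pair (Nat.pair a 0) i ∧ i ∈ f a) := by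
      repeat' (first | exact SF.var _ | exact SF.const _ | with_reducible apply hf' | with_reducible apply hg' | with_reducible apply SF.add | with_reducible apply SF.mul | with_reducible apply SF.pair | with_reducible apply Sig1.ball | with_reducible apply Sig1.ex | with_reducible apply Sig1.and | with_reducible apply Sig1.or | with_reducible apply Sig1.eq | with_reducible apply Sig1.le | with_reducible apply Sig1.lt | with_reducible apply Sig1.ne)
    have h2 : Sig1 (k := 3) (fun v => ∃ a, ∃ y, ∃ i, ∃ j, v 0 = Nat.pair (Nat.pair a y) i ∧ v 2 = Nat.pair (Nat.pair a (y+1)) j ∧ j ∈ g (Nat.pair a (Nat.pair y i))) := by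
      repeat' (first | exact SF.var _ | exact SF.const _ | with_reducible apply hf' | with_reducible apply hg' | with_reducible apply SF.add | with_reducible apply SF.mul | with_reducible apply SF.pair | with_reducible apply Sig1.ball | with_reducible apply Sig1.ex | with_reducible apply Sig1.and | with_reducible apply Sig1.or | with_reducible apply Sig1.eq | with_reducible apply Sig1.le | with_reducible apply Sig1.lt | with_reducible apply Sig1.ne)
    have h3 := Sig1.der (B := fun c => ∃ a, ∃ i, c = Nat.pair (Nat.pair a 0) i ∧ i ∈ f a) (R := fun p _ c => ∃ a, ∃ y, ∃ i, ∃ j, p = Nat.pair (Nat.pair a y) i ∧ c = Nat.pair (Nat.pair a (y+1)) j ∧ j ∈ g (Nat.pair a (Nat.pair y i))) h1 h2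
    refine (h3.comp1 (k := 2) (f := fun v => Nat.pair (v 0) (v 1)) ((SF.var 0).pair (SF.var 1))).congr fun v => ?_
    set F : ℕ → ℕ → Part ℕ := fun a n => Nat.rec (f a) (fun y IH => do let i ← IH; g (Nat.pair a (Nat.pair y i))) n with hF
    have e : ∀ a y i, Der (fun c => ∃ a, ∃ i, c = Nat.pair (Nat.pair a 0) i ∧ i ∈ f a) (fun p _ c => ∃ a, ∃ y, ∃ i, ∃ j, p = Nat.pair (Nat.pair a y) i ∧ c = Nat.pair (Nat.pair a (y+1)) j ∧ j ∈ g (Nat.pair a (Nat.pair y i))) (Nat.pair (Nat.pair a y) i) ↔ i ∈ F a y := by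
      intro a y i
      constructor
      · intro h
        generalize hc : Nat.pair (Nat.pair a y) i = c at h
        induction h generalizing a y i with
        | base h =>
          obtain ⟨a', i', rfl, h⟩ := h
          simp only [Nat.pair_eq_pair] at hc
          obtain ⟨⟨rfl, rfl⟩, rfl⟩ := hc
          exact h
        | step _ _ h ih1 _ =>
          obtain ⟨a', y', i', j', rfl, rfl, h⟩ := h
          simp only [Nat.pair_eq_pair] at hc
          obtain ⟨⟨rfl, rfl⟩, rfl⟩ := hc
          exact Part.mem_bind_iff.2 ⟨i', ih1 _ _ _ rfl, h⟩
      · intro h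
        induction y generalizing i with
        | zero => exact .base ⟨a, i, rfl, h⟩
        | succ y ih =>
          obtain ⟨j, hj, h⟩ := Part.mem_bind_iff.1 h
          exact .step (ih j hj) (ih j hj) ⟨a, y, j, i, rfl, rfl, h⟩
    have := e (Nat.unpair (v 0)).1 (Nat.unpair (v 0)).2 (v 1)
    rw [Nat.pair_unpair] at this
    exact this
  | @rfind f _ hf =>
    have hf' : ∀ {k : ℕ} {a b : (Fin k → ℕ) → ℕ}, SF a → SF b → Sig1 (fun v => b v ∈ f (a v)) := fun ha hb => hf.comp2 (R := fun x y => y ∈ f x) ha hb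
    have : Sig1 (k := 2) (fun v => 0 ∈ f (Nat.pair (v 0) (v 1)) ∧ ∀ m ≤ v 1, m = v 1 ∨ ∃ y, y ∈ f (Nat.pair (v 0) m) ∧ y ≠ 0) := by
      repeat' (first | exact SF.var _ | exact SF.const _ | with_reducible apply hf' | with_reducible apply SF.add | with_reducible apply SF.mul | with_reducible apply SF.pair | with_reducible apply Sig1.ball | with_reducible apply Sig1.ex | with_reducible apply Sig1.and | with_reducible apply Sig1.or | with_reducible apply Sig1.eq | with_reducible apply Sig1.le | with_reducible apply Sig1.lt | with_reducible apply Sig1.ne)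
    refine this.congr fun v => ?_
    refine Iff.trans ?_ Nat.mem_rfind.symm
    have e1 : ∀ n b, b ∈ ((fun m => decide (m = 0)) <$> f (Nat.pair (v 0) n) : Part Bool) ↔ ∃ a ∈ f (Nat.pair (v 0) n), decide (a = 0) = b := fun n b => Part.mem_map_iff _
    simp only [e1, decide_eq_true_eq, decide_eq_false_iff_not]
    constructor
    · rintro ⟨h1, h2⟩
      refine ⟨⟨0, h1, rfl⟩, fun {m} hm => ?_⟩
      rcases h2 m hm.le with h | h
      · exact absurd h hm.ne
      · exact h
    · rintro ⟨⟨a, h1, rfl⟩, h2⟩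
      refine ⟨h1, fun m hm => ?_⟩
      rcases hm.eq_or_lt with h | h
      · exact Or.inl h
      · exact Or.inr (h2 h)

theorem sig1_computablePred {p : ℕ → Prop} (h : ComputablePred p) : Sig1 (k := 1) (fun v => p (v 0)) := by
  obtain ⟨_, hf⟩ := h
  have h1 := sig1_partrec (Partrec.nat_iff.1 (Computable.encode.comp hf).partrec)
  refine (h1.comp2 (k := 1) (R := fun x y => y ∈ (fun a => Part.some (Encodable.encode (decide (p a))) : ℕ →. ℕ) x) (SF.var 0) (SF.const 1)).congr fun v => ?_
  by_cases h : p (v 0) <;> simp [h]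

theorem SF.computable {f : ℕ → ℕ} (h : Computable f) : SF (k := 1) (fun v => f (v 0)) := by
  have h1 := sig1_partrec (Partrec.nat_iff.1 h.partrec)
  refine (h1.comp2 (k := 2) (R := fun x y => y ∈ (fun a => Part.some (f a) : ℕ →. ℕ) x) (SF.var 0) (SF.var 1)).congr fun v => ?_
  simp [Fin.init]

theorem SF.computable2 {f : ℕ → ℕ → ℕ} (h : Computable₂ f) : SF (k := 2) (fun v => f (v 0) (v 1)) := by
  have h1 : Computable (fun x : ℕ => f (Nat.unpair x).1 (Nat.unpair x).2) := h.comp (Computable.fst.comp Computable.unpair) (Computable.snd.comp Computable.unpair)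
  have := SF.comp1 (F := fun x => f (Nat.unpair x).1 (Nat.unpair x).2) (SF.computable h1) ((SF.var (k := 2) 0).pair (SF.var 1))
  simpa using this

set_option linter.all false
set_option linter.unusedSimpArgs false

/-! ### completeness: syntax trees -/

inductive Sx : Type
  | leaf : Sx
  | nd (k : ℕ) (a b : Sx) : Sx

inductive TT {n : ℕ} : LA.Term (Empty ⊕ Fin n) → Sx → Prop
  | var (i : Fin n) : TT (vT i) (.nd (n - 1 - i + 4) .leaf .leaf)
  | zero : TT zeroT (.nd 3 .leaf .leaf)
  | succ {t s} : TT t s → TT (succT t) (.nd 2 s .leaf)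
  | add {t s t' s'} : TT t s → TT t' s' → TT (addT t t') (.nd 0 s s')
  | mul {t s t' s'} : TT t s → TT t' s' → TT (mulT t t') (.nd 1 s s')

inductive FT : ∀ {n : ℕ}, LA.BoundedFormula Empty n → Sx → Prop
  | bot {n : ℕ} : FT (⊥ : LA.BoundedFormula Empty n) .leaf
  | imp {n : ℕ} {φ ψ : LA.BoundedFormula Empty n} {s s'} : FT φ s → FT ψ s' → FT (φ.imp ψ) (.nd 0 s s')
  | eq {n : ℕ} {t t' : LA.Term (Empty ⊕ Fin n)} {s s'} : TT t s → TT t' s' → FT (t =' t') (.nd 1 s s')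
  | le {n : ℕ} {t t' : LA.Term (Empty ⊕ Fin n)} {s s'} : TT t s → TT t' s' → FT (leF t t') (.nd 2 s s')
  | all {n : ℕ} {φ : LA.BoundedFormula Empty (n+1)} {s} : FT φ s → FT φ.all (.nd 3 s .leaf)

theorem TT.total {n : ℕ} (t : LA.Term (Empty ⊕ Fin n)) : ∃ s, TT t s := by
  induction t with
  | var i =>
    rcases i with i | i
    · exact i.elim
    · exact ⟨_, TT.var i⟩
  | @func l f ts ih =>
    match l, f, ts, ih with
    | 0, f, ts, ih =>
      have : Term.func f ts = zeroT := by
        unfold zeroT Constants.term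
        congr 1
        exact Subsingleton.elim _ _
      rw [this]
      exact ⟨_, TT.zero⟩
    | 1, f, ts, ih =>
      have : Term.func f ts = succT (ts 0) := by
        unfold succT Functions.apply₁
        congr 1
        funext i; fin_cases i; rfl
      rw [this]
      obtain ⟨s, hs⟩ := ih 0
      exact ⟨_, TT.succ hs⟩
    | 2, false, ts, ih =>
      have : Term.func (show LA.Functions 2 from false) ts = addT (ts 0) (ts 1) := by
        unfold addT Functions.apply₂
        congr 1
        funext i; fin_cases i <;> rfl
      obtain ⟨s, hs⟩ := ih 0
      obtain ⟨s', hs'⟩ := ih 1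
      exact ⟨_, this ▸ TT.add hs hs'⟩
    | 2, true, ts, ih =>
      have : Term.func (show LA.Functions 2 from true) ts = mulT (ts 0) (ts 1) := by
        unfold mulT Functions.apply₂
        congr 1
        funext i; fin_cases i <;> rfl
      obtain ⟨s, hs⟩ := ih 0
      obtain ⟨s', hs'⟩ := ih 1
      exact ⟨_, this ▸ TT.mul hs hs'⟩
    | (_+3), f, ts, ih => exact Empty.elim f

theorem FT.total {n : ℕ} (φ : LA.BoundedFormula Empty n) : ∃ s, FT φ s := by
  induction φ with
  | falsum => exact ⟨_, FT.bot⟩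
  | equal t u =>
    obtain ⟨s, hs⟩ := TT.total t
    obtain ⟨s', hs'⟩ := TT.total u
    exact ⟨_, FT.eq hs hs'⟩
  | @rel n l R ts =>
    match l, R, ts with
    | 0, R, ts => exact Empty.elim R
    | 1, R, ts => exact Empty.elim R
    | 2, R, ts =>
      have : BoundedFormula.rel R ts = leF (ts 0) (ts 1) := by
        unfold leF Relations.boundedFormula₂ Relations.boundedFormula
        congr 1
        funext i; fin_cases i <;> rfl
      rw [this]
      obtain ⟨s, hs⟩ := TT.total (ts 0)
      obtain ⟨s', hs'⟩ := TT.total (ts 1)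
      exact ⟨_, FT.le hs hs'⟩
    | (_+3), R, ts => exact Empty.elim R
  | imp _ _ ih1 ih2 =>
    obtain ⟨s, hs⟩ := ih1
    obtain ⟨s', hs'⟩ := ih2
    exact ⟨_, FT.imp hs hs'⟩
  | all _ ih =>
    obtain ⟨s, hs⟩ := ih
    exact ⟨_, FT.all hs⟩

/-- rules, over an arbitrary term algebra -/
def ruf {α : Type} (nd : ℕ → α → α → α) (l : α) (x y z w : α) (k : ℕ) : ℕ → α × α × α × α
  | 0 => (nd 3 l l, nd 3 l l, nd 0 x x, l)
  | 1 => (nd 0 x y, nd 0 x z, nd 0 y z, l)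
  | 2 => (nd 0 x y, nd 3 l l, nd 0 (nd 3 x l) (nd 3 y l), l)
  | 3 => (nd 0 x y, nd 0 z w, nd 0 (nd 1 x z) (nd 1 y w), l)
  | 4 => (nd 0 x y, nd 0 z w, nd 0 (nd 2 x z) (nd 2 y w), l)
  | 5 => (nd 1 x z, nd 0 x y, nd 1 y z, l)
  | 6 => (nd 1 x z, nd 0 z y, nd 1 x y, l)
  | 7 => (nd 3 l l, nd 3 l l, nd 0 (nd (k+1+6) l l) (nd 3 (nd (k+6) l l) l), l)
  | 8 => (nd 3 l l, nd 3 l l, nd 0 (nd 4 (nd 4 l l) (nd 0 x y)) x, l)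
  | 9 => (nd 3 l l, nd 3 l l, nd 0 (nd 4 (nd (k+1+4) l l) (nd 0 x y)) (nd 4 (nd (k+4) l l) y), l)
  | 10 => (nd 3 l l, nd 3 l l, nd 0 (nd 4 (nd 3 l l) y) (nd 6 l l), l)
  | 11 => (nd 3 l l, nd 3 l l, nd 0 (nd 4 (nd 2 x l) y) (nd 3 (nd 4 x y) l), l)
  | 12 => (nd 3 l l, nd 3 l l, nd 0 (nd 4 (nd 0 x z) y) (nd 1 (nd 4 x y) (nd 4 z y)), l)
  | 13 => (nd 3 l l, nd 3 l l, nd 0 (nd 4 (nd 1 x z) y) (nd 2 (nd 4 x y) (nd 4 z y)), l)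
  | 14 => (nd 2 l y, nd 3 l l, l, l)
  | 15 => (nd 2 (nd 1 x z) y, nd 3 l l, nd 0 (nd 4 x y) (nd 4 z y), l)
  | 16 => (nd 0 (nd 4 x y) (nd 4 z y), nd 3 l l, nd 2 (nd 1 x z) y, l)
  | 17 => (nd 2 (nd 2 x z) y, nd 3 l l, nd 1 (nd 4 x y) (nd 4 z y), l)
  | 18 => (nd 1 (nd 4 x y) (nd 4 z y), nd 3 l l, nd 2 (nd 2 x z) y, l)
  | 19 => (nd 2 x y, nd 2 (nd 0 x z) y, nd 2 z y, l)
  | 20 => (nd 3 l l, nd 3 l l, nd 2 x y, nd 2 (nd 0 x z) y)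
  | 21 => (nd 2 z y, nd 3 l l, nd 2 (nd 0 x z) y, l)
  | 22 => (nd 2 (nd 3 x l) y, nd 3 l l, nd 2 x (nd 0 z y), l)
  | 23 => (nd 2 x (nd 0 (nd 5 x y) y), nd 3 l l, nd 2 (nd 3 x l) y, l)
  | _ => (nd 3 l l, nd 3 l l, nd 3 l l, l)

def Ru {α : Type} (nd : ℕ → α → α → α) (l : α) (Ax : α → Prop) (p₁ p₂ c₁ c₂ : α) : Prop :=
  (∃ i < 24, ∃ x y z w k, (p₁, p₂, c₁, c₂) = ruf nd l x y z w k i) ∨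
  ∃ s, Ax s ∧ (p₁, p₂, c₁, c₂) = (nd 3 l l, nd 3 l l, nd 2 s l, l)

theorem Ru.hom {α β : Type} {nd : ℕ → α → α → α} {l : α} {nd' : ℕ → β → β → β} {l' : β} (f : α → β)
    (h1 : f l = l') (h2 : ∀ k a b, f (nd k a b) = nd' k (f a) (f b)) {Ax : α → Prop} {Ax' : β → Prop} (hA : ∀ s, Ax s → Ax' (f s))
    {p₁ p₂ c₁ c₂ : α} (h : Ru nd l Ax p₁ p₂ c₁ c₂) : Ru nd' l' Ax' (f p₁) (f p₂) (f c₁) (f c₂) := by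
  have key : ∀ (q : α × α × α × α), (p₁, p₂, c₁, c₂) = q → (f p₁, f p₂, f c₁, f c₂) = (f q.1, f q.2.1, f q.2.2.1, f q.2.2.2) := by
    rintro q rfl
    rfl
  rcases h with ⟨i, hi, x, y, z, w, k, h⟩ | ⟨s, hs, h⟩
  · refine Or.inl ⟨i, hi, f x, f y, f z, f w, k, ?_⟩
    rw [key _ h]
    unfold ruf
    split <;> simp only [h1, h2]
  · refine Or.inr ⟨f s, hA s hs, ?_⟩
    rw [key _ h]
    simp only [h1, h2]

section sem
variable {M : Type} [CommSemiring M] [LinearOrder M]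

def cns (x : M) (ρ : ℕ → M) : ℕ → M := fun i => Nat.casesOn i x ρ

def val (ρ : ℕ → M) : Sx → M
  | .leaf => 0
  | .nd 0 a b => val ρ a + val ρ b
  | .nd 1 a b => val ρ a * val ρ b
  | .nd 2 a _ => val ρ a + 1
  | .nd 3 _ _ => 0
  | .nd (k+4) _ _ => ρ k

def Sat : Sx → (ℕ → M) → Prop
  | .leaf, _ => False
  | .nd 0 a b, ρ => Sat a ρ → Sat b ρ
  | .nd 1 a b, ρ => val ρ a = val ρ b
  | .nd 2 a b, ρ => val ρ a ≤ val ρ b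
  | .nd 3 a _, ρ => ∀ x, Sat a (cns x ρ)
  | .nd (_+4) _ _, _ => False

open Classical in
noncomputable def Hv : Sx → M × (ℕ → M)
  | .leaf => (0, fun _ => 0)
  | .nd 0 x a => (0, cns (Hv x).1 (Hv a).2)
  | .nd 1 x y => ((Hv x).1 + (Hv y).1, fun _ => 0)
  | .nd 2 x y => ((Hv x).1 * (Hv y).1, fun _ => 0)
  | .nd 3 x _ => ((Hv x).1 + 1, fun _ => 0)
  | .nd 4 t a => (val (Hv a).2 t, fun _ => 0)
  | .nd 5 φ a => (if h : ∃ x, ¬ Sat φ (cns x (Hv a).2) then Classical.choose h else 0, fun _ => 0)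
  | .nd (k+6) _ _ => ((k : M), fun _ => 0)

variable (M) in
def Tru : Sx → Prop
  | .leaf => False
  | .nd 0 x y => (Hv x : M × (ℕ → M)).1 = (Hv y).1
  | .nd 1 x y => (Hv x : M × (ℕ → M)).1 ≤ (Hv y).1
  | .nd 2 φ a => Sat φ (Hv a : M × (ℕ → M)).2
  | .nd (_+3) _ _ => True

theorem TT.val {n : ℕ} {t : LA.Term (Empty ⊕ Fin n)} {s : Sx} (h : TT t s) (ρ : ℕ → M) (v : Fin n → M)
    (hv : ∀ i : Fin n, v i = ρ (n - 1 - i)) : t.realize (Sum.elim default v) = Guaspari.val ρ s := by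
  induction h with
  | var i => simp [Guaspari.val, hv]
  | zero => simp [Guaspari.val]
  | succ _ ih => simp [Guaspari.val, ih]
  | add _ _ ih ih' => simp [Guaspari.val, ih, ih']
  | mul _ _ ih ih' => simp [Guaspari.val, ih, ih']

theorem env_snoc {n : ℕ} {ρ ρ' : ℕ → M} {v : Fin n → M} {x : M}
    (hv : ∀ i : Fin n, v i = ρ (n - 1 - i)) (h0 : ρ' 0 = x) (h1 : ∀ i, ρ' (i+1) = ρ i) (i : Fin (n+1)) : (Fin.snoc v x : Fin (n+1) → M) i = ρ' (n + 1 - 1 - i) := by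
  refine Fin.lastCases ?_ (fun j => ?_) i
  · simp [h0]
  · have : n + 1 - 1 - (j : ℕ) = (n - 1 - j) + 1 := by have := j.2; omega
    simp only [Fin.snoc_castSucc, Fin.val_castSucc, hv, this, h1]

theorem FT.sat {n : ℕ} {φ : LA.BoundedFormula Empty n} {s : Sx} (h : FT φ s) (ρ : ℕ → M) (v : Fin n → M)
    (hv : ∀ i : Fin n, v i = ρ (n - 1 - i)) : Sat s ρ ↔ φ.Realize default v := by
  induction h generalizing ρ with
  | bot => simp [Sat]
  | imp _ _ ih ih' => simp [Sat, ih ρ v hv, ih' ρ v hv]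
  | eq h h' => simp [Sat, ← h.val ρ v hv, ← h'.val ρ v hv]
  | le h h' => simp [Sat, ← h.val ρ v hv, ← h'.val ρ v hv]
  | all _ ih =>
    simp only [Sat, BoundedFormula.realize_all]
    refine forall_congr' fun x => ih _ _ (env_snoc hv rfl fun i => rfl)

/-- axioms, as trees -/
def AxS (T : Thy) (s : Sx) : Prop := ∃ φ ∈ T, FT (n := 0) φ s

theorem ru_sound {T : Thy} (hM : M ⊨ T) {p₁ p₂ c₁ c₂ : Sx} (h : Ru .nd .leaf (AxS T) p₁ p₂ c₁ c₂)
    (h1 : Tru M p₁) (h2 : Tru M p₂) : Tru M c₁ ∨ Tru M c₂ := by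
  rcases h with ⟨i, hi, x, y, z, w, k, h⟩ | ⟨s, ⟨φ, hφ, hs⟩, h⟩
  · by_cases hi' : i = 23
    · subst hi'
      simp only [ruf, Prod.mk.injEq] at h
      obtain ⟨rfl, rfl, rfl, rfl⟩ := h
      left
      simp only [Tru, Sat, Hv] at h1 ⊢
      by_contra! hc
      rw [dif_pos hc] at h1
      exact Classical.choose_spec hc h1
    · have hi2 : i < 23 := by omega
      clear hi hi'
      revert h
      interval_cases i
      all_goals
        simp only [ruf, Prod.mk.injEq]
        rintro ⟨rfl, rfl, rfl, rfl⟩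
        simp only [Tru, Hv, Sat, val, cns] at h1 h2 ⊢
        try simp_all
      tauto
  · simp only [Prod.mk.injEq] at h
    obtain ⟨rfl, rfl, rfl, rfl⟩ := h
    left
    have := Theory.realize_sentence_of_mem T hφ (M := M)
    simp only [Tru]
    rw [hs.sat _ default (fun i => i.elim0)]
    exact this
end sem
set_option linter.all false
set_option linter.unusedSimpArgs false

/-! ### completeness: refutations and term models -/

inductive Bad (T : Thy) : Set Sx → Prop
  | base {Γ} : Sx.leaf ∈ Γ → Bad T Γ
  | step {Γ p₁ p₂ c₁ c₂} : Ru .nd .leaf (AxS T) p₁ p₂ c₁ c₂ → p₁ ∈ Γ → p₂ ∈ Γ → Bad T (insert c₁ Γ) → Bad T (insert c₂ Γ) → Bad T Γ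

theorem Bad.mono {T : Thy} {Γ Δ : Set Sx} (h : Bad T Γ) (hs : Γ ⊆ Δ) : Bad T Δ := by
  induction h generalizing Δ with
  | base h => exact .base (hs h)
  | step hr h1 h2 _ _ ih1 ih2 => exact .step hr (hs h1) (hs h2) (ih1 (Set.insert_subset_insert hs)) (ih2 (Set.insert_subset_insert hs))

theorem Bad.fin {T : Thy} {Γ : Set Sx} (h : Bad T Γ) : ∃ Δ : Set Sx, Δ ⊆ Γ ∧ Δ.Finite ∧ Bad T Δ := by
  induction h with
  | base h => exact ⟨{.leaf}, by simpa using h, Set.finite_singleton _, .base rfl⟩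
  | @step Γ p₁ p₂ c₁ c₂ hr h1 h2 _ _ ih1 ih2 =>
    obtain ⟨D1, a1, b1, d1⟩ := ih1
    obtain ⟨D2, a2, b2, d2⟩ := ih2
    refine ⟨insert p₁ (insert p₂ ((D1 \ {c₁}) ∪ (D2 \ {c₂}))), ?_, ?_, .step (p₁ := p₁) (p₂ := p₂) hr (by simp) (by simp) (d1.mono ?_) (d2.mono ?_)⟩
    · intro x hx
      rcases hx with rfl | rfl | hx | hx
      · exact h1
      · exact h2
      · exact (a1 hx.1).resolve_left hx.2
      · exact (a2 hx.1).resolve_left hx.2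
    · exact (((b1.subset Set.diff_subset).union (b2.subset Set.diff_subset)).insert _).insert _
    · intro x hx
      by_cases e : x = c₁
      · exact Or.inl e
      · exact Or.inr (Or.inr (Or.inr (Or.inl ⟨hx, e⟩)))
    · intro x hx
      by_cases e : x = c₂
      · exact Or.inl e
      · exact Or.inr (Or.inr (Or.inr (Or.inr ⟨hx, e⟩)))

theorem Bad.sound {T : Thy} {M : Type} [CommSemiring M] [LinearOrder M] (hM : M ⊨ T) {Γ : Set Sx} (h : Bad T Γ) :
    ¬ ∀ s ∈ Γ, Tru M s := by
  induction h with
  | base h => exact fun hh => hh _ h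
  | step hr h1 h2 _ _ ih1 ih2 =>
    intro hh
    rcases ru_sound hM hr (hh _ h1) (hh _ h2) with h | h
    · exact ih1 fun s hs => by rcases hs with rfl | hs; exacts [h, hh _ hs]
    · exact ih2 fun s hs => by rcases hs with rfl | hs; exacts [h, hh _ hs]

theorem exists_max {T : Thy} {Γ : Set Sx} (h : ¬ Bad T Γ) : ∃ X : Set Sx, Γ ⊆ X ∧ .leaf ∉ X ∧
    ∀ p₁ p₂ c₁ c₂, Ru .nd .leaf (AxS T) p₁ p₂ c₁ c₂ → p₁ ∈ X → p₂ ∈ X → c₁ ∈ X ∨ c₂ ∈ X := by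
  obtain ⟨X, hX, hm⟩ := zorn_subset_nonempty {X : Set Sx | ¬ Bad T X} (by
    intro c hc hch hne
    refine ⟨⋃₀ c, ?_, fun s hs => Set.subset_sUnion_of_mem hs⟩
    intro hb
    obtain ⟨D, h1, h2, h3⟩ := hb.fin
    obtain ⟨t, ht, h4⟩ := DirectedOn.exists_mem_subset_of_finite_of_subset_sUnion hne hch.directedOn h2 h1
    exact hc ht (h3.mono h4)) Γ h
  refine ⟨X, hX, fun h => hm.prop (.base h), ?_⟩
  intro p₁ p₂ c₁ c₂ hr h1 h2
  by_contra! hc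
  have aux : ∀ c, c ∉ X → Bad T (insert c X) := by
    intro c hc
    by_contra hb
    exact hc (hm.le_of_ge (y := insert c X) hb (Set.subset_insert _ _) (Set.mem_insert _ _))
  exact hm.prop (.step hr h1 h2 (aux _ hc.1) (aux _ hc.2))

theorem exists_model {T : Thy} {X : Set Sx} (ht : Sx.nd 3 .leaf .leaf ∈ X) (hb : Sx.leaf ∉ X)
    (hr : ∀ p₁ p₂ c₁ c₂, Ru .nd .leaf (AxS T) p₁ p₂ c₁ c₂ → p₁ ∈ X → p₂ ∈ X → c₁ ∈ X ∨ c₂ ∈ X) :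
    ∃ (N : Type) (_ : LA.Structure N) (nv : ℕ → N) (ρ : Sx → ℕ → N), N ⊨ T ∧ Nonempty N ∧ nv 0 = rz ∧ (∀ k, nv (k+1) = rs (nv k)) ∧
      (∀ k y, ρ (.nd 0 (.nd (k+6) .leaf .leaf) y) 0 = nv k) ∧ (∀ x y i, ρ (.nd 0 x y) (i+1) = ρ y i) ∧
      ∀ (n : ℕ) (φ : LA.BoundedFormula Empty n) s, FT φ s → ∀ a (v : Fin n → N), (∀ i : Fin n, v i = ρ a (n - 1 - i)) →
        (φ.Realize default v ↔ .nd 2 s a ∈ X) := by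
  have R : ∀ i < 24, ∀ (x y z w : Sx) k, (ruf .nd .leaf x y z w k i).1 ∈ X → (ruf .nd .leaf x y z w k i).2.1 ∈ X → 
      (ruf .nd .leaf x y z w k i).2.2.1 ∈ X ∨ (ruf .nd .leaf x y z w k i).2.2.2 ∈ X := by
    intro i hi x y z w k h1 h2
    exact hr _ _ _ _ (Or.inl ⟨i, hi, x, y, z, w, k, rfl⟩) h1 h2
  have R' : ∀ i < 24, ∀ (x y z w : Sx) k, (ruf .nd .leaf x y z w k i).2.2.2 = .leaf → (ruf .nd .leaf x y z w k i).1 ∈ X → (ruf .nd .leaf x y z w k i).2.1 ∈ X → 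
      (ruf .nd .leaf x y z w k i).2.2.1 ∈ X := by
    intro i hi x y z w k h h1 h2
    rcases R i hi x y z w k h1 h2 with h' | h'
    · exact h'
    · rw [h] at h'; exact absurd h' hb
  let l := Sx.leaf
  have e0 : ∀ x, Sx.nd 0 x x ∈ X := fun x => R' 0 (by norm_num) x l l l 0 rfl ht ht
  have e1 : ∀ x y z, Sx.nd 0 x y ∈ X → Sx.nd 0 x z ∈ X → Sx.nd 0 y z ∈ X := fun x y z => R' 1 (by norm_num) x y z l 0 rfl
  have es : ∀ x y, Sx.nd 0 x y ∈ X → Sx.nd 0 y x ∈ X := fun x y h => e1 _ _ _ h (e0 x)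
  let S : Setoid Sx := ⟨fun x y => Sx.nd 0 x y ∈ X, e0, fun {x y} h => es x y h, fun {x y z} h h' => e1 _ _ _ (es _ _ h) h'⟩
  let N := Quotient S
  let mk : Sx → N := Quotient.mk S
  have mk_eq : ∀ x y, mk x = mk y ↔ Sx.nd 0 x y ∈ X := fun x y => Quotient.eq (r := S)
  let su : N → N := Quotient.map (fun x => .nd 3 x .leaf) (fun x y h => R' 2 (by norm_num) x y l l 0 rfl h ht)
  let ad : N → N → N := Quotient.map₂ (fun x y => .nd 1 x y) (fun x y h z w h' => R' 3 (by norm_num) x y z w 0 rfl h h')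
  let mu : N → N → N := Quotient.map₂ (fun x y => .nd 2 x y) (fun x y h z w h' => R' 4 (by norm_num) x y z w 0 rfl h h')
  let le : N → N → Prop := Quotient.lift₂ (fun x y => .nd 1 x y ∈ X) (by
    have aux : ∀ a b a' b', Sx.nd 0 a a' ∈ X → Sx.nd 0 b b' ∈ X → Sx.nd 1 a b ∈ X → Sx.nd 1 a' b' ∈ X := by
      intro a b a' b' h1 h2 h
      exact R' 6 (by norm_num) a' b' b l 0 rfl (R' 5 (by norm_num) a a' b l 0 rfl h h1) h2
    intro a b a' b' h1 h2
    exact propext ⟨aux _ _ _ _ h1 h2, aux _ _ _ _ (es _ _ h1) (es _ _ h2)⟩)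
  let I : LA.Structure N :=
    { funMap := fun {n} => match n with
        | 0 => fun _ _ => mk (.nd 6 l l)
        | 1 => fun _ v => su (v 0)
        | 2 => fun (f : Bool) v => match f with | false => ad (v 0) (v 1) | true => mu (v 0) (v 1)
        | (_ + 3) => fun (f : Empty) => f.elim
      RelMap := fun {n} => match n with
        | 0 => fun (f : Empty) => f.elim
        | 1 => fun (f : Empty) => f.elim
        | 2 => fun _ v => le (v 0) (v 1)
        | (_ + 3) => fun (f : Empty) => f.elim }
  have iz : (rz : N) = mk (.nd 6 l l) := rfl
  have is : ∀ x, rs (mk x) = mk (.nd 3 x l) := fun x => rfl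
  have ia : ∀ x y, ra (mk x) (mk y) = mk (.nd 1 x y) := fun x y => rfl
  have im : ∀ x y, rm (mk x) (mk y) = mk (.nd 2 x y) := fun x y => rfl
  have il : ∀ x y, rl (mk x) (mk y) ↔ .nd 1 x y ∈ X := fun x y => Iff.rfl
  let ρ : Sx → ℕ → N := fun a i => mk (.nd 4 (.nd (i+4) l l) a)
  have tv : ∀ {n : ℕ} {t : LA.Term (Empty ⊕ Fin n)} {s}, TT t s → ∀ a (v : Fin n → N), (∀ i : Fin n, v i = ρ a (n - 1 - i)) →
      t.realize (Sum.elim default v) = mk (.nd 4 s a) := by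
    intro n t s h a v hv
    induction h with
    | var i => simp [hv, ρ, l]
    | zero =>
      rw [real_zeroT, iz, eq_comm, mk_eq]
      exact R' 10 (by norm_num) l a l l 0 rfl ht ht
    | @succ t s _ ih =>
      rw [real_succT, ih, is, eq_comm, mk_eq]
      exact R' 11 (by norm_num) s a l l 0 rfl ht ht
    | @add t s t' s' _ _ ih ih' =>
      rw [real_addT, ih, ih', ia, eq_comm, mk_eq]
      exact R' 12 (by norm_num) s a s' l 0 rfl ht ht
    | @mul t s t' s' _ _ ih ih' =>
      rw [real_mulT, ih, ih', im, eq_comm, mk_eq]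
      exact R' 13 (by norm_num) s a s' l 0 rfl ht ht
  have r0 : ∀ x y, ρ (.nd 0 x y) 0 = mk x := fun x y => (mk_eq _ _).2 (R' 8 (by norm_num) x y l l 0 rfl ht ht)
  have r1 : ∀ x y i, ρ (.nd 0 x y) (i+1) = ρ y i := fun x y i => (mk_eq _ _).2 (R' 9 (by norm_num) x y l l i rfl ht ht)
  have truth : ∀ (n : ℕ) (φ : LA.BoundedFormula Empty n) s, FT φ s → ∀ a (v : Fin n → N), (∀ i : Fin n, v i = ρ a (n - 1 - i)) →
        (φ.Realize default v ↔ .nd 2 s a ∈ X) := by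
    intro n φ s h
    induction h with
    | bot =>
      intro a v hv
      simp only [BoundedFormula.realize_bot, false_iff]
      exact fun h => hb (R' 14 (by norm_num) l a l l 0 rfl h ht)
    | @imp n φ ψ s s' _ _ ih ih' =>
      intro a v hv
      rw [BoundedFormula.realize_imp, ih a v hv, ih' a v hv]
      constructor
      · intro h
        rcases R 20 (by norm_num) s a s' l 0 ht ht with h' | h'
        · exact R' 21 (by norm_num) s a s' l 0 rfl (h h') ht
        · exact h'
      · intro h h'
        exact R' 19 (by norm_num) s a s' l 0 rfl h' h
    | @eq n t t' s s' h h' =>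
      intro a v hv
      rw [BoundedFormula.realize_bdEqual, tv h a v hv, tv h' a v hv, mk_eq]
      exact ⟨fun h => R' 16 (by norm_num) s a s' l 0 rfl h ht, fun h => R' 15 (by norm_num) s a s' l 0 rfl h ht⟩
    | @le n t t' s s' h h' =>
      intro a v hv
      rw [real_leF, tv h a v hv, tv h' a v hv, il]
      exact ⟨fun h => R' 18 (by norm_num) s a s' l 0 rfl h ht, fun h => R' 17 (by norm_num) s a s' l 0 rfl h ht⟩
    | @all n φ s _ ih =>
      intro a v hv
      rw [BoundedFormula.realize_all]
      have e : ∀ x, φ.Realize default (Fin.snoc v (mk x)) ↔ .nd 2 s (.nd 0 x a) ∈ X := fun x => ih _ _ (by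
        intro i
        refine Fin.lastCases ?_ (fun j => ?_) i
        · simp [r0]
        · have : n + 1 - 1 - (j : ℕ) = (n - 1 - j) + 1 := by have := j.2; omega
          simp only [Fin.snoc_castSucc, Fin.val_castSucc, hv, this, r1])
      constructor
      · intro h
        exact R' 23 (by norm_num) s a l l 0 rfl ((e _).1 (h _)) ht
      · intro h x
        induction x using Quotient.inductionOn with
        | _ x =>
          exact (e x).2 (R' 22 (by norm_num) s a x l 0 rfl h ht)
  refine ⟨N, I, fun k => mk (.nd (k+6) l l), ρ, ?_, ⟨mk l⟩, rfl, ?_, ?_, r1, truth⟩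
  · refine ⟨fun φ hφ => ?_⟩
    obtain ⟨s, hs⟩ := FT.total (n := 0) φ
    refine (truth 0 φ s hs .leaf default (fun i => i.elim0)).2 ?_
    rcases hr _ _ _ _ (Or.inr ⟨s, ⟨φ, hφ, hs⟩, rfl⟩) ht ht with h | h
    · exact h
    · exact absurd h hb
  · intro k
    rw [is, mk_eq]
    exact R' 7 (by norm_num) l l l l k rfl ht ht
  · intro k y
    exact r0 _ _

/-- the environment of three numerals -/
def env3 {α : Type} (nd : ℕ → α → α → α) (l : α) (x y e : ℕ) : α :=
  nd 0 (nd (e+6) l l) (nd 0 (nd (y+6) l l) (nd 0 (nd (x+6) l l) l))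

theorem bad_iff {T : Thy} (hT : ExtPA T) {φ ψ : LA.BoundedFormula Empty 3} {s s' : Sx} (hs : FT φ s) (hs' : FT ψ s') (x y e : ℕ) :
    Bad T {.nd 3 .leaf .leaf, .nd 2 s (env3 .nd .leaf x y e), .nd 2 s' (env3 .nd .leaf x y e)} ↔
    ∀ (M : Type) [CommSemiring M] [LinearOrder M] [PAM M], M ⊨ T → ¬ (φ.Realize default ![(x : M), y, e] ∧ ψ.Realize default ![(x : M), y, e]) := by
  constructor
  · intro h M _ _ _ hM ⟨h1, h2⟩
    refine h.sound hM ?_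
    have e : ∀ i : Fin 3, ![(x : M), y, e] i = (Hv (env3 .nd .leaf x y e)).2 (3 - 1 - i) := by
      intro i
      fin_cases i <;> simp [env3, Hv, cns] <;> rfl
    rintro t (rfl | rfl | rfl)
    · simp [Tru]
    · exact (hs.sat _ _ e).2 h1
    · exact (hs'.sat _ _ e).2 h2
  · intro h
    by_contra hb
    obtain ⟨X, h1, h2, h3⟩ := exists_max hb
    obtain ⟨N, I, nv, ρ, g1, g2, g3, g4, g5, g6, g7⟩ := exists_model (T := T) (h1 (by simp)) h2 h3
    have hN : N ⊨ PAAx := ⟨fun φ hφ => (hT φ hφ).realize_sentence N⟩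
    obtain ⟨C, O, hS, hP⟩ := exists_alg N hN
    subst hS
    have hnv : ∀ k, nv k = (k : N) := by
      intro k
      induction k with
      | zero => simpa using g3
      | succ k ih => rw [g4, ih]; simp
    have e : ∀ i : Fin 3, ![(x : N), y, e] i = ρ (env3 .nd .leaf x y e) (3 - 1 - i) := by
      intro i
      fin_cases i
      · show (x : N) = ρ _ 2
        rw [env3, g6, g6, g5, hnv]
      · show (y : N) = ρ _ 1
        rw [env3, g6, g5, hnv]
      · show (e : N) = ρ _ 0
        rw [env3, g5, hnv]
    refine h N g1 ⟨(g7 _ _ _ hs _ _ e).2 (h1 (by simp)), (g7 _ _ _ hs' _ _ e).2 (h1 (by simp))⟩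
set_option linter.all false
set_option linter.unusedSimpArgs false

/-! ### coding of trees -/

def ndN (k a b : ℕ) : ℕ := Nat.pair k (Nat.pair a b) + 1
def cell (x r : ℕ) : ℕ := Nat.pair x r + 1
def qd (l r n c : ℕ) : ℕ := Nat.pair l (Nat.pair r (Nat.pair n c))

theorem ndN_inj {k a b k' a' b' : ℕ} : ndN k a b = ndN k' a' b' ↔ k = k' ∧ a = a' ∧ b = b' := by
  simp [ndN, Nat.pair_eq_pair]
theorem qd_inj {k a b c k' a' b' c' : ℕ} : qd k a b c = qd k' a' b' c' ↔ k = k' ∧ a = a' ∧ b = b' ∧ c = c' := by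
  simp [qd, Nat.pair_eq_pair]

theorem SF.ndN {k : ℕ} {f g h : (Fin k → ℕ) → ℕ} (hf : SF f) (hg : SF g) (hh : SF h) : SF (fun v => ndN (f v) (g v) (h v)) :=
  (hf.pair (hg.pair hh)).add (SF.const 1)
theorem SF.cell {k : ℕ} {f g : (Fin k → ℕ) → ℕ} (hf : SF f) (hg : SF g) : SF (fun v => cell (f v) (g v)) :=
  (hf.pair hg).add (SF.const 1)
theorem SF.qd {k : ℕ} {f g h i : (Fin k → ℕ) → ℕ} (hf : SF f) (hg : SF g) (hh : SF h) (hi : SF i) : SF (fun v => qd (f v) (g v) (h v) (i v)) :=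
  hf.pair (hg.pair (hh.pair hi))

def cod : Sx → ℕ
  | .leaf => 0
  | .nd k a b => ndN k (cod a) (cod b)

theorem cod_inj : Function.Injective cod := by
  intro s
  induction s with
  | leaf =>
    intro t h
    cases t with
    | leaf => rfl
    | nd => simp [cod, ndN] at h
  | nd k a b iha ihb =>
    intro t h
    cases t with
    | leaf => simp [cod, ndN] at h
    | nd =>
      simp only [cod, ndN_inj] at h
      rw [h.1, iha h.2.1, ihb h.2.2]

theorem cod_surj : Function.Surjective cod := by
  intro n
  induction n using Nat.strong_induction_on with
  | _ n ih =>
    cases n with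
    | zero => exact ⟨.leaf, rfl⟩
    | succ n =>
      have h1 := Nat.unpair_right_le n
      have h2 := Nat.unpair_left_le n.unpair.2
      have h3 := Nat.unpair_right_le n.unpair.2
      obtain ⟨a, ha⟩ := ih n.unpair.2.unpair.1 (by omega)
      obtain ⟨b, hb⟩ := ih n.unpair.2.unpair.2 (by omega)
      exact ⟨.nd n.unpair.1 a b, by simp [cod, ndN, ha, hb]⟩

noncomputable def codE : Sx ≃ ℕ := Equiv.ofBijective cod ⟨cod_inj, cod_surj⟩
noncomputable def dec : ℕ → Sx := codE.symm
theorem cod_dec (n : ℕ) : cod (dec n) = n := codE.apply_symm_apply n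
theorem dec_cod (s : Sx) : dec (cod s) = s := codE.symm_apply_apply s
theorem dec_zero : dec 0 = .leaf := dec_cod .leaf
theorem dec_nd (k a b : ℕ) : dec (ndN k a b) = .nd k (dec a) (dec b) := by
  rw [← dec_cod (.nd k (dec a) (dec b)), cod, cod_dec, cod_dec]

/-! ### parsing -/

def cat {A : Type} [Encodable A] (L : List A) (r : ℕ) : ℕ := L.foldr (fun x s => cell (Encodable.encode x) s) r

theorem cat_append {A : Type} [Encodable A] (L L' : List A) (r : ℕ) : cat (L ++ L') r = cat L (cat L' r) := by
  simp [cat]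
theorem cat_cons {A : Type} [Encodable A] (x : A) (L' : List A) (r : ℕ) : cat (x :: L') r = cell (Encodable.encode x) (cat L' r) := rfl
theorem cat_nil {A : Type} [Encodable A] (r : ℕ) : cat ([] : List A) r = r := rfl
theorem encode_list {A : Type} [Encodable A] (L : List A) : Encodable.encode L = cat L 0 := by
  induction L with
  | nil => rfl
  | cons x L ih => rw [Encodable.encode_list_cons, ih]; rfl

def BT (f : ℕ) : Prop := (∃ r, ∃ n, ∃ i, ∃ j, i + j + 1 = n ∧ f = qd (cell (2*(2*i+1)) r) r n (ndN (j + 4) 0 0)) ∨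
  (∃ r, ∃ n, f = qd (cell (2 * Nat.pair 0 0 + 1) r) r n (ndN 3 0 0))
def RT (a b c : ℕ) : Prop := (∃ l, ∃ r, ∃ n, ∃ s, a = qd l r n s ∧ c = qd (cell (2 * Nat.pair 1 0 + 1) l) r n (ndN 2 s 0)) ∨
  (∃ l, ∃ l', ∃ r, ∃ n, ∃ s, ∃ s', a = qd l l' n s ∧ b = qd l' r n s' ∧ (c = qd (cell (2 * Nat.pair 2 0 + 1) l) r n (ndN 0 s s') ∨
    c = qd (cell (2 * Nat.pair 2 1 + 1) l) r n (ndN 1 s s')))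
def GT (f : ℕ) : Prop := Der BT RT f
def BF (f : ℕ) : Prop := (∃ r, ∃ n, f = qd (cell (2*(2*(n+2)+1)+1) r) r n 0) ∨
  (∃ r, ∃ n, ∃ t, ∃ t', ∃ s, ∃ s', GT (qd t 0 n s) ∧ GT (qd t' 0 n s') ∧ 
    (f = qd (cell (2*Nat.pair n t) (cell (2*Nat.pair n t') r)) r n (ndN 1 s s') ∨ 
      f = qd (cell (2*(2*Nat.pair 2 0)+1) (cell (2*(2*n+1)+1) (cell (2*Nat.pair n t) (cell (2*Nat.pair n t') r)))) r n (ndN 2 s s')))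
def RF (a b c : ℕ) : Prop := (∃ l, ∃ r, ∃ n, ∃ s, a = qd l r (n+1) s ∧ c = qd (cell (2*(2*1+1)+1) l) r n (ndN 3 s 0)) ∨
  (∃ l, ∃ l', ∃ r, ∃ n, ∃ s, ∃ s', a = qd l l' n s ∧ b = qd l' r n s' ∧ c = qd (cell (2*(2*0+1)+1) l) r n (ndN 0 s s'))
def GF (f : ℕ) : Prop := Der BF RF f

theorem sig1_GT {k : ℕ} {f : (Fin k → ℕ) → ℕ} (hf : SF f) : Sig1 (fun v => GT (f v)) := by
  refine Sig1.comp1 (R := GT) (Sig1.der ?_ ?_) hf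
  · unfold BT
    repeat' (first | exact SF.var _ | exact SF.const _ | with_reducible apply SF.qd | with_reducible apply SF.cell | with_reducible apply SF.ndN | with_reducible apply SF.add | with_reducible apply SF.mul | with_reducible apply SF.pair | with_reducible apply Sig1.ball | with_reducible apply Sig1.ex | with_reducible apply Sig1.and | with_reducible apply Sig1.or | with_reducible apply Sig1.eq | with_reducible apply Sig1.le | with_reducible apply Sig1.lt | with_reducible apply Sig1.ne)
  · unfold RT
    repeat' (first | exact SF.var _ | exact SF.const _ | with_reducible apply SF.qd | with_reducible apply SF.cell | with_reducible apply SF.ndN | with_reducible apply SF.add | with_reducible apply SF.mul | with_reducible apply SF.pair | with_reducible apply Sig1.ball | with_reducible apply Sig1.ex | with_reducible apply Sig1.and | with_reducible apply Sig1.or | with_reducible apply Sig1.eq | with_reducible apply Sig1.le | with_reducible apply Sig1.lt | with_reducible apply Sig1.ne)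

theorem sig1_GF {k : ℕ} {f : (Fin k → ℕ) → ℕ} (hf : SF f) : Sig1 (fun v => GF (f v)) := by
  refine Sig1.comp1 (R := GF) (Sig1.der ?_ ?_) hf
  · unfold BF
    repeat' (first | exact SF.var _ | exact SF.const _ | with_reducible apply SF.qd | with_reducible apply SF.cell | with_reducible apply SF.ndN | with_reducible apply sig1_GT | with_reducible apply SF.add | with_reducible apply SF.mul | with_reducible apply SF.pair | with_reducible apply Sig1.ball | with_reducible apply Sig1.ex | with_reducible apply Sig1.and | with_reducible apply Sig1.or | with_reducible apply Sig1.eq | with_reducible apply Sig1.le | with_reducible apply Sig1.lt | with_reducible apply Sig1.ne)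
  · unfold RF
    repeat' (first | exact SF.var _ | exact SF.const _ | with_reducible apply SF.qd | with_reducible apply SF.cell | with_reducible apply SF.ndN | with_reducible apply sig1_GT | with_reducible apply SF.add | with_reducible apply SF.mul | with_reducible apply SF.pair | with_reducible apply Sig1.ball | with_reducible apply Sig1.ex | with_reducible apply Sig1.and | with_reducible apply Sig1.or | with_reducible apply Sig1.eq | with_reducible apply Sig1.le | with_reducible apply Sig1.lt | with_reducible apply Sig1.ne)

theorem le_var {n : ℕ} (i : Fin n) : (vT i).listEncode = [Sum.inl (Sum.inr i)] := rfl
theorem le_zero {n : ℕ} : (zeroT : LA.Term (Empty ⊕ Fin n)).listEncode = [Sum.inr ⟨0, Unit.unit⟩] := rfl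
theorem le_succ {n : ℕ} (t : LA.Term (Empty ⊕ Fin n)) : (succT t).listEncode = Sum.inr ⟨1, Unit.unit⟩ :: t.listEncode := by
  show _ :: (_ ++ []) = _
  rw [List.append_nil]; rfl
theorem le_add {n : ℕ} (t u : LA.Term (Empty ⊕ Fin n)) : (addT t u).listEncode = Sum.inr ⟨2, false⟩ :: (t.listEncode ++ u.listEncode) := by
  show _ :: (_ ++ (_ ++ [])) = _
  rw [List.append_nil]; rfl
theorem le_mul {n : ℕ} (t u : LA.Term (Empty ⊕ Fin n)) : (mulT t u).listEncode = Sum.inr ⟨2, true⟩ :: (t.listEncode ++ u.listEncode) := by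
  show _ :: (_ ++ (_ ++ [])) = _
  rw [List.append_nil]; rfl

theorem en_var {n : ℕ} (i : Fin n) : Encodable.encode (Sum.inl (Sum.inr i) : (Empty ⊕ Fin n) ⊕ (Σ i, LA.Functions i)) = 2*(2*(i:ℕ)+1) := rfl
theorem en_zero {n : ℕ} : Encodable.encode (Sum.inr ⟨0, Unit.unit⟩ : (Empty ⊕ Fin n) ⊕ (Σ i, LA.Functions i)) = 2*Nat.pair 0 0+1 := rfl
theorem en_succ {n : ℕ} : Encodable.encode (Sum.inr ⟨1, Unit.unit⟩ : (Empty ⊕ Fin n) ⊕ (Σ i, LA.Functions i)) = 2*Nat.pair 1 0+1 := rfl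
theorem en_add {n : ℕ} : Encodable.encode (Sum.inr ⟨2, false⟩ : (Empty ⊕ Fin n) ⊕ (Σ i, LA.Functions i)) = 2*Nat.pair 2 0+1 := rfl
theorem en_mul {n : ℕ} : Encodable.encode (Sum.inr ⟨2, true⟩ : (Empty ⊕ Fin n) ⊕ (Σ i, LA.Functions i)) = 2*Nat.pair 2 1+1 := rfl

theorem gt_mp {n : ℕ} {t : LA.Term (Empty ⊕ Fin n)} {s : Sx} (h : TT t s) : ∀ r, GT (qd (cat t.listEncode r) r n (cod s)) := by
  induction h with
  | var i =>
    intro r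
    refine .base (.inl ⟨r, n, i, n - 1 - i, by have := i.2; omega, ?_⟩)
    rw [le_var, cat_cons, en_var]; rfl
  | zero =>
    intro r
    refine .base (.inr ⟨r, n, ?_⟩)
    rw [le_zero, cat_cons, en_zero]; rfl
  | succ _ ih =>
    intro r
    refine .step (ih r) (ih r) (.inl ⟨_, _, _, _, rfl, ?_⟩)
    rw [le_succ, cat_cons, en_succ]; rfl
  | add _ _ ih ih' =>
    intro r
    refine .step (ih _) (ih' r) (.inr ⟨_, _, _, _, _, _, rfl, rfl, .inl ?_⟩)
    rw [le_add, cat_cons, cat_append, en_add]; rfl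
  | mul _ _ ih ih' =>
    intro r
    refine .step (ih _) (ih' r) (.inr ⟨_, _, _, _, _, _, rfl, rfl, .inr ?_⟩)
    rw [le_mul, cat_cons, cat_append, en_mul]; rfl

theorem gt_mpr {f : ℕ} (h : GT f) : ∃ (r n : ℕ) (t : LA.Term (Empty ⊕ Fin n)) (s : Sx), TT t s ∧ f = qd (cat t.listEncode r) r n (cod s) := by
  induction h with
  | base h =>
    rcases h with ⟨r, n, i, j, h, rfl⟩ | ⟨r, n, rfl⟩
    · refine ⟨r, n, _, _, TT.var ⟨i, by omega⟩, ?_⟩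
      rw [le_var, cat_cons, en_var]
      have : n - 1 - i = j := by omega
      simp [this]; rfl
    · refine ⟨r, n, _, _, TT.zero, ?_⟩
      rw [le_zero, cat_cons, en_zero]; rfl
  | step _ _ h ih1 ih2 =>
    obtain ⟨r1, n1, t1, s1, h1, rfl⟩ := ih1
    obtain ⟨r2, n2, t2, s2, h2, rfl⟩ := ih2
    rcases h with ⟨l, r, n, s, e1, rfl⟩ | ⟨l, l', r, n, s, s', e1, e2, rfl | rfl⟩
    · rw [qd_inj] at e1
      obtain ⟨rfl, rfl, rfl, rfl⟩ := e1
      refine ⟨r1, _, _, _, TT.succ h1, ?_⟩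
      rw [le_succ, cat_cons, en_succ]; rfl
    · rw [qd_inj] at e1 e2
      obtain ⟨rfl, rfl, rfl, rfl⟩ := e1
      obtain ⟨rfl, rfl, rfl, rfl⟩ := e2
      refine ⟨r2, _, _, _, TT.add h1 h2, ?_⟩
      rw [le_add, cat_cons, cat_append, en_add]; rfl
    · rw [qd_inj] at e1 e2
      obtain ⟨rfl, rfl, rfl, rfl⟩ := e1
      obtain ⟨rfl, rfl, rfl, rfl⟩ := e2
      refine ⟨r2, _, _, _, TT.mul h1 h2, ?_⟩
      rw [le_mul, cat_cons, cat_append, en_mul]; rfl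

abbrev FA : Type := (Σ k, LA.Term (Empty ⊕ Fin k)) ⊕ ((Σ n, LA.Relations n) ⊕ ℕ)

theorem en_t {n : ℕ} (t : LA.Term (Empty ⊕ Fin n)) : Encodable.encode (Sum.inl ⟨n, t⟩ : FA) = 2 * Nat.pair n (cat t.listEncode 0) := by
  rw [← encode_list]; rfl
theorem en_r : Encodable.encode (Sum.inr (Sum.inl ⟨2, Unit.unit⟩) : FA) = 2 * (2 * Nat.pair 2 0) + 1 := rfl
theorem en_n (n : ℕ) : Encodable.encode (Sum.inr (Sum.inr n) : FA) = 2 * (2 * n + 1) + 1 := rfl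
theorem lf_bot {n : ℕ} : (⊥ : LA.BoundedFormula Empty n).listEncode = [Sum.inr (Sum.inr (n+2))] := rfl
theorem lf_eq {n : ℕ} (t u : LA.Term (Empty ⊕ Fin n)) : (t =' u).listEncode = [Sum.inl ⟨n, t⟩, Sum.inl ⟨n, u⟩] := rfl
theorem lf_le {n : ℕ} (t u : LA.Term (Empty ⊕ Fin n)) : (leF t u).listEncode = [Sum.inr (Sum.inl ⟨2, Unit.unit⟩), Sum.inr (Sum.inr n), Sum.inl ⟨n, t⟩, Sum.inl ⟨n, u⟩] := rfl
theorem lf_imp {n : ℕ} (φ ψ : LA.BoundedFormula Empty n) : (φ.imp ψ).listEncode = Sum.inr (Sum.inr 0) :: (φ.listEncode ++ ψ.listEncode) := rfl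
theorem lf_all {n : ℕ} (φ : LA.BoundedFormula Empty (n+1)) : (φ.all).listEncode = Sum.inr (Sum.inr 1) :: φ.listEncode := rfl

theorem gf_mp {n : ℕ} {φ : LA.BoundedFormula Empty n} {s : Sx} (h : FT φ s) : ∀ r, GF (qd (cat (A := FA) φ.listEncode r) r n (cod s)) := by
  induction h with
  | @bot n =>
    intro r
    refine .base (.inl ⟨r, n, ?_⟩)
    rw [lf_bot, cat_cons, en_n]; rfl
  | eq h h' =>
    intro r
    refine .base (.inr ⟨r, _, _, _, _, _, gt_mp h 0, gt_mp h' 0, .inl ?_⟩)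
    rw [lf_eq, cat_cons, cat_cons, en_t, en_t]; rfl
  | le h h' =>
    intro r
    refine .base (.inr ⟨r, _, _, _, _, _, gt_mp h 0, gt_mp h' 0, .inr ?_⟩)
    rw [lf_le, cat_cons, cat_cons, cat_cons, cat_cons, en_t, en_t, en_n, en_r]; rfl
  | imp _ _ ih ih' =>
    intro r
    refine .step (ih _) (ih' r) (.inr ⟨_, _, _, _, _, _, rfl, rfl, ?_⟩)
    rw [lf_imp, cat_cons, cat_append, en_n]; rfl
  | all _ ih =>
    intro r
    refine .step (ih r) (ih r) (.inl ⟨_, _, _, _, rfl, ?_⟩)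
    rw [lf_all, cat_cons, en_n]; rfl

theorem gf_mpr {f : ℕ} (h : GF f) : ∃ (r n : ℕ) (φ : LA.BoundedFormula Empty n) (s : Sx), FT φ s ∧ f = qd (cat (A := FA) φ.listEncode r) r n (cod s) := by
  induction h with
  | base h =>
    rcases h with ⟨r, n, rfl⟩ | ⟨r, n, t, t', s, s', h1, h2, h⟩
    · refine ⟨r, n, _, _, FT.bot, ?_⟩
      rw [lf_bot, cat_cons, en_n]; rfl
    · obtain ⟨r1, n1, t1, s1, g1, e1⟩ := gt_mpr h1
      obtain ⟨r2, n2, t2, s2, g2, e2⟩ := gt_mpr h2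
      rw [qd_inj] at e1 e2
      obtain ⟨rfl, rfl, rfl, rfl⟩ := e1
      obtain ⟨rfl, rfl, rfl, rfl⟩ := e2
      rcases h with rfl | rfl
      · refine ⟨r, _, _, _, FT.eq g1 g2, ?_⟩
        rw [lf_eq, cat_cons, cat_cons, en_t, en_t]; rfl
      · refine ⟨r, _, _, _, FT.le g1 g2, ?_⟩
        rw [lf_le, cat_cons, cat_cons, cat_cons, cat_cons, en_t, en_t, en_n, en_r]; rfl
  | step _ _ h ih1 ih2 =>
    obtain ⟨r1, n1, t1, s1, h1, rfl⟩ := ih1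
    obtain ⟨r2, n2, t2, s2, h2, rfl⟩ := ih2
    rcases h with ⟨l, r, n, s, e1, rfl⟩ | ⟨l, l', r, n, s, s', e1, e2, rfl⟩
    · rw [qd_inj] at e1
      obtain ⟨rfl, rfl, rfl, rfl⟩ := e1
      refine ⟨r1, _, _, _, FT.all h1, ?_⟩
      rw [lf_all, cat_cons, en_n]; rfl
    · rw [qd_inj] at e1 e2
      obtain ⟨rfl, rfl, rfl, rfl⟩ := e1
      obtain ⟨rfl, rfl, rfl, rfl⟩ := e2
      refine ⟨r2, _, _, _, FT.imp h1 h2, ?_⟩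
      rw [lf_imp, cat_cons, cat_append, en_n]; rfl

theorem gnum_eq (φ : Snt) : gnum φ = cat (A := FA) (BoundedFormula.listEncode (n := 0) φ) 0 := by
  rw [← encode_list]; rfl

def AxN (T : Thy) (c : ℕ) : Prop := ∃ m, (∃ φ ∈ T, gnum φ = m) ∧ GF (qd m 0 0 c)

theorem axN_iff (T : Thy) (s : Sx) : AxN T (cod s) ↔ AxS T s := by
  constructor
  · rintro ⟨_, ⟨φ, hφ, rfl⟩, h⟩
    obtain ⟨r, n, ψ, s', h, e⟩ := gf_mpr h
    rw [qd_inj] at e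
    obtain ⟨e, rfl, rfl, e'⟩ := e
    obtain rfl := cod_inj e'
    rw [gnum_eq, ← encode_list, ← encode_list] at e
    have e2 := BoundedFormula.listEncode_sigma_injective (a₁ := ⟨0, φ⟩) (a₂ := ⟨0, ψ⟩) (Encodable.encode_injective e)
    simp only [Sigma.mk.injEq, heq_eq_eq, true_and] at e2
    subst e2
    exact ⟨φ, hφ, h⟩
  · rintro ⟨φ, hφ, h⟩
    exact ⟨_, ⟨φ, hφ, rfl⟩, by rw [gnum_eq]; exact gf_mp h 0⟩
set_option linter.all false
set_option linter.unusedSimpArgs false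

/-! ### inconsistency is recursively enumerable -/

theorem sig1_AxN {T : Thy} (hT : CompThy T) : Sig1 (k := 1) (fun v => AxN T (v 0)) := by
  unfold AxN
  have := sig1_computablePred hT
  refine Sig1.ex ?_
  refine Sig1.and ?_ ?_
  · exact Sig1.comp1 (R := fun m => ∃ φ ∈ T, gnum φ = m) this (SF.var _)
  · exact sig1_GF (SF.qd (SF.var _) (SF.const 0) (SF.const 0) (SF.var _))

theorem Sig1.fls {k : ℕ} : Sig1 (k := k) (fun _ => False) :=
  (Sig1.eq (SF.const 0) (SF.const 1)).congr (by simp)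

theorem Sig1.fin {k : ℕ} {R : ℕ → (Fin k → ℕ) → Prop} (m : ℕ) (h : ∀ i < m, Sig1 (R i)) : Sig1 (fun v => ∃ i < m, R i v) := by
  induction m with
  | zero => exact Sig1.fls.congr (by simp)
  | succ m ih =>
    refine ((ih fun i hi => h i (by omega)).or (h m (by omega))).congr fun v => ?_
    simp only [Nat.exists_lt_succ_right]

theorem sig1_Ru {A : ℕ → Prop} (hA : Sig1 (k := 1) (fun v => A (v 0))) : Sig1 (k := 4) (fun v => Ru ndN 0 A (v 0) (v 1) (v 2) (v 3)) := by
  unfold Ru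
  refine Sig1.or (Sig1.fin 24 ?_) ?_
  · intro i hi
    interval_cases i <;> simp only [ruf, Prod.mk.injEq] <;> repeat' (first | exact SF.var _ | exact SF.const _ | with_reducible apply SF.ndN | with_reducible apply SF.add | with_reducible apply SF.mul | with_reducible apply SF.pair | with_reducible apply Sig1.ball | with_reducible apply Sig1.ex | with_reducible apply Sig1.and | with_reducible apply Sig1.or | with_reducible apply Sig1.eq | with_reducible apply Sig1.le | with_reducible apply Sig1.lt | with_reducible apply Sig1.ne)
  · simp only [Prod.mk.injEq]
    refine Sig1.ex (Sig1.and (Sig1.comp1 hA (SF.var _)) ?_)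
    repeat' (first | exact SF.var _ | exact SF.const _ | with_reducible apply SF.ndN | with_reducible apply SF.add | with_reducible apply SF.mul | with_reducible apply SF.pair | with_reducible apply Sig1.ball | with_reducible apply Sig1.ex | with_reducible apply Sig1.and | with_reducible apply Sig1.or | with_reducible apply Sig1.eq | with_reducible apply Sig1.le | with_reducible apply Sig1.lt | with_reducible apply Sig1.ne)

def StB (T : Thy) (a b c : ℕ) : Prop := ∃ p1, ∃ p2, ∃ c1, ∃ c2, Ru ndN 0 (AxN T) p1 p2 c1 c2 ∧ Mem p1 c ∧ Mem p2 c ∧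
  (∀ z ≤ a, ¬ Mem z a ∨ Mem z c ∨ z = c1) ∧ (∀ z ≤ b, ¬ Mem z b ∨ Mem z c ∨ z = c2)
def DerB (T : Thy) (c : ℕ) : Prop := Der (fun c => Mem 0 c) (StB T) c

theorem sig1_DerB {T : Thy} (hT : CompThy T) : Sig1 (k := 1) (fun v => DerB T (v 0)) := by
  have h4 := sig1_Ru (sig1_AxN hT)
  refine Sig1.der ?_ ?_
  · exact Sig1.mem (SF.const 0) (SF.var _)
  · unfold StB
    refine Sig1.ex (Sig1.ex (Sig1.ex (Sig1.ex (Sig1.and (Sig1.comp4 h4 (SF.var _) (SF.var _) (SF.var _) (SF.var _)) ?_))))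
    repeat' (first | exact SF.var _ | exact SF.const _ | with_reducible apply Sig1.mem | with_reducible apply Sig1.nmem | with_reducible apply SF.add | with_reducible apply SF.mul | with_reducible apply SF.pair | with_reducible apply Sig1.ball | with_reducible apply Sig1.ex | with_reducible apply Sig1.and | with_reducible apply Sig1.or | with_reducible apply Sig1.eq | with_reducible apply Sig1.le | with_reducible apply Sig1.lt | with_reducible apply Sig1.ne)

theorem derB_mp {T : Thy} {c : ℕ} (h : DerB T c) : Bad T {s | Mem (cod s) c} := by
  induction h with
  | base h => exact .base h
  | step _ _ h ih1 ih2 =>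
    obtain ⟨p1, p2, c1, c2, hr, h1, h2, ha, hb⟩ := h
    have hr' := hr.hom (nd' := Sx.nd) (l' := Sx.leaf) (Ax' := AxS T) dec dec_zero dec_nd (fun s hs => (axN_iff T (dec s)).1 (by rwa [cod_dec]))
    refine Bad.step hr' (by simpa [cod_dec] using h1) (by simpa [cod_dec] using h2) (ih1.mono ?_) (ih2.mono ?_)
    · intro s hs
      rcases ha (cod s) (Mem.lt hs).le with h | h | h
      · exact absurd hs h
      · exact Or.inr h
      · exact Or.inl (by rw [← h, dec_cod])
    · intro s hs
      rcases hb (cod s) (Mem.lt hs).le with h | h | h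
      · exact absurd hs h
      · exact Or.inr h
      · exact Or.inl (by rw [← h, dec_cod])

theorem derB_mpr {T : Thy} {Γ : Set Sx} (h : Bad T Γ) : ∀ c : ℕ, (∀ s ∈ Γ, Mem (cod s) c) → DerB T c := by
  have ins : ∀ c d : ℕ, ∃ a : ℕ, ∀ z, Mem z a ↔ Mem z c ∨ z = d := by
    intro c d
    obtain ⟨a, ha⟩ := code_nat (fun z => Mem z c ∨ z = d) (c + d + 1)
    refine ⟨a, fun z => (ha z).trans ⟨fun h => h.2, fun h => ⟨?_, h⟩⟩⟩
    rcases h with h | h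
    · have := h.lt; omega
    · omega
  induction h with
  | base h => exact fun c hc => .base (hc _ h)
  | @step Γ p1 p2 c1 c2 hr h1 h2 _ _ ih1 ih2 =>
    intro c hc
    obtain ⟨a, ha⟩ := ins c (cod c1)
    obtain ⟨b, hb⟩ := ins c (cod c2)
    have hr' := hr.hom (nd' := ndN) (l' := 0) (Ax' := AxN T) cod rfl (fun _ _ _ => rfl) (fun s hs => (axN_iff T s).2 hs)
    refine .step (ih1 a ?_) (ih2 b ?_) ⟨_, _, _, _, hr', hc _ h1, hc _ h2, fun z _ => ?_, fun z _ => ?_⟩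
    · rintro s (rfl | hs)
      · exact (ha _).2 (Or.inr rfl)
      · exact (ha _).2 (Or.inl (hc _ hs))
    · rintro s (rfl | hs)
      · exact (hb _).2 (Or.inr rfl)
      · exact (hb _).2 (Or.inl (hc _ hs))
    · rw [ha]; tauto
    · rw [hb]; tauto

def QT (T : Thy) (l1 l2 x y e : ℕ) : Prop := ∃ c, DerB T c ∧ ∀ z ≤ c, ¬ Mem z c ∨ z = ndN 3 0 0 ∨
  z = ndN 2 l1 (ndN 0 (ndN (e+6) 0 0) (ndN 0 (ndN (y+6) 0 0) (ndN 0 (ndN (x+6) 0 0) 0))) ∨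
  z = ndN 2 l2 (ndN 0 (ndN (e+6) 0 0) (ndN 0 (ndN (y+6) 0 0) (ndN 0 (ndN (x+6) 0 0) 0)))

theorem sig1_QT {T : Thy} (hT : CompThy T) {k : ℕ} {f1 f2 f3 f4 f5 : (Fin k → ℕ) → ℕ} (h1 : SF f1) (h2 : SF f2) (h3 : SF f3) (h4 : SF f4) (h5 : SF f5) :
    Sig1 (fun v => QT T (f1 v) (f2 v) (f3 v) (f4 v) (f5 v)) := by
  have h0 := sig1_DerB hT
  unfold QT
  refine Sig1.ex (Sig1.and (Sig1.comp1 h0 (SF.var _)) ?_)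
  have e1 := h1.init.init
  have e2 := h2.init.init
  have e3 := h3.init.init
  have e4 := h4.init.init
  have e5 := h5.init.init
  refine Sig1.ball (SF.var _) ?_
  refine Sig1.or ?_ (Sig1.or ?_ (Sig1.or ?_ ?_))
  · repeat' (first | exact SF.var _ | exact SF.const _ | with_reducible apply Sig1.nmem | with_reducible apply SF.add | with_reducible apply SF.mul | with_reducible apply SF.pair | with_reducible apply Sig1.ball | with_reducible apply Sig1.ex | with_reducible apply Sig1.and | with_reducible apply Sig1.or | with_reducible apply Sig1.eq | with_reducible apply Sig1.le | with_reducible apply Sig1.lt | with_reducible apply Sig1.ne)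
  · repeat' (first | exact SF.var _ | exact SF.const _ | with_reducible apply SF.ndN | with_reducible apply SF.add | with_reducible apply SF.mul | with_reducible apply SF.pair | with_reducible apply Sig1.ball | with_reducible apply Sig1.ex | with_reducible apply Sig1.and | with_reducible apply Sig1.or | with_reducible apply Sig1.eq | with_reducible apply Sig1.le | with_reducible apply Sig1.lt | with_reducible apply Sig1.ne)
  · (repeat' (first | exact SF.var _ | exact SF.const _ | with_reducible apply SF.ndN | with_reducible apply SF.add | with_reducible apply SF.mul | with_reducible apply SF.pair | with_reducible apply Sig1.ball | with_reducible apply Sig1.ex | with_reducible apply Sig1.and | with_reducible apply Sig1.or | with_reducible apply Sig1.eq | with_reducible apply Sig1.le | with_reducible apply Sig1.lt | with_reducible apply Sig1.ne)) <;> assumption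
  · (repeat' (first | exact SF.var _ | exact SF.const _ | with_reducible apply SF.ndN | with_reducible apply SF.add | with_reducible apply SF.mul | with_reducible apply SF.pair | with_reducible apply Sig1.ball | with_reducible apply Sig1.ex | with_reducible apply Sig1.and | with_reducible apply Sig1.or | with_reducible apply Sig1.eq | with_reducible apply Sig1.le | with_reducible apply Sig1.lt | with_reducible apply Sig1.ne)) <;> assumption

theorem qt_iff {T : Thy} (hT : ExtPA T) {φ ψ : LA.BoundedFormula Empty 3} {s s' : Sx} (hs : FT φ s) (hs' : FT ψ s') (x y e : ℕ) :
    QT T (cod s) (cod s') x y e ↔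
    ∀ (M : Type) [CommSemiring M] [LinearOrder M] [PAM M], M ⊨ T → ¬ (φ.Realize default ![(x : M), y, e] ∧ ψ.Realize default ![(x : M), y, e]) := by
  rw [← bad_iff hT hs hs']
  constructor
  · rintro ⟨c, hc, h⟩
    refine (derB_mp hc).mono fun t ht => ?_
    rcases h _ (Mem.lt ht).le with h | h | h | h
    · exact absurd ht h
    · exact Or.inl (cod_inj h)
    · exact Or.inr (Or.inl (cod_inj h))
    · exact Or.inr (Or.inr (cod_inj h))
  · intro h
    obtain ⟨c, hc⟩ := code_nat_finset {cod (.nd 3 .leaf .leaf), cod (.nd 2 s (env3 .nd .leaf x y e)), cod (.nd 2 s' (env3 .nd .leaf x y e))}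
    refine ⟨c, derB_mpr h c ?_, fun z _ => ?_⟩
    · intro t ht
      rw [hc]
      rcases ht with rfl | rfl | rfl <;> simp
    · rw [hc]
      by_cases hz : z ∈ ({cod (.nd 3 .leaf .leaf), cod (.nd 2 s (env3 .nd .leaf x y e)), cod (.nd 2 s' (env3 .nd .leaf x y e))} : Finset ℕ)
      · right
        simp only [Finset.mem_insert, Finset.mem_singleton] at hz
        exact hz
      · exact Or.inl hz
set_option linter.all false
set_option linter.unusedSimpArgs false

/-! ### the fixed point -/

abbrev U4 : Type 1 := ∀ (M : Type) [CommSemiring M] [LinearOrder M], M → M → M → M → Prop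
abbrev U3 : Type 1 := ∀ (M : Type) [CommSemiring M] [LinearOrder M], M → M → M → Prop

theorem stage3 {R : ℕ → ℕ → ℕ → Prop} (h : Sig1 (k := 3) (fun v => R (v 0) (v 1) (v 2))) :
    ∃ q : U4, Dl0 (k := 4) (fun M _ _ v => q M (v 0) (v 1) (v 2) (v 3)) ∧ (∀ x y e, R x y e ↔ ∃ B, q ℕ x y e B) ∧
      ∀ x y e B B', B ≤ B' → q ℕ x y e B → q ℕ x y e B' := by
  obtain ⟨P, h1, h2, h3⟩ := h.stage
  have e1 : ∀ x y e B : ℕ, (Fin.snoc ![x, y, e] B : Fin 4 → ℕ) = ![x, y, e, B] := by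
    intro x y e B
    funext i
    fin_cases i <;> rfl
  refine ⟨fun M _ _ x y e B => P M ![x, y, e, B], h1.congr fun M _ _ _ v => ?_, fun x y e => ?_, fun x y e B B' hB => ?_⟩
  · apply iff_of_eq
    congr 1
    funext i
    fin_cases i <;> rfl
  · have := h2 ![x, y, e]
    simp only [e1] at this
    exact this
  · have := h3 ![x, y, e] B B' hB
    simp only [e1] at this
    exact this

theorem stage2 {R : ℕ → ℕ → Prop} (h : Sig1 (k := 2) (fun v => R (v 0) (v 1))) :
    ∃ q : U3, Dl0 (k := 3) (fun M _ _ v => q M (v 0) (v 1) (v 2)) ∧ (∀ x y, R x y ↔ ∃ B, q ℕ x y B) := by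
  obtain ⟨P, h1, h2, h3⟩ := h.stage
  have e1 : ∀ x y B : ℕ, (Fin.snoc ![x, y] B : Fin 3 → ℕ) = ![x, y, B] := by
    intro x y B
    funext i
    fin_cases i <;> rfl
  refine ⟨fun M _ _ x y B => P M ![x, y, B], h1.congr fun M _ _ _ v => ?_, fun x y => ?_⟩
  · apply iff_of_eq
    congr 1
    funext i
    fin_cases i <;> rfl
  · have := h2 ![x, y]
    simp only [e1] at this
    exact this

theorem abs4 {q : U4} (h : Dl0 (k := 4) (fun M _ _ v => q M (v 0) (v 1) (v 2) (v 3))) (M : Type) [CommSemiring M] [LinearOrder M] [PAM M]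
    (x y e B : ℕ) : q M x y e B ↔ q ℕ x y e B := (h.abs M ![x, y, e, B]).symm
theorem abs3 {q : U3} (h : Dl0 (k := 3) (fun M _ _ v => q M (v 0) (v 1) (v 2))) (M : Type) [CommSemiring M] [LinearOrder M] [PAM M]
    (x y B : ℕ) : q M x y B ↔ q ℕ x y B := (h.abs M ![x, y, B]).symm

section
variable {M : Type} [CommSemiring M] [LinearOrder M]
def SS (k : ℕ) (e : M) : Prop := ∃ w, UPi k e (pr 0 w)
def Xi (k : ℕ) (q0 : U4) (q2 : U3) (x y : M) : Prop :=
  ∃ p, ∃ e, (e ≤ p ∧ q0 M x y e p ∧ ∀ m, m ≤ p → ¬ q2 M x y m) ∧ SS k e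
def Nn (k : ℕ) (q1 : U4) (q2 : U3) (x y : M) : Prop :=
  ∃ m, ∃ Y, (q2 M x y m ∧ ∀ e, e ≤ m → ∀ p, p ≤ m → q1 M x y e p → ∃ w, w ≤ Y ∧ Mem (pr e w) Y) ∧
    ∀ e, e ≤ m → ∀ w, w ≤ Y → Mem (pr e w) Y → UPi k e (pr 0 w)
end

theorem sigP_SS {k m : ℕ} {f : UF m} (hf : Trm f) : SigP (k+1) (fun M _ _ v => SS k (f M v)) := by
  unfold SS
  exact SigP.ex (P := fun M _ _ v w => UPi k (f M v) (pr 0 w)) ((univ_def k).2 hf.init (Trm.zero.pr (Trm.var _))).sig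

theorem sigP_Xi {k : ℕ} {q0 : U4} {q2 : U3} (h0 : Dl0 (k := 4) (fun M _ _ v => q0 M (v 0) (v 1) (v 2) (v 3))) 
    (h2 : Dl0 (k := 3) (fun M _ _ v => q2 M (v 0) (v 1) (v 2))) {m : ℕ} {f g : UF m} (hf : Trm f) (hg : Trm g) : 
    SigP (k+1) (fun M _ _ v => Xi k q0 q2 (f M v) (g M v)) := by
  unfold Xi
  refine SigP.ex (P := fun M _ _ v p => ∃ e, (e ≤ p ∧ q0 M (f M v) (g M v) e p ∧ ∀ m, m ≤ p → ¬ q2 M (f M v) (g M v) m) ∧ SS k e) ?_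
  refine SigP.ex (P := fun M _ _ v e => (e ≤ v (Fin.last _) ∧ q0 M (f M (Fin.init v)) (g M (Fin.init v)) e (v (Fin.last _)) ∧ ∀ m, m ≤ (v (Fin.last _)) → ¬ q2 M (f M (Fin.init v)) (g M (Fin.init v)) m) ∧ SS k e) ?_
  refine SigP.and_dl0 ?_ (sigP_SS (Trm.var _))
  refine Dl0.and (Dl0.le (Trm.var _) (Trm.var _).init) (Dl0.and ?_ ?_)
  · exact Dl0.comp4 (F := q0) h0 hf.init.init hg.init.init (Trm.var _) (Trm.var _).init
  · refine Dl0.ball (P := fun M _ _ v m => ¬ q2 M (f M (Fin.init (Fin.init v))) (g M (Fin.init (Fin.init v))) m) (Trm.var _).init ?_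
    exact (Dl0.comp3 (F := q2) h2 hf.init.init.init hg.init.init.init (Trm.var _)).not

theorem sigP_Nn {k : ℕ} {q1 : U4} {q2 : U3} (h1 : Dl0 (k := 4) (fun M _ _ v => q1 M (v 0) (v 1) (v 2) (v 3))) 
    (h2 : Dl0 (k := 3) (fun M _ _ v => q2 M (v 0) (v 1) (v 2))) {m : ℕ} {f g : UF m} (hf : Trm f) (hg : Trm g) : 
    SigP (k+1) (fun M _ _ v => Nn k q1 q2 (f M v) (g M v)) := by
  unfold Nn
  refine SigP.ex (P := fun M _ _ v m => ∃ Y, (q2 M (f M v) (g M v) m ∧ ∀ e, e ≤ m → ∀ p, p ≤ m → q1 M (f M v) (g M v) e p → ∃ w, w ≤ Y ∧ Mem (pr e w) Y) ∧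
    ∀ e, e ≤ m → ∀ w, w ≤ Y → Mem (pr e w) Y → UPi k e (pr 0 w)) ?_
  refine SigP.ex (P := fun M _ _ v Y => (q2 M (f M (Fin.init v)) (g M (Fin.init v)) (v (Fin.last _)) ∧ ∀ e, e ≤ (v (Fin.last _)) → ∀ p, p ≤ (v (Fin.last _)) → q1 M (f M (Fin.init v)) (g M (Fin.init v)) e p → ∃ w, w ≤ Y ∧ Mem (pr e w) Y) ∧
    ∀ e, e ≤ (v (Fin.last _)) → ∀ w, w ≤ Y → Mem (pr e w) Y → UPi k e (pr 0 w)) ?_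
  refine SigP.and_dl0 (Dl0.and ?_ ?_) (PiP.sig ?_)
  · exact Dl0.comp3 (F := q2) h2 hf.init.init hg.init.init (Trm.var _).init
  · refine Dl0.ball (P := fun M _ _ v e => ∀ p, p ≤ Fin.init v (Fin.last _) → q1 M (f M (Fin.init (Fin.init v))) (g M (Fin.init (Fin.init v))) e p → ∃ w, w ≤ v (Fin.last _) ∧ Mem (pr e w) (v (Fin.last _))) (Trm.var _).init ?_
    refine Dl0.ball (P := fun M _ _ v p => q1 M (f M (Fin.init (Fin.init (Fin.init v)))) (g M (Fin.init (Fin.init (Fin.init v)))) (v (Fin.last _)) p → ∃ w, w ≤ Fin.init v (Fin.last _) ∧ Mem (pr (v (Fin.last _)) w) (Fin.init v (Fin.last _))) (Trm.var _).init.init ?_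
    refine Dl0.imp ?_ ?_
    · exact Dl0.comp4 (F := q1) h1 hf.init.init.init.init hg.init.init.init.init (Trm.var _).init (Trm.var _)
    · refine Dl0.bex (P := fun M _ _ v w => Mem (pr (Fin.init v (Fin.last _)) w) (Fin.init (Fin.init v) (Fin.last _))) (Trm.var _).init.init ?_
      exact Dl0.mem ((Trm.var _).init.init.pr (Trm.var _)) (Trm.var _).init.init.init
  · refine PiP.ball (P := fun M _ _ v e => ∀ w, w ≤ v (Fin.last _) → Mem (pr e w) (v (Fin.last _)) → UPi k e (pr 0 w)) (Trm.var _).init ?_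
    refine PiP.ball (P := fun M _ _ v w => Mem (pr (v (Fin.last _)) w) (Fin.init v (Fin.last _)) → UPi k (v (Fin.last _)) (pr 0 w)) (Trm.var _).init ?_
    refine PiP.imp_dl0 ?_ ?_
    · exact Dl0.mem ((Trm.var _).init.pr (Trm.var _)) (Trm.var _).init.init
    · exact (univ_def k).2 (Trm.var _).init (Trm.zero.pr (Trm.var _))

def NM (T : Thy) (P : ∀ (M : Type) [CommSemiring M] [LinearOrder M], Prop) : Prop :=
  ∀ (M : Type) [CommSemiring M] [LinearOrder M] [PAM M], M ⊨ T → ¬ P M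

theorem diag {T U : Thy} (hT : GoodThy T) (hU : GoodThy U) (k : ℕ) : ∃ (q0 q1 : U4) (q2 : U3) (a b : ℕ),
    Dl0 (k := 4) (fun M _ _ v => q0 M (v 0) (v 1) (v 2) (v 3)) ∧ Dl0 (k := 4) (fun M _ _ v => q1 M (v 0) (v 1) (v 2) (v 3)) ∧
    Dl0 (k := 3) (fun M _ _ v => q2 M (v 0) (v 1) (v 2)) ∧
    (∀ x y e B B', B ≤ B' → q0 ℕ x y e B → q0 ℕ x y e B') ∧
    (∀ e : ℕ, (NM T (fun M _ _ => Xi k q0 q2 (a : M) (b : M) ∧ SS k (e : M)) ∨ NM U (fun M _ _ => Xi k q0 q2 (a : M) (b : M) ∧ SS k (e : M))) ↔ ∃ B, q0 ℕ a b e B) ∧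
    (∀ e : ℕ, (NM T (fun M _ _ => ¬ Nn k q1 q2 (a : M) (b : M) ∧ ¬ SS k (e : M)) ∨ NM U (fun M _ _ => ¬ Nn k q1 q2 (a : M) (b : M) ∧ ¬ SS k (e : M))) ↔ ∃ B, q1 ℕ a b e B) ∧
    ((NM T (fun M _ _ => ¬ Xi k q0 q2 (a : M) (b : M) ∧ Nn k q1 q2 (a : M) (b : M)) ∨ NM U (fun M _ _ => ¬ Xi k q0 q2 (a : M) (b : M) ∧ Nn k q1 q2 (a : M) (b : M))) ↔ ∃ B, q2 ℕ a b B) := by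
  obtain ⟨φS, _, hφS⟩ := sigP_SS (k := k) (m := 3) (f := fun M _ _ v => v 2) (Trm.var _)
  obtain ⟨sS, hsS⟩ := FT.total φS
  have key : ∀ {l1 l2 : (Fin 3 → ℕ) → ℕ}, SF l1 → SF l2 → Sig1 (k := 3) (fun v => QT T (l1 v) (l2 v) (v 0) (v 1) (v 2) ∨ QT U (l1 v) (l2 v) (v 0) (v 1) (v 2)) := 
    fun h1 h2 => (sig1_QT hT.1 h1 h2 (SF.var _) (SF.var _) (SF.var _)).or (sig1_QT hU.1 h1 h2 (SF.var _) (SF.var _) (SF.var _))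
  obtain ⟨q0, d0, s0, m0⟩ := stage3 (R := fun x y e => QT T x (cod sS) x y e ∨ QT U x (cod sS) x y e) (key (SF.var _) (SF.const _))
  obtain ⟨q1, d1, s1, m1⟩ := stage3 (R := fun x y e => QT T (ndN 0 y 0) (ndN 0 (cod sS) 0) x y e ∨ QT U (ndN 0 y 0) (ndN 0 (cod sS) 0) x y e)
    (key ((SF.const 0).ndN (SF.var _) (SF.const 0)) (SF.const _))
  obtain ⟨q2, d2, s2⟩ := stage2 (R := fun x y => QT T (ndN 0 x 0) y x y 0 ∨ QT U (ndN 0 x 0) y x y 0)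
    ((sig1_QT hT.1 ((SF.const 0).ndN (SF.var _) (SF.const 0)) (SF.var _) (SF.var _) (SF.var _) (SF.const 0)).or 
      (sig1_QT hU.1 ((SF.const 0).ndN (SF.var _) (SF.const 0)) (SF.var _) (SF.var _) (SF.var _) (SF.const 0)))
  obtain ⟨φX, _, hφX⟩ := sigP_Xi (k := k) d0 d2 (m := 3) (f := fun M _ _ v => v 0) (g := fun M _ _ v => v 1) (Trm.var _) (Trm.var _)
  obtain ⟨φN, _, hφN⟩ := sigP_Nn (k := k) d1 d2 (m := 3) (f := fun M _ _ v => v 0) (g := fun M _ _ v => v 1) (Trm.var _) (Trm.var _)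
  obtain ⟨sX, hsX⟩ := FT.total φX
  obtain ⟨sN, hsN⟩ := FT.total φN
  refine ⟨q0, q1, q2, cod sX, cod sN, d0, d1, d2, m0, fun e => ?_, fun e => ?_, ?_⟩
  · rw [← s0, qt_iff hT.2.2 hsX hsS, qt_iff hU.2.2 hsX hsS]
    refine or_congr ?_ ?_ <;> exact forall_congr' fun M => forall_congr' fun _ => forall_congr' fun _ => forall_congr' fun _ => imp_congr_right fun _ => not_congr (and_congr (hφX M ![(cod sX : M), (cod sN : M), (e : M)]).symm (hφS M ![(cod sX : M), (cod sN : M), (e : M)]).symm)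
  · rw [← s1]
    have := fun {V : Thy} (hV : ExtPA V) => qt_iff hV (hsN.imp FT.bot) (hsS.imp FT.bot) (cod sX) (cod sN) e
    simp only [cod] at this
    rw [this hT.2.2, this hU.2.2]
    refine or_congr ?_ ?_ <;> exact forall_congr' fun M => forall_congr' fun _ => forall_congr' fun _ => forall_congr' fun _ => imp_congr_right fun _ => not_congr (and_congr (not_congr (hφN M ![(cod sX : M), (cod sN : M), (e : M)]).symm) (not_congr (hφS M ![(cod sX : M), (cod sN : M), (e : M)]).symm))
  · rw [← s2]
    have := fun {V : Thy} (hV : ExtPA V) => qt_iff hV (hsX.imp FT.bot) hsN (cod sX) (cod sN) 0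
    simp only [cod] at this
    rw [this hT.2.2, this hU.2.2]
    refine or_congr ?_ ?_ <;> exact forall_congr' fun M => forall_congr' fun _ => forall_congr' fun _ => forall_congr' fun _ => imp_congr_right fun _ => not_congr (and_congr (not_congr (hφX M ![(cod sX : M), (cod sN : M), ((0 : ℕ) : M)]).symm) (hφN M ![(cod sX : M), (cod sN : M), ((0 : ℕ) : M)]).symm)
set_option linter.all false
set_option linter.unusedSimpArgs false

/-! ### the main construction -/

theorem sr_inf (M : Type) [LA.Structure M] (φ ψ : Snt) : M ⊨ (φ ⊓ ψ : Snt) ↔ M ⊨ φ ∧ M ⊨ ψ := BoundedFormula.realize_inf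
theorem sr_sup (M : Type) [LA.Structure M] (φ ψ : Snt) : M ⊨ (φ ⊔ ψ : Snt) ↔ M ⊨ φ ∨ M ⊨ ψ := BoundedFormula.realize_sup
theorem sr_imp (M : Type) [LA.Structure M] (φ ψ : Snt) : M ⊨ (φ ⟹ ψ : Snt) ↔ (M ⊨ φ → M ⊨ ψ) := BoundedFormula.realize_imp
theorem sr_not (M : Type) [LA.Structure M] (φ : Snt) : M ⊨ (∼φ : Snt) ↔ ¬ M ⊨ φ := BoundedFormula.realize_not

theorem mod_add (M : Type) [LA.Structure M] (T : Thy) (φ : Snt) : M ⊨ add T φ ↔ M ⊨ φ ∧ M ⊨ T := by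
  simp only [add, Theory.model_iff, Set.mem_insert_iff, forall_eq_or_imp]

theorem cons_of {T : Thy} (hT : ExtPA T) {n : ℕ} {φ : Snt} (h1 : ConsIn (SigmaS n) T φ) (h2 : ConsIn (PiS n) T φ) : ConsIn (SigAndPiS n) T φ := by
  rintro _ ⟨σ, hσ, π, hπ, rfl⟩ h
  have hT' := extPA_add hT φ
  have a := h1 σ hσ ((prv_iff hT' _).2 fun M _ _ _ hM => ((sr_inf M _ _).1 ((prv_iff hT' _).1 h M hM)).1)
  have b := h2 π hπ ((prv_iff hT' _).2 fun M _ _ _ hM => ((sr_inf M _ _).1 ((prv_iff hT' _).1 h M hM)).2)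
  exact (prv_iff hT _).2 fun M _ _ _ hM => (sr_inf M _ _).2 ⟨(prv_iff hT _).1 a M hM, (prv_iff hT _).1 b M hM⟩

theorem sigP_snt {n : ℕ} {P : UP 0} (h : SigP n P) : ∃ σ : Snt, IsSigmaFml n σ ∧ ∀ (M : Type) [CommSemiring M] [LinearOrder M] [PAM M], M ⊨ σ ↔ P M default := by
  obtain ⟨φ, h1, h2⟩ := h
  exact ⟨φ, h1, fun M _ _ _ => by rw [← h2]; rfl⟩

theorem core {T U : Thy} (hT : GoodThy T) (hU : GoodThy U) (k : ℕ) 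
    {M : Type} [CommSemiring M] [LinearOrder M] [PAM M] (hM : M ⊨ T) {N : Type} [CommSemiring N] [LinearOrder N] [PAM N] (hN : N ⊨ U)
    (hMN : ∀ θ ∈ SigmaS (k+1), M ⊨ θ ↔ N ⊨ θ) :
    ∃ φ ∈ BSigmaS (k+1), ConsIn (SigAndPiS (k+1)) T φ ∧ ConsIn (SigAndPiS (k+1)) U φ ∧ ¬ Prv T φ ∧ ¬ Prv U φ := by
  obtain ⟨q0, q1, q2, a, b, d0, d1, d2, m0, s0, s1, s2⟩ := diag hT hU k
  obtain ⟨σX, cX, hX⟩ := sigP_snt (sigP_Xi (k := k) d0 d2 (Trm.cast a) (Trm.cast b))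
  obtain ⟨σN, cN, hN'⟩ := sigP_snt (sigP_Nn (k := k) d1 d2 (Trm.cast a) (Trm.cast b))
  have hφ : ∀ (M : Type) [CommSemiring M] [LinearOrder M] [PAM M], M ⊨ (σX ⊔ ∼σN : Snt) ↔ (Xi k q0 q2 (a : M) (b : M) ∨ ¬ Nn k q1 q2 (a : M) (b : M)) := by
    intro M _ _ _
    rw [sr_sup, sr_not, hX, hN']
  have hSS : ∀ e : ℕ, SS k (e : M) ↔ SS k (e : N) := by
    intro e
    obtain ⟨σ, c, h⟩ := sigP_snt (sigP_SS (k := k) (m := 0) (Trm.cast e))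
    rw [← h M, ← h N]
    exact hMN σ c
  have hXMN : Xi k q0 q2 (a : M) (b : M) ↔ Xi k q0 q2 (a : N) (b : N) := by rw [← hX M, ← hX N]; exact hMN _ cX
  have hNMN : Nn k q1 q2 (a : M) (b : M) ↔ Nn k q1 q2 (a : N) (b : N) := by rw [← hN' M, ← hN' N]; exact hMN _ cN
  -- no stage of q2
  have nq2 : ∀ m : ℕ, ¬ q2 ℕ a b m := by
    intro m hm
    have hφM : Xi k q0 q2 (a : M) (b : M) ∨ ¬ Nn k q1 q2 (a : M) (b : M) := by
      rcases s2.2 ⟨m, hm⟩ with h | h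
      · have := h M hM
        tauto
      · have := h N hN
        rw [hXMN, hNMN]
        tauto
    rcases hφM with hx | hn
    · have hx' := hx
      obtain ⟨p, e, ⟨hep, h0, h2⟩, hS⟩ := hx
      have hpm : p < (m : M) := by
        by_contra hc
        exact h2 m (not_lt.1 hc) ((abs3 d2 M a b m).2 hm)
      obtain ⟨p, rfl, _⟩ := nat_initial m p hpm.le
      obtain ⟨e, rfl, _⟩ := nat_initial p e hep
      have h0' := (abs4 d0 M a b e p).1 h0
      rcases (s0 e).2 ⟨p, h0'⟩ with h | h
      · exact h M hM ⟨hx', hS⟩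
      · exact h N hN ⟨hXMN.1 hx', (hSS e).1 hS⟩
    · have hS : ∀ e p : ℕ, q1 ℕ a b e p → SS k (e : M) := by
        intro e p h1
        by_contra hc
        rcases (s1 e).2 ⟨p, h1⟩ with h | h
        · exact h M hM ⟨hn, hc⟩
        · exact h N hN ⟨fun hh => hn (hNMN.2 hh), fun hh => hc ((hSS e).2 hh)⟩
      -- a bound for the witnesses
      have hB : ∀ j : ℕ, ∃ B : M, ∀ e < j, SS k (e : M) → ∃ w, UPi k (e : M) (pr 0 w) ∧ pr (e : M) w < B := by
        intro j
        induction j with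
        | zero => exact ⟨0, fun e he => absurd he (by omega)⟩
        | succ j ih =>
          obtain ⟨B, hB⟩ := ih
          by_cases hj : SS k (j : M)
          · obtain ⟨w, hw⟩ := hj
            refine ⟨B + pr (j : M) w + 1, fun e he hs => ?_⟩
            rcases Nat.lt_succ_iff_lt_or_eq.1 he with he | rfl
            · obtain ⟨w', h1, h2⟩ := hB e he hs
              refine ⟨w', h1, h2.trans_le ?_⟩
              rw [add_assoc]
              exact le_self_add
            · exact ⟨w, hw, lt_succ_iff'.2 le_add_self⟩
          · refine ⟨B, fun e he hs => ?_⟩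
            rcases Nat.lt_succ_iff_lt_or_eq.1 he with he | rfl
            · exact hB e he hs
            · exact absurd hs hj
      obtain ⟨B, hB⟩ := hB (m + 1)
      have hdf : Df (k := 1) (fun M _ _ v => ∃ e, ∃ w, v 0 = pr e w ∧ UPi k e (pr 0 w)) := by
        refine Df.ex (P := fun M _ _ v e => ∃ w, v 0 = pr e w ∧ UPi k e (pr 0 w)) ?_
        refine Df.ex (P := fun M _ _ v w => Fin.init v 0 = pr (v (Fin.last _)) w ∧ UPi k (v (Fin.last _)) (pr 0 w)) ?_
        refine Df.and (Dl0.df (Dl0.eq (Trm.var _) ((Trm.var _).init.pr (Trm.var _)))) ?_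
        exact ((univ_def k).2 (Trm.var _).init (Trm.zero.pr (Trm.var _))).df
      obtain ⟨Y, hY⟩ := hdf.code (M := M) Fin.elim0 B
      refine hn ⟨m, Y, ⟨(abs3 d2 M a b m).2 hm, ?_⟩, ?_⟩
      · intro e he p hp h1
        obtain ⟨e, rfl, he'⟩ := nat_initial m e he
        obtain ⟨p, rfl, _⟩ := nat_initial m p hp
        obtain ⟨w, h2, h3⟩ := hB e (by omega) (hS e p ((abs4 d1 M a b e p).1 h1))
        have : Mem (pr (e : M) w) Y := (hY _).2 ⟨h3, e, w, rfl, h2⟩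
        exact ⟨w, (le_pr_right _ _).trans this.lt.le, this⟩
      · intro e he w hw h
        obtain ⟨_, e', w', h1, h2⟩ := (hY _).1 h
        obtain ⟨rfl, rfl⟩ := pr_inj h1
        exact h2
  have nM : ∀ (K : Type) [CommSemiring K] [LinearOrder K] [PAM K] (m : K), q2 K a b m → ∀ p : ℕ, (p : K) ≤ m := by
    intro K _ _ _ m hm p
    by_contra hc
    obtain ⟨m, rfl, _⟩ := nat_initial p m (not_le.1 hc).le
    exact nq2 m ((abs3 d2 K a b m).1 hm)
  have nprv : ∀ V : Thy, ExtPA V → (V = T ∨ V = U) → ¬ Prv V (σX ⊔ ∼σN : Snt) := by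
    intro V hV hTU hp
    have : NM V (fun M _ _ => ¬ Xi k q0 q2 (a : M) (b : M) ∧ Nn k q1 q2 (a : M) (b : M)) := by
      intro K _ _ _ hK
      have := (hφ K).1 ((prv_iff hV _).1 hp K hK)
      tauto
    have : ∃ B, q2 ℕ a b B := by
      apply s2.1
      rcases hTU with rfl | rfl
      · exact Or.inl this
      · exact Or.inr this
    obtain ⟨m, hm⟩ := this
    exact nq2 m hm
  have cns : ∀ V : Thy, ExtPA V → (V = T ∨ V = U) → ConsIn (SigAndPiS (k+1)) V (σX ⊔ ∼σN : Snt) := by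
    intro V hV hTU
    have hV' := extPA_add hV (σX ⊔ ∼σN : Snt)
    refine cons_of hV ?_ ?_
    · intro σ hσ hp
      obtain ⟨e, he⟩ := univ_sigma hσ
      have : NM V (fun M _ _ => ¬ Nn k q1 q2 (a : M) (b : M) ∧ ¬ SS k (e : M)) := by
        rintro K _ _ _ hK ⟨h1, h2⟩
        exact h2 ((he K).2 ((prv_iff hV' _).1 hp K ((mod_add K V _).2 ⟨(hφ K).2 (Or.inr h1), hK⟩)))
      have : ∃ B, q1 ℕ a b e B := by
        apply (s1 e).1
        rcases hTU with rfl | rfl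
        · exact Or.inl this
        · exact Or.inr this
      obtain ⟨p, hp1⟩ := this
      refine (prv_iff hV _).2 fun K _ _ _ hK => ?_
      by_contra hc
      by_cases hn : Nn k q1 q2 (a : K) (b : K)
      · obtain ⟨m, Y, ⟨h1, h2⟩, h3⟩ := hn
        have hl := nM K m h1
        obtain ⟨w, hw, hw'⟩ := h2 e (hl e) p (hl p) ((abs4 d1 K a b e p).2 hp1)
        exact hc ((he K).1 ⟨w, h3 e (hl e) w hw hw'⟩)
      · exact hc ((prv_iff hV' _).1 hp K ((mod_add K V _).2 ⟨(hφ K).2 (Or.inr hn), hK⟩))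
    · intro π hπ hp
      obtain ⟨e, he⟩ := univ_pi hπ
      have : NM V (fun M _ _ => Xi k q0 q2 (a : M) (b : M) ∧ SS k (e : M)) := by
        rintro K _ _ _ hK ⟨h1, h2⟩
        exact (he K).1 h2 ((prv_iff hV' _).1 hp K ((mod_add K V _).2 ⟨(hφ K).2 (Or.inl h1), hK⟩))
      have : ∃ B, q0 ℕ a b e B := by
        apply (s0 e).1
        rcases hTU with rfl | rfl
        · exact Or.inl this
        · exact Or.inr this
      obtain ⟨p, hp1⟩ := this
      have hp2 := m0 a b e p (p + e) (by omega) hp1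
      refine (prv_iff hV _).2 fun K _ _ _ hK => ?_
      by_contra hc
      refine hc ((prv_iff hV' _).1 hp K ((mod_add K V _).2 ⟨(hφ K).2 (Or.inl ?_), hK⟩))
      refine ⟨((p + e : ℕ) : K), e, ⟨?_, (abs4 d0 K a b e (p+e)).2 hp2, ?_⟩, (he K).2 hc⟩
      · push_cast
        exact le_add_self
      · intro m hm h
        obtain ⟨m, rfl, _⟩ := nat_initial _ m hm
        exact nq2 m ((abs3 d2 K a b m).1 h)
  exact ⟨_, .sup (.base cX) (.not (.base cN)), cns T hT.2.2 (Or.inl rfl), cns U hU.2.2 (Or.inr rfl), nprv T hT.2.2 (Or.inl rfl), nprv U hU.2.2 (Or.inr rfl)⟩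
set_option linter.all false
set_option linter.unusedSimpArgs false

/-! ### compactness and the final theorem -/

theorem extPA_union {T : Thy} (hT : ExtPA T) (Γ : Thy) : ExtPA (T ∪ Γ) := by
  intro ψ hψ
  have := hT ψ hψ
  unfold Prv at this ⊢
  rw [Theory.models_sentence_iff] at this ⊢
  intro M
  have hM : M ⊨ T := Theory.Model.mono M.is_model Set.subset_union_left
  exact this (Theory.ModelType.of T M)

theorem compactness {T : Thy} (hT : ExtPA T) (Γ : Thy) (hne : ∃ θ, θ ∈ Γ)
    (hinf : ∀ θ ∈ Γ, ∀ η ∈ Γ, (θ ⊓ η : Snt) ∈ Γ) (h : ∀ θ ∈ Γ, ¬ Prv T (∼θ)) :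
    ∃ (M : Type) (_ : CommSemiring M) (_ : LinearOrder M) (_ : PAM M), M ⊨ T ∧ ∀ θ ∈ Γ, M ⊨ θ := by
  classical
  have hc : ¬ Prv (T ∪ Γ) ⊥ := by
    intro hp
    obtain ⟨F, hF, hb⟩ := Theory.models_iff_finset_models.1 hp
    have key : ∀ G : Finset Snt, (G : Thy) ⊆ T ∪ Γ → ∃ θ ∈ Γ, ∀ (M : Type) [LA.Structure M], M ⊨ T → M ⊨ θ → ∀ ψ ∈ G, M ⊨ ψ := by
      intro G
      induction G using Finset.induction_on with
      | empty =>
        intro _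
        obtain ⟨θ, hθ⟩ := hne
        exact ⟨θ, hθ, fun M _ _ _ ψ hψ => absurd hψ (Finset.notMem_empty ψ)⟩
      | insert x G hx ih =>
        intro hG
        rw [Finset.coe_insert, Set.insert_subset_iff] at hG
        obtain ⟨θ, hθ, h1⟩ := ih hG.2
        rcases hG.1 with hxT | hxΓ
        · refine ⟨θ, hθ, fun M _ hM hMθ ψ hψ => ?_⟩
          rcases Finset.mem_insert.1 hψ with rfl | hψ
          · exact (Theory.model_iff T).1 hM _ hxT
          · exact h1 M hM hMθ ψ hψ
        · refine ⟨θ ⊓ x, hinf _ hθ _ hxΓ, fun M _ hM hMθ ψ hψ => ?_⟩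
          rw [sr_inf] at hMθ
          rcases Finset.mem_insert.1 hψ with rfl | hψ
          · exact hMθ.2
          · exact h1 M hM hMθ.1 ψ hψ
    obtain ⟨θ, hθ, h1⟩ := key F hF
    refine h θ hθ ((prv_iff hT _).2 fun M _ _ _ hM => ?_)
    rw [sr_not]
    intro hMθ
    have : M ⊨ (F : Thy) := (Theory.model_iff _).2 fun ψ hψ => h1 M hM hMθ ψ hψ
    have : Nonempty M := ⟨0⟩
    exact hb.realize_sentence M
  obtain ⟨M, a, b, c, hM, -⟩ := not_prv (extPA_union hT Γ) hc
  refine ⟨M, a, b, c, Theory.Model.mono hM Set.subset_union_left, fun θ hθ => ?_⟩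
  exact (Theory.model_iff _).1 hM _ (Or.inr hθ)

theorem bot_mem (k : ℕ) : IsSigmaFml k (⊥ : Snt) ∧ IsPiFml k (⊥ : Snt) := by
  induction k with
  | zero => exact ⟨.ofDelta0 .falsum, .ofDelta0 .falsum⟩
  | succ k ih => exact ⟨.ofPi ih.2, .ofSigma ih.1⟩

theorem single {V : Thy} (hV : GoodThy V) (k : ℕ) :
    ∃ φ ∈ BSigmaS (k+1), ConsIn (SigAndPiS (k+1)) V φ ∧ ¬ Prv V φ := by
  obtain ⟨M, a, b, c, hM, -⟩ := not_prv hV.2.2 hV.2.1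
  obtain ⟨φ, h1, h2, _, h3, _⟩ := core hV hV k hM hM (fun _ _ => Iff.rfl)
  exact ⟨φ, h1, h2, h3⟩

theorem transfer {V : Thy} (hV : ExtPA V) {Γ : Set Snt} {φ ψ : Snt}
    (h : ∀ (M : Type) [CommSemiring M] [LinearOrder M] [PAM M], M ⊨ V → (M ⊨ φ ↔ M ⊨ ψ))
    (hc : ConsIn Γ V φ) (hn : ¬ Prv V φ) : ConsIn Γ V ψ ∧ ¬ Prv V ψ := by
  constructor
  · intro γ hγ hp
    refine hc γ hγ ((prv_iff (extPA_add hV φ) _).2 fun M _ _ _ hM => ?_)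
    refine (prv_iff (extPA_add hV ψ) _).1 hp M ?_
    rw [mod_add] at hM ⊢
    exact ⟨(h M hM.2).1 hM.1, hM.2⟩
  · intro hp
    exact hn ((prv_iff hV _).2 fun M _ _ _ hM => (h M hM).2 ((prv_iff hV _).1 hp M hM))

theorem main_thm {T U : Thy} (hT : GoodThy T) (hU : GoodThy U) (k : ℕ) :
    ∃ φ ∈ BSigmaS (k+1), ConsIn (SigAndPiS (k+1)) T φ ∧ ConsIn (SigAndPiS (k+1)) U φ ∧ ¬ Prv T φ ∧ ¬ Prv U φ := by
  by_cases hθ : ∃ θ ∈ BSigmaS (k+1), Prv T θ ∧ Prv U (∼θ)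
  · obtain ⟨θ, hθ, t, u⟩ := hθ
    obtain ⟨φ, f1, f2, f3⟩ := single hT k
    obtain ⟨ψ, g1, g2, g3⟩ := single hU k
    obtain ⟨a1, a2⟩ := transfer (ψ := (θ ⟹ φ) ⊓ (∼θ ⟹ ψ)) hT.2.2 (fun M _ _ _ hM => by
      have := (prv_iff hT.2.2 _).1 t M hM
      rw [sr_inf, sr_imp, sr_imp, sr_not]
      tauto) f2 f3
    obtain ⟨b1, b2⟩ := transfer (ψ := (θ ⟹ φ) ⊓ (∼θ ⟹ ψ)) hU.2.2 (fun M _ _ _ hM => by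
      have := (prv_iff hU.2.2 _).1 u M hM
      rw [sr_not] at this
      rw [sr_inf, sr_imp, sr_imp, sr_not]
      tauto) g2 g3
    exact ⟨_, .inf (.imp hθ f1) (.imp (.not hθ) g1), a1, b1, a2, b2⟩
  · push Not at hθ
    have htop : (∼(⊥ : Snt) : Snt) ∈ BSigmaS (k+1) := .not (.base (bot_mem (k+1)).1)
    obtain ⟨M, _, _, _, hM, hM'⟩ := compactness hT.2.2 (ThIn (BSigmaS (k+1)) U)
      ⟨∼(⊥ : Snt), htop, (prv_iff hU.2.2 _).2 fun M _ _ _ _ => by rw [sr_not]; exact id⟩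
      (by
        rintro θ ⟨a, b⟩ η ⟨c, d⟩
        exact ⟨.inf a c, (prv_iff hU.2.2 _).2 fun M _ _ _ hM => (sr_inf M _ _).2
          ⟨(prv_iff hU.2.2 _).1 b M hM, (prv_iff hU.2.2 _).1 d M hM⟩⟩)
      (by
        rintro θ ⟨a, b⟩ hp
        refine hθ _ (.not a) hp ((prv_iff hU.2.2 _).2 fun M _ _ _ hM => ?_)
        rw [sr_not, sr_not, not_not]
        exact (prv_iff hU.2.2 _).1 b M hM)
    obtain ⟨N, _, _, _, hN, hN'⟩ := compactness hU.2.2 {θ | θ ∈ BSigmaS (k+1) ∧ M ⊨ θ}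
      ⟨∼(⊥ : Snt), htop, by rw [sr_not]; exact id⟩
      (by
        rintro θ ⟨a, b⟩ η ⟨c, d⟩
        exact ⟨.inf a c, (sr_inf M _ _).2 ⟨b, d⟩⟩)
      (by
        rintro θ ⟨a, b⟩ hp
        exact (sr_not M _).1 (hM' _ ⟨.not a, hp⟩) b)
    refine core hT hU k hM hN fun θ hθ => ⟨fun h => hN' _ ⟨.base hθ, h⟩, fun h => ?_⟩
    by_contra hc
    exact (sr_not N _).1 (hN' _ ⟨.not (.base hθ), (sr_not M _).2 hc⟩) h


/-- Theorem 8.3. -/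
theorem stmt_19 (T U : Thy) (hT : GoodThy T) (hU : GoodThy U) (n : ℕ) (hn : 1 ≤ n) :
    ∃ φ ∈ BSigmaS n, ConsIn (SigAndPiS n) T φ ∧ ConsIn (SigAndPiS n) U φ ∧
      ¬ Prv T φ ∧ ¬ Prv U φ := by
  obtain ⟨k, rfl⟩ : ∃ k, n = k + 1 := ⟨n - 1, by omega⟩
  exact main_thm hT hU k

end Guaspari
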